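/- BV estimate for finite Morse index solutions of fractional Allen–Cahn (Euclidean version): let n ≥ 1, s₀ ∈ (0,1) and m ∈ ℕ. There exists C = C(n,s₀,m) > 0 such that for every s ∈ (s₀,1), every ε > 0, every R > 0, every p ∈ ℝ^n, and every continuously differentiable solution u : ℝ^n → (-1,1) of the fractional Allen–Cahn equation with parameters s, ε in B_R(p) ⊆ ℝ^n which has bounded gradient and Morse index at most m in B_R(p), one has ∫_{B_{R/2}(p)} |∇u| dx ≤ (C/(1-s))·R^{n-1}. -/

import Mathlib

open MeasureTheory Real Set Metric Filter Topology

noncomputable section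

/-- Euclidean `n`-space. -/
abbrev Rn (n : ℕ) : Type := EuclideanSpace ℝ (Fin n)

/-- The normalizing constant `α_{n,s}` of the fractional Laplacian kernel. -/
def alphaC (n : ℕ) (s : ℝ) : ℝ :=
  s * 2 ^ (s - 1) * Real.Gamma (((n : ℝ) + s) / 2) /
    (Real.pi ^ ((n : ℝ) / 2) * Real.Gamma (1 - s / 2))

/-- The fractional kernel `α_{n,s} |x-y|^{-(n+s)}`. -/
def fracKer (n : ℕ) (s : ℝ) (x y : Rn n) : ℝ :=
  alphaC n s * ‖x - y‖ ^ (-((n : ℝ) + s))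

/-- The double-well potential `W(t) = (1-t²)²/4`. -/
def Wpot (t : ℝ) : ℝ := (1 - t ^ 2) ^ 2 / 4

/-- `u` solves the fractional Allen–Cahn equation
`(-Δ)^{s/2} u + ε^{-s} W'(u) = 0` (with `W'(t) = t³ - t`) in the open set `O`. -/
def IsACSol (n : ℕ) (s ε : ℝ) (u : Rn n → ℝ) (O : Set (Rn n)) : Prop :=
  ∀ x ∈ O, (∫ y, (u x - u y) * fracKer n s x y) + ε ^ (-s) * (u x ^ 3 - u x) = 0

/-- The second-variation quadratic form of the fractional Allen–Cahn energy at `u` in `Ω`,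
with `W''(t) = 3t² - 1`. -/
def Qform (n : ℕ) (s ε : ℝ) (u : Rn n → ℝ) (Ω : Set (Rn n)) (ξ : Rn n → ℝ) : ℝ :=
  (1 / 4) * (∫ p in ((Ωᶜ ×ˢ Ωᶜ)ᶜ : Set (Rn n × Rn n)),
      (ξ p.1 - ξ p.2) ^ 2 * fracKer n s p.1 p.2) +
    ε ^ (-s) * ∫ x in Ω, (3 * u x ^ 2 - 1) * ξ x ^ 2

/-- `ξ` is a `C¹` function compactly supported in `Ω`. -/
def IsCc1On (n : ℕ) (Ω : Set (Rn n)) (ξ : Rn n → ℝ) : Prop :=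
  ContDiff ℝ 1 ξ ∧ HasCompactSupport ξ ∧ tsupport ξ ⊆ Ω

/-- The Morse index of `u` in `Ω` is at most `m`: there is no `(m+1)`-dimensional subspace
of `C_c¹(Ω)` on which the second variation is negative definite. -/
def ACMorseIndexLE (n : ℕ) (s ε : ℝ) (u : Rn n → ℝ) (Ω : Set (Rn n)) (m : ℕ) : Prop :=
  ∀ ξ : Fin (m + 1) → Rn n → ℝ, (∀ i, IsCc1On n Ω (ξ i)) → LinearIndependent ℝ ξ →
    ∃ a : Fin (m + 1) → ℝ, a ≠ 0 ∧ 0 ≤ Qform n s ε u Ω (fun x => ∑ i, a i * ξ i x)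

/-- `u` is `Λ`-almost stable in `Ω`: `Q_Ω(ξ) ≥ -Λ (∫_Ω |ξ|)²` for all `ξ ∈ C_c¹(Ω)`. -/
def AlmostStable (n : ℕ) (s ε Λ : ℝ) (u : Rn n → ℝ) (Ω : Set (Rn n)) : Prop :=
  ∀ ξ : Rn n → ℝ, IsCc1On n Ω ξ → -(Λ * (∫ x in Ω, |ξ x|) ^ 2) ≤ Qform n s ε u Ω ξ

end

namespace FracAC

noncomputable section

/-- The volume of the unit ball. -/
def omega (n : ℕ) : ℝ := volume.real (ball (0 : Rn n) 1)

lemma omega_pos (n : ℕ) : 0 < omega n :=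
  ENNReal.toReal_pos (measure_ball_pos _ _ one_pos).ne' measure_ball_lt_top.ne

lemma volume_ball {n : ℕ} (x : Rn n) {r : ℝ} (hr : 0 < r) :
    volume.real (ball x r) = omega n * r ^ n := by
  rw [omega, Measure.real, Measure.addHaar_ball_of_pos _ _ hr, ENNReal.toReal_mul,
    ENNReal.toReal_ofReal (by positivity), finrank_euclideanSpace_fin, mul_comm]
  rfl

lemma radial_lt {n : ℕ} (hn : 1 ≤ n) {p ρ : ℝ} (hp : 0 < p) (hρ : 0 < ρ) :
    Integrable (fun z : Rn n => if ‖z‖ < ρ then ‖z‖ ^ (p - n) else 0) ∧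
    ∫ z : Rn n, (if ‖z‖ < ρ then ‖z‖ ^ (p - n) else 0) = n * omega n * (ρ ^ p / p) := by
  have hnt : Nontrivial (Rn n) := by
    have : Nonempty (Fin n) := ⟨⟨0, hn⟩⟩
    infer_instance
  have key : ∀ y ∈ Ioi (0 : ℝ), y ^ (Module.finrank ℝ (Rn n) - 1) •
      (if y < ρ then y ^ (p - n) else 0) = (Iio ρ).indicator (fun y => y ^ (p - 1)) y := by
    intro y hy
    have hy : 0 < y := hy
    rw [finrank_euclideanSpace_fin]
    by_cases h : y < ρ
    · simp only [h, if_true, smul_eq_mul, indicator, mem_Iio]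
      rw [← rpow_natCast, ← rpow_add hy]
      congr 1
      push_cast [hn]
      ring
    · simp [h, indicator]
  have hio : IntegrableOn (fun y : ℝ => y ^ (p - 1)) (Ioo 0 ρ) := by
    have := intervalIntegral.intervalIntegrable_rpow' (a := 0) (b := ρ) (r := p - 1) (by linarith)
    rw [intervalIntegrable_iff_integrableOn_Ioo_of_le hρ.le] at this
    exact this
  constructor
  · rw [integrable_fun_norm_addHaar volume (f := fun y => if y < ρ then y ^ (p - n) else 0)]
    rw [integrableOn_congr_fun key measurableSet_Ioi, IntegrableOn,
      integrable_indicator_iff measurableSet_Iio, IntegrableOn,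
      Measure.restrict_restrict measurableSet_Iio, inter_comm, Ioi_inter_Iio]
    exact hio
  · rw [integral_fun_norm_addHaar volume (fun y => if y < ρ then y ^ (p - n) else 0)]
    rw [setIntegral_congr_fun measurableSet_Ioi key, setIntegral_indicator measurableSet_Iio,
      Ioi_inter_Iio, ← integral_Ioc_eq_integral_Ioo, ← intervalIntegral.integral_of_le hρ.le,
      integral_rpow (Or.inl (by linarith)), finrank_euclideanSpace_fin]
    rw [zero_rpow (by linarith), sub_add_cancel, nsmul_eq_mul, smul_eq_mul]
    simp only [omega]
    ring

lemma radial_ge {n : ℕ} (hn : 1 ≤ n) {p ρ : ℝ} (hp : 0 < p) (hρ : 0 < ρ) :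
    Integrable (fun z : Rn n => if ‖z‖ < ρ then 0 else ‖z‖ ^ (-p - n)) ∧
    ∫ z : Rn n, (if ‖z‖ < ρ then 0 else ‖z‖ ^ (-p - n)) = n * omega n * (ρ ^ (-p) / p) := by
  have hnt : Nontrivial (Rn n) := by
    have : Nonempty (Fin n) := ⟨⟨0, hn⟩⟩
    infer_instance
  have key : ∀ y ∈ Ioi (0 : ℝ), y ^ (Module.finrank ℝ (Rn n) - 1) •
      (if y < ρ then 0 else y ^ (-p - n)) = (Ici ρ).indicator (fun y => y ^ (-p - 1)) y := by
    intro y hy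
    have hy : 0 < y := hy
    rw [finrank_euclideanSpace_fin]
    by_cases h : y < ρ
    · simp [h, indicator]
    · simp only [h, if_false, smul_eq_mul, indicator, mem_Ici, not_lt.1 h, if_true]
      rw [← rpow_natCast, ← rpow_add hy]
      congr 1
      push_cast [hn]
      ring
  have hsub : Ici ρ ∩ Ioi 0 = Ici ρ := inter_eq_left.2 fun y hy => lt_of_lt_of_le hρ hy
  constructor
  · rw [integrable_fun_norm_addHaar volume (f := fun y => if y < ρ then 0 else y ^ (-p - n))]
    rw [integrableOn_congr_fun key measurableSet_Ioi, IntegrableOn,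
      integrable_indicator_iff measurableSet_Ici, IntegrableOn,
      Measure.restrict_restrict measurableSet_Ici, hsub, ← IntegrableOn,
      integrableOn_Ici_iff_integrableOn_Ioi]
    exact integrableOn_Ioi_rpow_of_lt (by linarith) hρ
  · rw [integral_fun_norm_addHaar volume (fun y => if y < ρ then 0 else y ^ (-p - n))]
    rw [setIntegral_congr_fun measurableSet_Ioi key, setIntegral_indicator measurableSet_Ici,
      inter_comm, hsub, integral_Ici_eq_integral_Ioi,
      integral_Ioi_rpow_of_lt (by linarith) hρ, finrank_euclideanSpace_fin]
    rw [sub_add_cancel, nsmul_eq_mul, smul_eq_mul, neg_div_neg_eq]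
    simp only [omega]
    ring

/-- The kernel `|z|^{-(n+s)}`. -/
def J (n : ℕ) (s : ℝ) (z : Rn n) : ℝ := ‖z‖ ^ (-((n : ℝ) + s))

lemma J_nonneg {n : ℕ} {s : ℝ} (z : Rn n) : 0 ≤ J n s z := rpow_nonneg (norm_nonneg _) _

lemma J_neg {n : ℕ} {s : ℝ} (z : Rn n) : J n s (-z) = J n s z := by simp [J]

lemma J_sub_comm {n : ℕ} {s : ℝ} (x y : Rn n) : J n s (x - y) = J n s (y - x) := by
  rw [← J_neg, neg_sub]

@[fun_prop]
lemma measurable_J {n : ℕ} {s : ℝ} : Measurable (J n s) := by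
  unfold J; fun_prop

/-- The kernel truncated near the origin, with an extra decay exponent. -/
def kq (n : ℕ) (q η : ℝ) (z : Rn n) : ℝ := max ‖z‖ η ^ (-((n : ℝ) + q))

lemma kq_nonneg {n : ℕ} {q η : ℝ} (z : Rn n) : 0 ≤ kq n q η z :=
  rpow_nonneg (le_max_of_le_left (norm_nonneg _)) _

lemma kq_neg {n : ℕ} {q η : ℝ} (z : Rn n) : kq n q η (-z) = kq n q η z := by simp [kq]

@[fun_prop]
lemma measurable_kq {n : ℕ} {q η : ℝ} : Measurable (kq n q η) := by
  unfold kq; fun_prop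

lemma kq_integral {n : ℕ} (hn : 1 ≤ n) {q η : ℝ} (hq : 0 < q) (hη : 0 < η) :
    Integrable (kq n q η) ∧ ∫ z, kq n q η z = omega n * (1 + n / q) * η ^ (-q) := by
  have hn' : (0 : ℝ) < n := by exact_mod_cast hn
  obtain ⟨h1, h2⟩ := radial_lt hn hn' hη
  obtain ⟨h3, h4⟩ := radial_ge hn hq hη
  have heq : kq n q η = fun z => η ^ (-((n : ℝ) + q)) *
      (if ‖z‖ < η then ‖z‖ ^ ((n : ℝ) - n) else 0) +
      (if ‖z‖ < η then 0 else ‖z‖ ^ (-q - n)) := by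
    funext z
    unfold kq
    split_ifs with h
    · simp [max_eq_right h.le]
    · rw [max_eq_left (not_lt.1 h)]
      simp only [mul_zero, zero_add]
      congr 1
      ring
  rw [heq]
  refine ⟨(h1.const_mul _).add h3, ?_⟩
  rw [integral_add (h1.const_mul _) h3, integral_const_mul, h2, h4]
  have : η ^ (-((n : ℝ) + q)) * η ^ (n : ℝ) = η ^ (-q) := by
    rw [← rpow_add hη]; congr 1; ring
  field_simp
  linear_combination (q * omega n) * this

/-- The quadratically weighted kernel near the origin. -/
def mq (n : ℕ) (s η : ℝ) (z : Rn n) : ℝ := if ‖z‖ < η then ‖z‖ ^ 2 * J n s z else 0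

lemma mq_nonneg {n : ℕ} {s η : ℝ} (z : Rn n) : 0 ≤ mq n s η z := by
  unfold mq; split_ifs
  · exact mul_nonneg (by positivity) (J_nonneg z)
  · exact le_rfl

lemma mq_integral {n : ℕ} (hn : 1 ≤ n) {s η : ℝ} (hs : s ∈ Ioo (0 : ℝ) 1) (hη : 0 < η) :
    Integrable (mq n s η) ∧ ∫ z, mq n s η z ≤ n * omega n * η ^ (2 - s) := by
  obtain ⟨hs0, hs1⟩ := hs
  have hn' : (1 : ℝ) ≤ n := by exact_mod_cast hn
  obtain ⟨h1, h2⟩ := radial_lt hn (p := 2 - s) (by linarith) hη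
  have heq : mq n s η = fun z => (if ‖z‖ < η then ‖z‖ ^ (2 - s - n) else 0) := by
    funext z
    unfold mq J
    split_ifs with h
    · rcases eq_or_ne z 0 with rfl | hz
      · have : (2 - s - n) ≠ 0 := by
          intro h0
          have h1 : (1 : ℝ) < n := by linarith
          have h2 : (n : ℝ) < 2 := by linarith
          have h3 : 1 < n := by exact_mod_cast h1
          have h4 : n < 2 := by exact_mod_cast h2
          omega
        simp [zero_rpow this]
      · have : 0 < ‖z‖ := norm_pos_iff.2 hz
        rw [← rpow_natCast, ← rpow_add this]
        congr 1
        push_cast; ring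
    · rfl
  rw [heq]
  refine ⟨h1, h2.trans_le ?_⟩
  have : 0 < omega n := omega_pos n
  gcongr
  exact div_le_self (by positivity) (by linarith)

/-- The kernel weighted by the modulus `min (|z|/r) 1`. -/
def mlin (n : ℕ) (s r : ℝ) (z : Rn n) : ℝ := min (‖z‖ / r) 1 * J n s z

lemma mlin_nonneg {n : ℕ} {s r : ℝ} (hr : 0 < r) (z : Rn n) : 0 ≤ mlin n s r z :=
  mul_nonneg (le_min (by positivity) zero_le_one) (J_nonneg z)

lemma mlin_integral {n : ℕ} (hn : 1 ≤ n) {s r : ℝ} (hs : s ∈ Ioo (0 : ℝ) 1) (hr : 0 < r) :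
    Integrable (mlin n s r) ∧
      ∫ z, mlin n s r z = n * omega n * (1 / (1 - s) + 1 / s) * r ^ (-s) := by
  obtain ⟨hs0, hs1⟩ := hs
  have hn' : (1 : ℝ) ≤ n := by exact_mod_cast hn
  obtain ⟨h1, h2⟩ := radial_lt hn (p := 1 - s) (by linarith) hr
  obtain ⟨h3, h4⟩ := radial_ge hn (p := s) hs0 hr
  have heq : mlin n s r = fun z => r⁻¹ * (if ‖z‖ < r then ‖z‖ ^ (1 - s - n) else 0) +
      (if ‖z‖ < r then 0 else ‖z‖ ^ (-s - n)) := by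
    funext z
    unfold mlin J
    split_ifs with h
    · rw [min_eq_left ((div_le_one hr).2 h.le)]
      rcases eq_or_ne z 0 with rfl | hz
      · have : (1 - s - n) ≠ 0 := by
          intro h0
          linarith
        simp [zero_rpow this]
      · have : 0 < ‖z‖ := norm_pos_iff.2 hz
        rw [div_eq_mul_inv, mul_comm ‖z‖, mul_assoc, add_zero]
        congr 1
        nth_rewrite 1 [← rpow_one ‖z‖]
        rw [← rpow_add this]
        congr 1
        ring
    · rw [min_eq_right ((one_le_div hr).2 (not_lt.1 h))]
      simp only [mul_zero, zero_add, one_mul]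
      congr 1
      ring
  rw [heq]
  refine ⟨(h1.const_mul _).add h3, ?_⟩
  rw [integral_add (h1.const_mul _) h3, integral_const_mul, h2, h4]
  have : r⁻¹ * r ^ (1 - s) = r ^ (-s) := by
    rw [← rpow_neg_one, ← rpow_add hr]; congr 1; ring
  have h5 : (1 - s) ≠ 0 := by linarith
  rw [← this]
  field_simp

/-- Lipschitz bound for the truncated kernel. -/
lemma kq_sub_le {n : ℕ} {q η : ℝ} (hq : 0 ≤ q) (hη : 0 < η) (z h : Rn n) :
    |kq n q η (z + h) - kq n q η z| ≤
      (n + q) * ‖h‖ * (kq n (q + 1) η (z + h) + kq n (q + 1) η z) := by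
  have main : ∀ a b : ℝ, 0 < a → a ≤ b →
      a ^ (-((n : ℝ) + q)) - b ^ (-((n : ℝ) + q)) ≤
        (n + q) * (b - a) * a ^ (-((n : ℝ) + (q + 1))) := by
    intro a b ha hab
    have hb : 0 < b := ha.trans_le hab
    set e := (n : ℝ) + q
    have he : 0 ≤ e := by positivity
    have h1 : 1 - e * (b / a - 1) ≤ (b / a) ^ (-e) := by
      have h2 := add_one_le_exp (-(e * Real.log (b / a)))
      have h3 := Real.log_le_sub_one_of_pos (div_pos hb ha)
      rw [rpow_def_of_pos (div_pos hb ha)]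
      have h4 : Real.log (b / a) * -e = -(e * Real.log (b / a)) := by ring
      rw [h4]
      nlinarith
    have h5 : b ^ (-e) = a ^ (-e) * (b / a) ^ (-e) := by
      rw [div_rpow hb.le ha.le]
      field_simp
    have h6 : a ^ (-((n : ℝ) + (q + 1))) = a ^ (-e) * a⁻¹ := by
      rw [← rpow_neg_one, ← rpow_add ha]
      congr 1
      simp only [e]; ring
    rw [h5, h6]
    have h7 : 0 < a ^ (-e) := rpow_pos_of_pos ha _
    have h8 : e * (b / a - 1) = e * (b - a) * a⁻¹ := by field_simp
    nlinarith
  have hA : 0 < max ‖z + h‖ η := lt_max_of_lt_right hη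
  have hB : 0 < max ‖z‖ η := lt_max_of_lt_right hη
  have hd : |max ‖z + h‖ η - max ‖z‖ η| ≤ ‖h‖ := by
    refine (abs_max_sub_max_le_abs _ _ _).trans ?_
    simpa using abs_norm_sub_norm_le (z + h) z
  obtain ⟨hd1, hd2⟩ := abs_le.1 hd
  have hK1 := kq_nonneg (n := n) (q := q + 1) (η := η) (z + h)
  have hK2 := kq_nonneg (n := n) (q := q + 1) (η := η) z
  have hc : 0 ≤ (n : ℝ) + q := by positivity
  rcases le_total (max ‖z + h‖ η) (max ‖z‖ η) with hle | hle
  · have := main _ _ hA hle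
    have h0 : kq n q η z ≤ kq n q η (z + h) :=
      rpow_le_rpow_of_nonpos hA hle (by linarith)
    rw [abs_of_nonneg (by linarith)]
    refine this.trans ?_
    refine mul_le_mul (mul_le_mul_of_nonneg_left (by linarith) hc) ?_ hK1 (by positivity)
    unfold kq at *
    linarith
  · have := main _ _ hB hle
    have h0 : kq n q η (z + h) ≤ kq n q η z :=
      rpow_le_rpow_of_nonpos hB hle (by linarith)
    rw [abs_sub_comm, abs_of_nonneg (by linarith)]
    refine this.trans ?_
    refine mul_le_mul (mul_le_mul_of_nonneg_left (by linarith) hc) ?_ hK2 (by positivity)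
    unfold kq at *
    linarith

end

end FracAC

namespace FracAC

noncomputable section

variable {n : ℕ} {s : ℝ}

lemma conv_snd {f m : Rn n → ℝ} (hf : Integrable f) (hm : Integrable m) :
    Integrable (fun p : Rn n × Rn n => f p.2 * m (p.1 - p.2)) ∧
    ∫ p : Rn n × Rn n, f p.2 * m (p.1 - p.2) = (∫ x, f x) * ∫ x, m x := by
  have hmp := measurePreserving_prod_sub_swap (G := Rn n) volume volume
  have hi : Integrable (fun q : Rn n × Rn n => f q.1 * m q.2) := hf.mul_prod hm
  constructor
  · exact hmp.integrable_comp_of_integrable hi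
  · rw [← integral_prod_mul (μ := volume) (ν := volume) f m, ← hmp.map_eq,
      integral_map hmp.aemeasurable (by rw [hmp.map_eq]; exact hi.aestronglyMeasurable)]
    rfl

lemma conv_fst {f m : Rn n → ℝ} (hf : Integrable f) (hm : Integrable m)
    (hev : ∀ z, m (-z) = m z) :
    Integrable (fun p : Rn n × Rn n => f p.1 * m (p.1 - p.2)) ∧
    ∫ p : Rn n × Rn n, f p.1 * m (p.1 - p.2) = (∫ x, f x) * ∫ x, m x := by
  obtain ⟨h1, h2⟩ := conv_snd hf hm
  have he : ∀ p : Rn n × Rn n, f p.1 * m (p.1 - p.2) =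
      (fun p : Rn n × Rn n => f p.2 * m (p.1 - p.2)) p.swap := by
    intro p
    simp only [Prod.fst_swap, Prod.snd_swap]
    rw [← hev, neg_sub]
  simp_rw [he]
  refine ⟨h1.swap, ?_⟩
  rw [← h2]
  exact integral_prod_swap (μ := (volume : Measure (Rn n))) (ν := (volume : Measure (Rn n)))
    (fun p : Rn n × Rn n => f p.2 * m (p.1 - p.2))

lemma integral_swap_symm (F : Rn n × Rn n → ℝ) :
    ∫ p : Rn n × Rn n, F p.swap = ∫ p, F p :=
  integral_prod_swap (μ := (volume : Measure (Rn n))) (ν := (volume : Measure (Rn n))) F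

/-- The indicator function of a ball. -/
def ib (z : Rn n) (r : ℝ) : Rn n → ℝ := (ball z r).indicator 1

lemma ib_nonneg (z : Rn n) (r : ℝ) (x : Rn n) : 0 ≤ ib z r x :=
  indicator_nonneg (fun _ _ => zero_le_one) x

lemma ib_of_mem {z : Rn n} {r : ℝ} {x : Rn n} (h : x ∈ ball z r) : ib z r x = 1 := by
  simp only [ib, indicator_of_mem h, Pi.one_apply]

lemma ib_of_notMem {z : Rn n} {r : ℝ} {x : Rn n} (h : x ∉ ball z r) : ib z r x = 0 := by
  simp only [ib, indicator_of_notMem h]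

lemma ib_integrable (z : Rn n) (r : ℝ) : Integrable (ib z r) := by
  unfold ib
  rw [integrable_indicator_iff measurableSet_ball]
  exact integrableOn_const measure_ball_lt_top.ne

lemma ib_integral (z : Rn n) {r : ℝ} (hr : 0 < r) : ∫ x, ib z r x = omega n * r ^ n := by
  unfold ib
  rw [integral_indicator measurableSet_ball]
  simp [volume_ball z hr]

lemma int_dom {F : Rn n × Rn n → ℝ} {m : Rn n → ℝ} {c : ℝ} {z : Rn n} {r : ℝ}
    (hF : AEStronglyMeasurable F) (hm : Integrable m) (hev : ∀ z, m (-z) = m z)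
    (h : ∀ p, |F p| ≤ c * ((ib z r p.1 + ib z r p.2) * m (p.1 - p.2))) : Integrable F := by
  have h1 := (conv_fst (ib_integrable z r) hm hev).1
  have h2 := (conv_snd (ib_integrable z r) hm).1
  refine ((h1.add h2).const_mul c).mono' hF (Eventually.of_forall fun p => ?_)
  simpa [add_mul] using h p

lemma integral_le_dom {F : Rn n × Rn n → ℝ} {m : Rn n → ℝ} {c : ℝ} {z : Rn n} {r : ℝ}
    (hr : 0 < r) (hm : Integrable m) (hev : ∀ z, m (-z) = m z)
    (h : ∀ p, |F p| ≤ c * ((ib z r p.1 + ib z r p.2) * m (p.1 - p.2))) :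
    |∫ p, F p| ≤ c * (2 * (omega n * r ^ n) * ∫ x, m x) := by
  have h1 := conv_fst (ib_integrable z r) hm hev
  have h2 := conv_snd (ib_integrable z r) hm
  have h3 : ∫ p : Rn n × Rn n, c * ((ib z r p.1 + ib z r p.2) * m (p.1 - p.2)) =
      c * (2 * (omega n * r ^ n) * ∫ x, m x) := by
    simp_rw [add_mul]
    rw [integral_const_mul, integral_add h1.1 h2.1, h1.2, h2.2, ib_integral z hr]
    ring
  rw [← h3, ← Real.norm_eq_abs]
  refine norm_integral_le_of_norm_le ?_ (Eventually.of_forall h)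
  simp_rw [add_mul]
  exact (h1.1.add h2.1).const_mul c

/-- A bounded Lipschitz function. -/
structure BddLip (w : Rn n → ℝ) (C : ℝ) : Prop where
  bd : ∀ x, |w x| ≤ C
  lip : ∀ x y, |w x - w y| ≤ C * ‖x - y‖

lemma BddLip.nonneg {w : Rn n → ℝ} {C : ℝ} (h : BddLip w C) : 0 ≤ C :=
  (abs_nonneg _).trans (h.bd 0)

lemma BddLip.continuous {w : Rn n → ℝ} {C : ℝ} (h : BddLip w C) : Continuous w := by
  have : LipschitzWith ⟨C, h.nonneg⟩ w := by
    refine LipschitzWith.of_dist_le_mul fun x y => ?_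
    rw [Real.dist_eq, dist_eq_norm]
    exact h.lip x y
  exact this.continuous

lemma BddLip.mul {w v : Rn n → ℝ} {C D : ℝ} (h : BddLip w C) (h' : BddLip v D) :
    BddLip (fun x => w x * v x) (2 * C * D) := by
  have hC := h.nonneg
  have hD := h'.nonneg
  constructor
  · intro x
    rw [abs_mul]
    have := mul_le_mul (h.bd x) (h'.bd x) (abs_nonneg _) hC
    nlinarith [mul_nonneg hC hD]
  · intro x y
    have e : w x * v x - w y * v y = w x * (v x - v y) + (w x - w y) * v y := by ring
    rw [e]
    refine (abs_add_le _ _).trans ?_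
    rw [abs_mul, abs_mul]
    have h1 := mul_le_mul (h.bd x) (h'.lip x y) (abs_nonneg _) hC
    have h2 := mul_le_mul (h.lip x y) (h'.bd y) (abs_nonneg _)
      (mul_nonneg hC (norm_nonneg _))
    linarith

lemma BddLip.mlin_le {w : Rn n → ℝ} {C : ℝ} (h : BddLip w C) (x y : Rn n) :
    |w x - w y| * J n s (x - y) ≤ 2 * C * mlin n s 1 (x - y) := by
  unfold mlin
  rw [← mul_assoc]
  refine mul_le_mul_of_nonneg_right ?_ (J_nonneg _)
  have hC := h.nonneg
  rw [mul_min_of_nonneg _ _ (by positivity), div_one]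
  refine le_min ?_ ?_
  · have := h.lip x y
    nlinarith [mul_nonneg hC (norm_nonneg (x - y))]
  · have := abs_sub (w x) (w y)
    linarith [h.bd x, h.bd y]

lemma mlin_neg (r : ℝ) (z : Rn n) : mlin n s r (-z) = mlin n s r z := by
  simp [mlin, J_neg]

/-- The operator `w ↦ ∫ (w(x)-w(y)) |x-y|^{-(n+s)} dy`. -/
def Lop (n : ℕ) (s : ℝ) (w : Rn n → ℝ) (x : Rn n) : ℝ := ∫ y, (w x - w y) * J n s (x - y)

lemma Lop_integrable (hn : 1 ≤ n) (hs : s ∈ Ioo (0 : ℝ) 1) {w : Rn n → ℝ} {C : ℝ}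
    (hw : BddLip w C) (x : Rn n) : Integrable (fun y => (w x - w y) * J n s (x - y)) := by
  have h := ((mlin_integral hn hs one_pos).1.comp_sub_left x).const_mul (2 * C)
  have hc := hw.continuous
  refine h.mono' (Measurable.aestronglyMeasurable ?_) (Eventually.of_forall fun y => ?_)
  · have := hc.measurable
    fun_prop
  · rw [Real.norm_eq_abs, abs_mul, abs_of_nonneg (J_nonneg (x - y))]
    exact hw.mlin_le x y

lemma weak_form (hn : 1 ≤ n) (hs : s ∈ Ioo (0 : ℝ) 1) {w g : Rn n → ℝ} {C M : ℝ}
    (hw : BddLip w C) (hgm : Measurable g) (hg : ∀ x, |g x| ≤ M) {z : Rn n} {r : ℝ}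
    (hgz : ∀ x, x ∉ ball z r → g x = 0) :
    Integrable (fun p : Rn n × Rn n => (w p.1 - w p.2) * (g p.1 - g p.2) * J n s (p.1 - p.2)) ∧
    ∫ p : Rn n × Rn n, (w p.1 - w p.2) * (g p.1 - g p.2) * J n s (p.1 - p.2) =
      2 * ∫ x, g x * Lop n s w x := by
  have hwm := hw.continuous.measurable
  have hC := hw.nonneg
  have hM : 0 ≤ M := (abs_nonneg _).trans (hg 0)
  set H : Rn n × Rn n → ℝ := fun p => g p.1 * ((w p.1 - w p.2) * J n s (p.1 - p.2)) with hH
  have hHi : Integrable H := by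
    refine int_dom (c := M * (2 * C)) (z := z) (r := r) ?_ (mlin_integral hn hs one_pos).1
      (mlin_neg _) ?_
    · exact Measurable.aestronglyMeasurable (by fun_prop)
    · intro p
      simp only [hH]
      by_cases hp : p.1 ∈ ball z r
      · rw [ib_of_mem hp, abs_mul, abs_mul, abs_of_nonneg (J_nonneg (p.1 - p.2))]
        have h1 := hw.mlin_le (s := s) p.1 p.2
        have h2 := ib_nonneg z r p.2
        have h3 := mlin_nonneg (s := s) one_pos (p.1 - p.2)
        have h4 := mul_le_mul (hg p.1) h1
          (mul_nonneg (abs_nonneg _) (J_nonneg _)) hM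
        refine h4.trans ?_
        have : 0 ≤ M * (2 * C) * (ib z r p.2 * mlin n s 1 (p.1 - p.2)) := by positivity
        linarith
      · rw [hgz _ hp]
        have h2 := ib_nonneg z r p.2
        have h2' := ib_nonneg z r p.1
        have h3 := mlin_nonneg (s := s) one_pos (p.1 - p.2)
        simp only [zero_mul, abs_zero]
        positivity
  have he : (fun p : Rn n × Rn n => (w p.1 - w p.2) * (g p.1 - g p.2) * J n s (p.1 - p.2)) =
      fun p => H p + H p.swap := by
    funext p
    simp only [hH, Prod.fst_swap, Prod.snd_swap]
    rw [J_sub_comm p.2 p.1]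
    ring
  have hsw : Integrable (fun p : Rn n × Rn n => H p.swap) := hHi.swap
  rw [he]
  refine ⟨hHi.add hsw, ?_⟩
  rw [integral_add hHi hsw, integral_swap_symm, ← two_mul]
  congr 1
  have : ∫ p, H p = ∫ x, ∫ y, H (x, y) := integral_prod H hHi
  rw [this]
  simp only [hH, Lop, integral_const_mul]

/-- The Gagliardo form with kernel `|x-y|^{-(n+s)}`. -/
def Bf (n : ℕ) (s : ℝ) (ξ : Rn n → ℝ) : ℝ :=
  ∫ p : Rn n × Rn n, (ξ p.1 - ξ p.2) ^ 2 * J n s (p.1 - p.2)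

lemma Bf_integrable (hn : 1 ≤ n) (hs : s ∈ Ioo (0 : ℝ) 1) {ξ : Rn n → ℝ} {C : ℝ}
    (hξ : BddLip ξ C) {z : Rn n} {r : ℝ} (hz : ∀ x, x ∉ ball z r → ξ x = 0) :
    Integrable (fun p : Rn n × Rn n => (ξ p.1 - ξ p.2) ^ 2 * J n s (p.1 - p.2)) := by
  have := (weak_form hn hs hξ hξ.continuous.measurable hξ.bd hz).1
  simpa only [sq] using this

/-- The commutator form of a cutoff `φ` against `w`. -/
def Df (n : ℕ) (s : ℝ) (φ w : Rn n → ℝ) : ℝ :=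
  ∫ p : Rn n × Rn n, (φ p.1 - φ p.2) ^ 2 * (w p.1 * w p.2) * J n s (p.1 - p.2)

lemma Df_integrable (hn : 1 ≤ n) (hs : s ∈ Ioo (0 : ℝ) 1) {φ w : Rn n → ℝ} {C D : ℝ}
    (hφ : BddLip φ C) (hw : BddLip w D) {z : Rn n} {r : ℝ}
    (hz : ∀ x, x ∉ ball z r → φ x = 0) :
    Integrable (fun p : Rn n × Rn n =>
      (φ p.1 - φ p.2) ^ 2 * (w p.1 * w p.2) * J n s (p.1 - p.2)) := by
  have hm := hφ.continuous.measurable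
  have hm' := hw.continuous.measurable
  have h := Bf_integrable hn hs hφ hz
  refine (h.const_mul (D * D)).mono' (Measurable.aestronglyMeasurable (by fun_prop))
    (Eventually.of_forall fun p => ?_)
  rw [Real.norm_eq_abs, abs_mul, abs_mul, abs_of_nonneg (J_nonneg _), abs_of_nonneg (sq_nonneg _),
    abs_mul]
  have h1 := mul_le_mul (hw.bd p.1) (hw.bd p.2) (abs_nonneg _) hw.nonneg
  have h2 := mul_nonneg (sq_nonneg (φ p.1 - φ p.2)) (J_nonneg (s := s) (p.1 - p.2))
  nlinarith

lemma energy_identity (hn : 1 ≤ n) (hs : s ∈ Ioo (0 : ℝ) 1) {φ w : Rn n → ℝ} {C D : ℝ}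
    (hφ : BddLip φ C) (hw : BddLip w D) {z : Rn n} {r : ℝ}
    (hz : ∀ x, x ∉ ball z r → φ x = 0) :
    Bf n s (fun x => φ x * w x) =
      2 * (∫ x, φ x ^ 2 * w x * Lop n s w x) + Df n s φ w := by
  have h0 := (hφ.mul (hφ.mul hw))
  have h1 := weak_form hn hs hw h0.continuous.measurable h0.bd (z := z) (r := r)
    (fun x hx => by simp [hz x hx])
  have h2 := Df_integrable hn hs hφ hw hz
  have h3 : ∫ x, φ x ^ 2 * w x * Lop n s w x = ∫ x, φ x * (φ x * w x) * Lop n s w x := by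
    congr 1; funext x; ring
  rw [h3, ← h1.2, Df, ← integral_add h1.1 h2, Bf]
  congr 1; funext p; ring

/-- Poincaré inequality for functions supported in a ball. -/
lemma poincare (hn : 1 ≤ n) (hs : s ∈ Ioo (0 : ℝ) 1) {ξ : Rn n → ℝ} {C : ℝ}
    (hξ : BddLip ξ C) {z : Rn n} {r : ℝ} (hr : 0 < r) (hz : ∀ x, x ∉ ball z r → ξ x = 0) :
    omega n * (4 ^ (n + 1))⁻¹ * r ^ (-s) * ∫ x, ξ x ^ 2 ≤ Bf n s ξ := by
  obtain ⟨v, hv⟩ : ∃ v : Rn n, ‖v‖ = 1 :=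
    ⟨EuclideanSpace.single (⟨0, hn⟩ : Fin n) (1 : ℝ), by simp⟩
  set z' := z + (2 * r) • v
  have hi : Integrable (fun x => ξ x ^ 2) := by
    refine ((ib_integrable z r).const_mul (C ^ 2)).mono'
      (hξ.continuous.pow 2).aestronglyMeasurable (Eventually.of_forall fun x => ?_)
    rw [Real.norm_eq_abs, abs_pow]
    by_cases hx : x ∈ ball z r
    · rw [ib_of_mem hx, mul_one]
      exact pow_le_pow_left₀ (abs_nonneg _) (hξ.bd x) 2
    · simp [hz x hx, ib_of_notMem hx]
  have hlow : ∫ p : Rn n × Rn n, (4 * r) ^ (-((n : ℝ) + s)) * (ξ p.1 ^ 2 * ib z' r p.2) =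
      omega n * 4 ^ (-((n : ℝ) + s)) * r ^ (-s) * ∫ x, ξ x ^ 2 := by
    have h2 : ∫ p : Rn n × Rn n, (ξ p.1 ^ 2 * ib z' r p.2) =
        (∫ x, ξ x ^ 2) * ∫ y, ib z' r y :=
      integral_prod_mul (μ := (volume : Measure (Rn n))) (ν := (volume : Measure (Rn n)))
        (fun x => ξ x ^ 2) (ib z' r)
    rw [integral_const_mul, h2, ib_integral _ hr, mul_rpow (by norm_num) hr.le]
    have : r ^ (-((n : ℝ) + s)) * r ^ n = r ^ (-s) := by
      rw [← rpow_natCast, ← rpow_add hr]; congr 1; ring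
    rw [← this]; ring
  have h4 : ((4 : ℝ) ^ (n + 1))⁻¹ ≤ 4 ^ (-((n : ℝ) + s)) := by
    rw [← rpow_natCast, ← rpow_neg (by norm_num)]
    refine rpow_le_rpow_of_exponent_le (by norm_num) ?_
    push_cast
    linarith [hs.2]
  have h5 : 0 ≤ ∫ x, ξ x ^ 2 := integral_nonneg fun x => sq_nonneg _
  have h6 : 0 ≤ r ^ (-s) := rpow_nonneg hr.le _
  have h7 := (omega_pos n).le
  calc _ ≤ omega n * 4 ^ (-((n : ℝ) + s)) * r ^ (-s) * ∫ x, ξ x ^ 2 := by gcongr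
    _ = _ := hlow.symm
    _ ≤ _ := by
      refine integral_mono ((hi.mul_prod (ib_integrable z' r)).const_mul _)
        (Bf_integrable hn hs hξ hz) fun p => ?_
      have hRn : 0 ≤ (ξ p.1 - ξ p.2) ^ 2 * J n s (p.1 - p.2) :=
        mul_nonneg (sq_nonneg _) (J_nonneg _)
      by_cases hx : p.1 ∈ ball z r
      · by_cases hy : p.2 ∈ ball z' r
        · have hy1 : ‖p.2 - z - (2 * r) • v‖ < r := by
            rw [mem_ball, dist_eq_norm] at hy
            simpa [z', sub_sub] using hy
          have hx1 : ‖p.1 - z‖ < r := by rwa [mem_ball, dist_eq_norm] at hx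
          have hv2 : ‖(2 * r) • v‖ = 2 * r := by
            rw [norm_smul, hv, Real.norm_eq_abs, abs_of_pos (by positivity), mul_one]
          have hyz : r < ‖p.2 - z‖ := by
            have := norm_sub_norm_le ((2 * r) • v) (p.2 - z)
            rw [norm_sub_rev ((2 * r) • v) (p.2 - z), hv2] at this
            linarith
          have hy0 : ξ p.2 = 0 := hz _ (by rw [mem_ball, dist_eq_norm]; linarith)
          have hne : 0 < ‖p.1 - p.2‖ := by
            rw [norm_pos_iff, sub_ne_zero]
            intro h
            rw [h] at hx1
            linarith
          have hle : ‖p.1 - p.2‖ ≤ 4 * r := by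
            have e : p.1 - p.2 = (p.1 - z) - ((p.2 - z - (2 * r) • v) + (2 * r) • v) := by abel
            rw [e]
            refine (norm_sub_le _ _).trans ?_
            have := norm_add_le (p.2 - z - (2 * r) • v) ((2 * r) • v)
            linarith
          simp only [ib_of_mem hy, hy0, sub_zero, mul_one]
          rw [mul_comm]
          refine mul_le_mul_of_nonneg_left ?_ (sq_nonneg _)
          refine rpow_le_rpow_of_nonpos hne hle ?_
          have : (0 : ℝ) ≤ n := by positivity
          linarith [hs.1]
        · simpa [ib_of_notMem hy] using hRn
      · simpa [hz _ hx] using hRn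

/-- A `C¹` cutoff between `ball z r` and `closedBall z (3r/2)` with Lipschitz constant `C / r`. -/
structure IsBump (C : ℝ) (z : Rn n) (r : ℝ) (φ : Rn n → ℝ) : Prop where
  cd : ContDiff ℝ 1 φ
  nonneg : ∀ x, 0 ≤ φ x
  le_one : ∀ x, φ x ≤ 1
  one : ∀ x ∈ ball z r, φ x = 1
  supp : tsupport φ ⊆ closedBall z (3 * r / 2)
  lip : ∀ x y, |φ x - φ y| ≤ C / r * ‖x - y‖

lemma IsBump.hasCompactSupport {C : ℝ} {z : Rn n} {r : ℝ} {φ : Rn n → ℝ} (h : IsBump C z r φ) :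
    HasCompactSupport φ :=
  HasCompactSupport.of_support_subset_isCompact (isCompact_closedBall z (3 * r / 2))
    ((subset_tsupport φ).trans h.supp)

lemma IsBump.zero {C : ℝ} {z : Rn n} {r : ℝ} {φ : Rn n → ℝ} (h : IsBump C z r φ) {x : Rn n}
    (hx : 3 * r / 2 < ‖x - z‖) : φ x = 0 := by
  by_contra h0
  have := h.supp (subset_tsupport φ h0)
  rw [mem_closedBall, dist_eq_norm] at this
  linarith

lemma IsBump.zero_two {C : ℝ} {z : Rn n} {r : ℝ} {φ : Rn n → ℝ} (h : IsBump C z r φ)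
    (hr : 0 < r) {x : Rn n} (hx : x ∉ ball z (2 * r)) : φ x = 0 := by
  refine h.zero ?_
  rw [mem_ball, dist_eq_norm] at hx
  linarith

lemma IsBump.bddLip {C : ℝ} {z : Rn n} {r : ℝ} {φ : Rn n → ℝ} (h : IsBump C z r φ) :
    BddLip φ (max 1 (C / r)) where
  bd x := by
    rw [abs_of_nonneg (h.nonneg x)]
    exact (h.le_one x).trans (le_max_left _ _)
  lip x y := (h.lip x y).trans
    (mul_le_mul_of_nonneg_right (le_max_right _ _) (norm_nonneg _))

lemma exists_bump (n : ℕ) : ∃ C : ℝ, 1 ≤ C ∧ ∀ (z : Rn n) (r : ℝ), 0 < r →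
    ∃ φ : Rn n → ℝ, IsBump C z r φ := by
  let f : ContDiffBump (0 : Rn n) := ⟨1, 3 / 2, by norm_num, by norm_num⟩
  have hf : ContDiff ℝ 1 (f : Rn n → ℝ) := f.contDiff
  obtain ⟨K, hK⟩ := hf.lipschitzWith_of_hasCompactSupport f.hasCompactSupport one_ne_zero
  refine ⟨max 1 K, le_max_left _ _, fun z r hr => ⟨fun x => f (r⁻¹ • (x - z)), ?_, fun x => f.nonneg,
    fun x => f.le_one, fun x hx => ?_, ?_, fun x y => ?_⟩⟩
  · exact hf.comp (by fun_prop)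
  · refine f.one_of_mem_closedBall ?_
    rw [mem_ball, dist_eq_norm] at hx
    rw [mem_closedBall, dist_zero_right, norm_smul, norm_inv, Real.norm_eq_abs, abs_of_pos hr]
    change r⁻¹ * ‖x - z‖ ≤ 1
    rw [inv_mul_le_iff₀ hr]
    linarith
  · refine closure_minimal (fun x hx => ?_) isClosed_closedBall
    have h1 : r⁻¹ • (x - z) ∈ Function.support f := hx
    rw [f.support_eq, mem_ball, dist_zero_right, norm_smul, norm_inv, Real.norm_eq_abs,
      abs_of_pos hr] at h1
    change r⁻¹ * ‖x - z‖ < 3 / 2 at h1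
    rw [inv_mul_lt_iff₀ hr] at h1
    rw [mem_closedBall, dist_eq_norm]
    linarith
  · have := hK.dist_le_mul (r⁻¹ • (x - z)) (r⁻¹ • (y - z))
    rw [Real.dist_eq, dist_eq_norm, ← smul_sub, sub_sub_sub_cancel_right, norm_smul, norm_inv,
      Real.norm_eq_abs, abs_of_pos hr] at this
    refine this.trans ?_
    rw [div_eq_mul_inv, ← mul_assoc]
    gcongr
    exact le_max_right _ _

lemma kq_diff_integral (hn : 1 ≤ n) {q η : ℝ} (hq : 0 < q) (hη : 0 < η) {g : Rn n → ℝ} {M : ℝ}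
    (hg : Measurable g) (hM : ∀ x, |g x| ≤ M) (x h : Rn n) :
    |∫ y, kq n q η (x - y) * (g (y + h) - g y)| ≤
      ‖h‖ * M * (2 * (n + q) * (omega n * (1 + n / (q + 1)) * η ^ (-(q + 1)))) := by
  have hM0 : 0 ≤ M := (abs_nonneg _).trans (hM 0)
  obtain ⟨hk, -⟩ := kq_integral hn hq hη
  obtain ⟨hk1, hk1v⟩ := kq_integral hn (by linarith : 0 < q + 1) hη
  have hkx : ∀ a : Rn n, Integrable (fun y => kq n q η (a - y)) := fun a => hk.comp_sub_left a
  have hk1x : ∀ a : Rn n, Integrable (fun y => kq n (q + 1) η (a - y)) :=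
    fun a => hk1.comp_sub_left a
  have hmul : ∀ (a b : Rn n), Integrable (fun y => kq n q η (a - y) * g (y + b)) := fun a b =>
    (hkx a).mul_bdd (c := M) ((hg.comp (measurable_add_const b)).aestronglyMeasurable)
      (ae_of_all _ fun y => by simpa using hM _)
  have hmul0 : ∀ a : Rn n, Integrable (fun y => kq n q η (a - y) * g y) := fun a => by
    simpa using hmul a 0
  have e1 : ∫ y, kq n q η (x - y) * g (y + h) = ∫ y, kq n q η (x - y + h) * g y := by
    rw [← integral_add_right_eq_self (fun y => kq n q η (x - y + h) * g y) h]
    congr 1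
    funext y
    congr 2
    abel
  have hmul' : Integrable (fun y => kq n q η (x - y + h) * g y) := by
    have := hmul0 (x + h)
    refine this.congr (ae_of_all _ fun y => ?_)
    simp only
    congr 2
    abel
  have e2 : ∫ y, kq n q η (x - y) * (g (y + h) - g y) =
      ∫ y, (kq n q η (x - y + h) - kq n q η (x - y)) * g y := by
    simp_rw [mul_sub, sub_mul]
    rw [integral_sub (hmul x h) (hmul0 x), integral_sub hmul' (hmul0 x), e1]
  have hk1h : Integrable (fun y => kq n (q + 1) η (x - y + h)) := by
    refine (hk1x (x + h)).congr (ae_of_all _ fun y => ?_)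
    simp only
    congr 1
    abel
  have hv : ∀ a : Rn n, ∫ y, kq n (q + 1) η (a - y) = ∫ y, kq n (q + 1) η y := fun a =>
    integral_sub_left_eq_self (fun y => kq n (q + 1) η y) volume a
  have hvh : ∫ y, kq n (q + 1) η (x - y + h) = ∫ y, kq n (q + 1) η y := by
    rw [← hv (x + h)]
    congr 1
    funext y
    congr 1
    abel
  rw [e2, ← Real.norm_eq_abs]
  refine (norm_integral_le_of_norm_le (((hk1h.add (hk1x x)).const_mul
    ((n + q) * ‖h‖ * M))) (ae_of_all _ fun y => ?_)).trans ?_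
  · rw [Real.norm_eq_abs, abs_mul]
    have h1 := kq_sub_le (n := n) hq.le hη (x - y) h
    calc _ ≤ ((n + q) * ‖h‖ * (kq n (q + 1) η (x - y + h) + kq n (q + 1) η (x - y))) * M :=
          mul_le_mul h1 (hM y) (abs_nonneg _) ((abs_nonneg _).trans h1)
      _ = _ := by simp only [Pi.add_apply]; ring
  · rw [integral_const_mul]
    simp only [Pi.add_apply]
    rw [integral_add hk1h (hk1x x), hvh, hv x, hk1v]
    apply le_of_eq
    ring

lemma ib_mul_integral (z : Rn n) (r : ℝ) (f : Rn n → ℝ) :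
    ∫ x, ib z r x * f x = ∫ x in ball z r, f x := by
  rw [← integral_indicator measurableSet_ball]
  congr 1
  funext x
  by_cases hx : x ∈ ball z r
  · rw [ib_of_mem hx, indicator_of_mem hx, one_mul]
  · rw [ib_of_notMem hx, indicator_of_notMem hx, zero_mul]

lemma ib_mul_integrable (z : Rn n) (r : ℝ) {f : Rn n → ℝ} (hf : Continuous f) :
    Integrable (fun x => ib z r x * f x) := by
  have h1 : IntegrableOn f (ball z r) :=
    (hf.continuousOn.integrableOn_compact (isCompact_closedBall z r)).mono_set
      ball_subset_closedBall
  rw [← integrable_indicator_iff measurableSet_ball] at h1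
  refine h1.congr (ae_of_all _ fun x => ?_)
  by_cases hx : x ∈ ball z r
  · simp only [ib_of_mem hx, indicator_of_mem hx, one_mul]
  · simp only [ib_of_notMem hx, indicator_of_notMem hx, zero_mul]

/-- The difference quotient of `u` in the direction `v` with step `t`. -/
def dq (u : Rn n → ℝ) (v : Rn n) (t : ℝ) (x : Rn n) : ℝ := t⁻¹ * (u (x + t • v) - u x)

lemma dq_conv (hn : 1 ≤ n) {q η t C r K : ℝ} (hq : 0 < q) (hη : 0 < η) (ht : 0 < t)
    (hr : 0 < r) {v : Rn n} (hv : ‖v‖ = 1) {u φ : Rn n → ℝ} (hu : BddLip u K)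
    (hu1 : ∀ x, |u x| ≤ 1) {z : Rn n} (hφ : IsBump C z r φ) (hC : 0 ≤ C) (x : Rn n) :
    |∫ y, kq n q η (x - y) * dq u v t y| ≤
      2 * (n + q) * (omega n * (1 + n / (q + 1)) * η ^ (-(q + 1))) ∧
    |∫ y, kq n q η (x - y) * (φ y * dq u v t y)| ≤
      2 * (n + q) * (omega n * (1 + n / (q + 1)) * η ^ (-(q + 1))) +
        C / r * (omega n * (1 + n / q) * η ^ (-q)) := by
  have htv : ‖t • v‖ = t := by rw [norm_smul, hv, mul_one, Real.norm_eq_abs, abs_of_pos ht]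
  obtain ⟨hk, hkv⟩ := kq_integral hn hq hη
  have hkx : Integrable (fun y => kq n q η (x - y)) := hk.comp_sub_left x
  have hkxv : ∫ y, kq n q η (x - y) = ∫ y, kq n q η y :=
    integral_sub_left_eq_self (fun y => kq n q η y) volume x
  constructor
  · have h1 := kq_diff_integral hn hq hη hu.continuous.measurable hu1 x (t • v)
    have e : ∀ y, kq n q η (x - y) * dq u v t y =
        t⁻¹ * (kq n q η (x - y) * (u (y + t • v) - u y)) := fun y => by rw [dq]; ring
    simp_rw [e]
    rw [integral_const_mul, abs_mul, abs_inv, abs_of_pos ht, inv_mul_le_iff₀ ht]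
    rw [htv, mul_one] at h1
    exact h1
  · have hg1 : ∀ x, |φ x * u x| ≤ 1 := fun x => by
      rw [abs_mul, abs_of_nonneg (hφ.nonneg x)]
      exact mul_le_one₀ (hφ.le_one x) (abs_nonneg _) (hu1 x)
    have hgc : Continuous (fun x => φ x * u x) := hφ.cd.continuous.mul hu.continuous
    have h1 := kq_diff_integral hn hq hη hgc.measurable hg1 x (t • v)
    rw [htv, mul_one] at h1
    have e : ∀ y, kq n q η (x - y) * (φ y * dq u v t y) =
        t⁻¹ * (kq n q η (x - y) * (φ (y + t • v) * u (y + t • v) - φ y * u y)) -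
        t⁻¹ * (kq n q η (x - y) * ((φ (y + t • v) - φ y) * u (y + t • v))) :=
      fun y => by rw [dq]; ring
    have hsh : Continuous fun y : Rn n => y + t • v := by fun_prop
    have i1 : Integrable fun y =>
        kq n q η (x - y) * (φ (y + t • v) * u (y + t • v) - φ y * u y) :=
      hkx.mul_bdd (c := 2) ((hgc.comp hsh).sub hgc).aestronglyMeasurable
        (ae_of_all _ fun y => by
          rw [Real.norm_eq_abs]
          have h1 := hg1 (y + t • v)
          have h2 := hg1 y
          rw [abs_le] at *
          constructor <;> linarith)
    have hbd : ∀ y, ‖(φ (y + t • v) - φ y) * u (y + t • v)‖ ≤ C / r * t := fun y => by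
      rw [Real.norm_eq_abs, abs_mul]
      have h1 := hφ.lip (y + t • v) y
      rw [add_sub_cancel_left, htv] at h1
      calc _ ≤ C / r * t * 1 := mul_le_mul h1 (hu1 _) (abs_nonneg _) (by positivity)
        _ = _ := mul_one _
    have i2 : Integrable fun y => kq n q η (x - y) * ((φ (y + t • v) - φ y) * u (y + t • v)) :=
      hkx.mul_bdd (c := C / r * t) (((hφ.cd.continuous.comp hsh).sub hφ.cd.continuous).mul
        (hu.continuous.comp hsh)).aestronglyMeasurable (ae_of_all _ hbd)
    have h2 : |∫ y, kq n q η (x - y) * ((φ (y + t • v) - φ y) * u (y + t • v))| ≤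
        C / r * t * (omega n * (1 + n / q) * η ^ (-q)) := by
      rw [← hkv, ← hkxv, ← integral_const_mul, ← Real.norm_eq_abs]
      refine norm_integral_le_of_norm_le (hkx.const_mul _) (ae_of_all _ fun y => ?_)
      rw [norm_mul, Real.norm_eq_abs, abs_of_nonneg (kq_nonneg _), mul_comm]
      exact mul_le_mul_of_nonneg_right (hbd y) (kq_nonneg _)
    simp_rw [e]
    rw [integral_sub (i1.const_mul _) (i2.const_mul _), integral_const_mul, integral_const_mul,
      ← mul_sub, abs_mul, abs_inv, abs_of_pos ht, inv_mul_le_iff₀ ht]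
    refine (abs_sub _ _).trans ?_
    linarith

lemma far_conv (hn : 1 ≤ n) {q η A K L D : ℝ} (hq : 0 < q) (hη : 0 < η) {w ψ χ : Rn n → ℝ}
    (hw : BddLip w K) (hψ : BddLip ψ L) (hχ : BddLip χ D) (hψ1 : ∀ x, |ψ x| ≤ 1) {z : Rn n} {r : ℝ}
    (hz : ∀ x, x ∉ ball z r → ψ x = 0)
    (hA : ∀ x, |∫ y, kq n q η (x - y) * χ y| ≤ A) :
    Integrable (fun p : Rn n × Rn n => ψ p.1 * w p.1 * χ p.2 * kq n q η (p.1 - p.2)) ∧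
    |∫ p : Rn n × Rn n, ψ p.1 * w p.1 * χ p.2 * kq n q η (p.1 - p.2)| ≤
      A * ∫ x in ball z r, |w x| := by
  obtain ⟨hk, -⟩ := kq_integral hn hq hη
  have hi : Integrable
      (fun p : Rn n × Rn n => ψ p.1 * w p.1 * χ p.2 * kq n q η (p.1 - p.2)) := by
    have hψc := hψ.continuous
    have hwc := hw.continuous
    have hχc := hχ.continuous
    refine int_dom (m := kq n q η) (c := K * D) (z := z) (r := r) ?_ hk kq_neg fun p => ?_
    · refine Continuous.aestronglyMeasurable (by fun_prop) |>.mul ?_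
      exact (measurable_kq.comp (measurable_fst.sub measurable_snd)).aestronglyMeasurable
    · rw [abs_mul, abs_mul, abs_mul, abs_of_nonneg (kq_nonneg _), ← mul_assoc]
      refine mul_le_mul_of_nonneg_right ?_ (kq_nonneg _)
      by_cases hx : p.1 ∈ ball z r
      · rw [ib_of_mem hx]
        have h1 := hψ1 p.1
        have h2 := hw.bd p.1
        have h3 := hχ.bd p.2
        have h4 := ib_nonneg z r p.2
        have h5 := hw.nonneg
        have h6 := hχ.nonneg
        calc |ψ p.1| * |w p.1| * |χ p.2| ≤ 1 * K * D := by gcongr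
          _ ≤ K * D * (1 + ib z r p.2) := by
            nlinarith [mul_nonneg (mul_nonneg h5 h6) h4]
      · rw [hz _ hx, abs_zero, zero_mul, zero_mul]
        have := ib_nonneg z r p.1
        have := ib_nonneg z r p.2
        have h5 := hw.nonneg
        have h6 := hχ.nonneg
        positivity
  refine ⟨hi, ?_⟩
  have e : ∫ p : Rn n × Rn n, ψ p.1 * w p.1 * χ p.2 * kq n q η (p.1 - p.2) =
      ∫ x, ∫ y, ψ x * w x * χ y * kq n q η (x - y) := integral_prod _ hi
  have e2 : ∀ x, ∫ y, ψ x * w x * χ y * kq n q η (x - y) =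
      ψ x * w x * ∫ y, kq n q η (x - y) * χ y := fun x => by
    rw [← integral_const_mul]
    congr 1
    funext y
    ring
  rw [e, ← ib_mul_integral, ← integral_const_mul, ← Real.norm_eq_abs]
  simp_rw [e2]
  refine norm_integral_le_of_norm_le
    ((ib_mul_integrable z r hw.continuous.abs).const_mul A) (ae_of_all _ fun x => ?_)
  rw [Real.norm_eq_abs, abs_mul, abs_mul]
  have hA0 : 0 ≤ A := (abs_nonneg _).trans (hA x)
  by_cases hx : x ∈ ball z r
  · rw [ib_of_mem hx]
    calc _ ≤ 1 * |w x| * A := by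
          gcongr
          · exact hψ1 x
          · exact hA x
      _ = _ := by ring
  · rw [hz _ hx, ib_of_notMem hx]
    simp

lemma mq_neg (η : ℝ) (z : Rn n) : mq n s η (-z) = mq n s η z := by
  simp only [mq, norm_neg, J_neg]

lemma Df_near (hn : 1 ≤ n) (hs : s ∈ Ioo (0 : ℝ) 1) {C r η K : ℝ} (hη : 0 < η)
    (hηr : η ≤ r / 2) {w φ : Rn n → ℝ} (hw : BddLip w K) {z : Rn n}
    (hφ : IsBump C z r φ) :
    |∫ p : Rn n × Rn n, (φ p.1 - φ p.2) ^ 2 * (w p.1 * w p.2) *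
      (J n s (p.1 - p.2) - kq n s η (p.1 - p.2))| ≤
      (C / r) ^ 2 * (n * omega n * η ^ (2 - s)) * ∫ x in ball z (2 * r), w x ^ 2 := by
  obtain ⟨hm, hmv⟩ := mq_integral hn hs hη
  have hwi : Integrable (fun x => ib z (2 * r) x * w x ^ 2) :=
    ib_mul_integrable z (2 * r) (hw.continuous.pow 2)
  obtain ⟨i1, v1⟩ := conv_fst hwi hm (mq_neg η)
  obtain ⟨i2, v2⟩ := conv_snd hwi hm
  rw [ib_mul_integral z (2 * r) (fun x => w x ^ 2)] at v1 v2
  have h0 : 0 ≤ ∫ x in ball z (2 * r), w x ^ 2 := integral_nonneg fun x => sq_nonneg _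
  rw [← Real.norm_eq_abs]
  refine (norm_integral_le_of_norm_le ((i1.add i2).const_mul ((C / r) ^ 2 * (1 / 2)))
    (ae_of_all _ fun p => ?_)).trans ?_
  · rw [Real.norm_eq_abs, abs_mul, abs_mul, abs_of_nonneg (sq_nonneg _)]
    simp only [Pi.add_apply]
    have hR : 0 ≤ (C / r) ^ 2 * (1 / 2) * (ib z (2 * r) p.1 * w p.1 ^ 2 * mq n s η (p.1 - p.2) +
        ib z (2 * r) p.2 * w p.2 ^ 2 * mq n s η (p.1 - p.2)) := by
      have := ib_nonneg z (2 * r) p.1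
      have := ib_nonneg z (2 * r) p.2
      have := mq_nonneg (n := n) (s := s) (η := η) (p.1 - p.2)
      positivity
    by_cases hd : ‖p.1 - p.2‖ < η
    · by_cases hφ0 : φ p.1 = φ p.2
      · rw [hφ0, sub_self]
        simpa using hR
      have hne : 0 < ‖p.1 - p.2‖ := by
        rw [norm_pos_iff, sub_ne_zero]
        intro h
        exact hφ0 (by rw [h])
      have hxy : ‖p.1 - z‖ ≤ 3 * r / 2 ∨ ‖p.2 - z‖ ≤ 3 * r / 2 := by
        by_contra! hcon
        exact hφ0 (by rw [hφ.zero hcon.1, hφ.zero hcon.2])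
      have hxy2 : ‖p.1 - z‖ < 2 * r ∧ ‖p.2 - z‖ < 2 * r := by
        have h1 : ‖p.1 - z‖ ≤ ‖p.1 - p.2‖ + ‖p.2 - z‖ := norm_sub_le_norm_sub_add_norm_sub _ _ _
        have h2 : ‖p.2 - z‖ ≤ ‖p.2 - p.1‖ + ‖p.1 - z‖ := norm_sub_le_norm_sub_add_norm_sub _ _ _
        rw [norm_sub_rev p.2 p.1] at h2
        rcases hxy with h | h <;> constructor <;> linarith
      have hx : p.1 ∈ ball z (2 * r) := by rw [mem_ball, dist_eq_norm]; exact hxy2.1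
      have hy : p.2 ∈ ball z (2 * r) := by rw [mem_ball, dist_eq_norm]; exact hxy2.2
      rw [ib_of_mem hx, ib_of_mem hy, mq, if_pos hd]
      have hk : |J n s (p.1 - p.2) - kq n s η (p.1 - p.2)| ≤ J n s (p.1 - p.2) := by
        have hle : kq n s η (p.1 - p.2) ≤ J n s (p.1 - p.2) := by
          unfold kq J
          refine Real.rpow_le_rpow_of_nonpos hne (le_max_left _ _) ?_
          have := hs.1
          have : (0 : ℝ) ≤ n := Nat.cast_nonneg _
          linarith
        have := kq_nonneg (n := n) (q := s) (η := η) (p.1 - p.2)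
        rw [abs_of_nonneg (by linarith)]
        linarith
      have hl : (φ p.1 - φ p.2) ^ 2 ≤ (C / r) ^ 2 * ‖p.1 - p.2‖ ^ 2 := by
        rw [← mul_pow, ← sq_abs (φ p.1 - φ p.2)]
        exact pow_le_pow_left₀ (abs_nonneg _) (hφ.lip _ _) 2
      have ha : |w p.1 * w p.2| ≤ (1 / 2) * (w p.1 ^ 2 + w p.2 ^ 2) := by
        rw [abs_mul]
        nlinarith [sq_nonneg (|w p.1| - |w p.2|), sq_abs (w p.1), sq_abs (w p.2)]
      have hJ := J_nonneg (n := n) (s := s) (p.1 - p.2)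
      calc _ ≤ ((C / r) ^ 2 * ‖p.1 - p.2‖ ^ 2) * ((1 / 2) * (w p.1 ^ 2 + w p.2 ^ 2)) *
            J n s (p.1 - p.2) := by gcongr
        _ = _ := by ring
    · have : J n s (p.1 - p.2) - kq n s η (p.1 - p.2) = 0 := by
        unfold kq J
        rw [max_eq_left (not_lt.mp hd), sub_self]
      rw [this, abs_zero, mul_zero]
      exact hR
  · rw [integral_const_mul]
    simp only [Pi.add_apply]
    rw [integral_add i1 i2, v1, v2]
    calc _ = (C / r) ^ 2 * (∫ x, mq n s η x) * ∫ x in ball z (2 * r), w x ^ 2 := by ring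
      _ ≤ _ := by gcongr

lemma Df_far (hn : 1 ≤ n) {q η A B K C r : ℝ} (hq : 0 < q) (hη : 0 < η) (hr : 0 < r)
    {w φ : Rn n → ℝ} (hw : BddLip w K) {z : Rn n} (hφ : IsBump C z r φ)
    (hA : ∀ x, |∫ y, kq n q η (x - y) * w y| ≤ A)
    (hB : ∀ x, |∫ y, kq n q η (x - y) * (φ y * w y)| ≤ B) :
    Integrable (fun p : Rn n × Rn n =>
      (φ p.1 - φ p.2) ^ 2 * (w p.1 * w p.2) * kq n q η (p.1 - p.2)) ∧
    |∫ p : Rn n × Rn n, (φ p.1 - φ p.2) ^ 2 * (w p.1 * w p.2) * kq n q η (p.1 - p.2)| ≤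
      2 * (A + B) * ∫ x in ball z (2 * r), |w x| := by
  have h1 : ∀ x, |φ x| ≤ 1 := fun x => by
    rw [abs_of_nonneg (hφ.nonneg x)]
    exact hφ.le_one x
  obtain ⟨i1, v1⟩ := far_conv hn hq hη hw (hφ.bddLip.mul hφ.bddLip) hw
    (fun x => by rw [abs_mul]; exact mul_le_one₀ (h1 x) (abs_nonneg _) (h1 x))
    (fun x hx => by rw [hφ.zero_two hr hx, zero_mul]) hA
  obtain ⟨i2, v2⟩ := far_conv hn hq hη hw hφ.bddLip (hφ.bddLip.mul hw) h1
    (fun x hx => hφ.zero_two hr hx) hB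
  set F : Rn n × Rn n → ℝ := fun p => φ p.1 * φ p.1 * w p.1 * w p.2 * kq n q η (p.1 - p.2)
    with hF
  set G : Rn n × Rn n → ℝ := fun p => φ p.1 * w p.1 * (φ p.2 * w p.2) * kq n q η (p.1 - p.2)
    with hG
  have hsw : Integrable (fun p : Rn n × Rn n => F p.swap) := i1.swap
  have e : (fun p : Rn n × Rn n =>
      (φ p.1 - φ p.2) ^ 2 * (w p.1 * w p.2) * kq n q η (p.1 - p.2)) =
      fun p => F p + F p.swap - 2 * G p := by
    funext p
    have : kq n q η (p.2 - p.1) = kq n q η (p.1 - p.2) := by rw [← kq_neg, neg_sub]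
    simp only [hF, hG, Prod.fst_swap, Prod.snd_swap, this]
    ring
  have hint : Integrable (fun p => F p + F p.swap) := i1.add hsw
  rw [e]
  refine ⟨hint.sub (i2.const_mul 2), ?_⟩
  rw [integral_sub hint (i2.const_mul 2), integral_add i1 hsw, integral_swap_symm,
    integral_const_mul]
  rw [abs_le] at *
  constructor <;> linarith

lemma Df_estimate (hn : 1 ≤ n) {s₀ C : ℝ} (hs₀ : s₀ ∈ Ioo (0 : ℝ) 1) (hC : 0 ≤ C) :
    ∃ C₁ : ℝ, 0 < C₁ ∧ ∀ s ∈ Ioo s₀ 1, ∀ (δ r t K : ℝ) (v z : Rn n) (u φ : Rn n → ℝ), 0 < δ →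
      δ ≤ 1 / 2 → 0 < r → 0 < t → ‖v‖ = 1 → BddLip u K → (∀ x, |u x| ≤ 1) →
      (∃ K', BddLip (dq u v t) K') → IsBump C z r φ →
      |Df n s φ (dq u v t)| ≤ C₁ * (δ * r ^ (-s) * (∫ x in ball z (2 * r), dq u v t x ^ 2) +
        δ⁻¹ ^ 2 * r ^ (-1 - s) * ∫ x in ball z (2 * r), |dq u v t x|) := by
  have hω := omega_pos n
  have hn0 : (0 : ℝ) < n := by exact_mod_cast hn
  set c := 2 * ((n : ℝ) + 1) * (omega n * (1 + n)) with hc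
  set d := omega n * (1 + n / s₀) with hd
  have hs0 := hs₀.1
  have hd0 : 0 < d := by positivity
  have hc0 : 0 < c := by positivity
  refine ⟨C ^ 2 * (n * omega n) + 2 * (2 * c + C * d), by positivity, ?_⟩
  intro s hs δ r t K v z u φ hδ hδ2 hr ht hv hu hu1 ⟨K', hw⟩ hφ
  have hsp : 0 < s := hs0.trans hs.1
  have hs1 := hs.2
  have hs' : s ∈ Ioo (0 : ℝ) 1 := ⟨hsp, hs.2⟩
  have hη : 0 < δ * r := by positivity
  have hconv := fun x => dq_conv hn (q := s) hsp hη ht hr hv hu hu1 hφ hC x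
  obtain ⟨ifar, vfar⟩ := Df_far hn hsp hη hr hw hφ (fun x => (hconv x).1) (fun x => (hconv x).2)
  have vnear := Df_near hn hs' hη (by nlinarith) hw hφ
  have iD := Df_integrable hn hs' hφ.bddLip hw (z := z) (r := 2 * r)
    (fun x hx => hφ.zero_two hr hx)
  have inear : Integrable (fun p : Rn n × Rn n => (φ p.1 - φ p.2) ^ 2 *
      (dq u v t p.1 * dq u v t p.2) * (J n s (p.1 - p.2) - kq n s (δ * r) (p.1 - p.2))) := by
    refine (iD.sub ifar).congr (ae_of_all _ fun p => ?_)
    simp only [Pi.sub_apply]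
    ring
  have eD : Df n s φ (dq u v t) = (∫ p : Rn n × Rn n, (φ p.1 - φ p.2) ^ 2 *
      (dq u v t p.1 * dq u v t p.2) * (J n s (p.1 - p.2) - kq n s (δ * r) (p.1 - p.2))) +
      ∫ p : Rn n × Rn n, (φ p.1 - φ p.2) ^ 2 * (dq u v t p.1 * dq u v t p.2) *
        kq n s (δ * r) (p.1 - p.2) := by
    rw [← integral_add inear ifar, Df]
    congr 1
    funext p
    ring
  have hX0 : 0 ≤ ∫ x in ball z (2 * r), dq u v t x ^ 2 := integral_nonneg fun x => sq_nonneg _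
  have hY0 : 0 ≤ ∫ x in ball z (2 * r), |dq u v t x| := integral_nonneg fun x => abs_nonneg _
  set X := ∫ x in ball z (2 * r), dq u v t x ^ 2
  set Y := ∫ x in ball z (2 * r), |dq u v t x|
  have hrs : 0 < r ^ (-s) := rpow_pos_of_pos hr _
  have hrs1 : r ^ (-1 - s) = r⁻¹ * r ^ (-s) := by
    rw [sub_eq_add_neg, rpow_add hr, rpow_neg_one]
  have n1 : (C / r) ^ 2 * (n * omega n * (δ * r) ^ (2 - s)) ≤
      C ^ 2 * (n * omega n) * (δ * r ^ (-s)) := by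
    have e1 : (δ * r) ^ (2 - s) = δ ^ (2 - s) * (r ^ 2 * r ^ (-s)) := by
      rw [mul_rpow hδ.le hr.le, sub_eq_add_neg, rpow_add hr, rpow_two]
    have e2 : δ ^ (2 - s) ≤ δ := by
      calc δ ^ (2 - s) ≤ δ ^ (1 : ℝ) :=
            rpow_le_rpow_of_exponent_ge hδ (by linarith) (by linarith)
        _ = δ := rpow_one _
    rw [e1]
    calc _ = C ^ 2 * (n * omega n) * (δ ^ (2 - s) * r ^ (-s)) := by field_simp
      _ ≤ _ := by gcongr
  have a1 : 2 * (n + s) * (omega n * (1 + n / (s + 1)) * (δ * r) ^ (-(s + 1))) ≤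
      c * (δ⁻¹ ^ 2 * r ^ (-1 - s)) := by
    have e1 : (δ * r) ^ (-(s + 1)) = δ ^ (-(s + 1)) * r ^ (-1 - s) := by
      rw [mul_rpow hδ.le hr.le]
      congr 2
      ring
    have e2 : δ ^ (-(s + 1)) ≤ δ⁻¹ ^ 2 := by
      calc δ ^ (-(s + 1)) ≤ δ ^ (-2 : ℝ) :=
            rpow_le_rpow_of_exponent_ge hδ (by linarith) (by linarith)
        _ = δ⁻¹ ^ 2 := by rw [rpow_neg hδ.le, rpow_two, inv_pow]
    have e3 : (n : ℝ) / (s + 1) ≤ n := div_le_self hn0.le (by linarith)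
    have : 0 < r ^ (-1 - s) := rpow_pos_of_pos hr _
    rw [e1, hc]
    calc _ ≤ 2 * ((n : ℝ) + 1) * (omega n * (1 + n) * (δ⁻¹ ^ 2 * r ^ (-1 - s))) := by
          gcongr
      _ = _ := by ring
  have a2 : C / r * (omega n * (1 + n / s) * (δ * r) ^ (-s)) ≤
      C * d * (δ⁻¹ ^ 2 * r ^ (-1 - s)) := by
    have e1 : (δ * r) ^ (-s) = δ ^ (-s) * r ^ (-s) := mul_rpow hδ.le hr.le
    have e2 : δ ^ (-s) ≤ δ⁻¹ ^ 2 := by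
      calc δ ^ (-s) ≤ δ ^ (-2 : ℝ) :=
            rpow_le_rpow_of_exponent_ge hδ (by linarith) (by linarith)
        _ = δ⁻¹ ^ 2 := by rw [rpow_neg hδ.le, rpow_two, inv_pow]
    have e3 : (n : ℝ) / s ≤ n / s₀ := by
      have := hs.1
      gcongr
    rw [e1, hd, hrs1]
    calc _ ≤ C / r * (omega n * (1 + n / s₀) * (δ⁻¹ ^ 2 * r ^ (-s))) := by gcongr
      _ = _ := by rw [div_eq_mul_inv]; ring
  have hP : 0 ≤ δ⁻¹ ^ 2 * r ^ (-1 - s) := by positivity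
  set P := δ⁻¹ ^ 2 * r ^ (-1 - s)
  have hQ : 0 ≤ δ * r ^ (-s) := by positivity
  set Q := δ * r ^ (-s)
  rw [eD]
  refine (abs_add_le _ _).trans ?_
  have b1 := vnear.trans (mul_le_mul_of_nonneg_right n1 hX0)
  have b2 := vfar.trans (mul_le_mul_of_nonneg_right
    (mul_le_mul_of_nonneg_left (add_le_add a1 (add_le_add a1 a2)) zero_le_two) hY0)
  refine (add_le_add b1 b2).trans ?_
  have c1 : 0 ≤ C ^ 2 * (n * omega n) * (P * Y) := by positivity
  have c2 : 0 ≤ 2 * (2 * c + C * d) * (Q * X) := by positivity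
  nlinarith

/-- The second variation divided by `α_{n,s}`, with `τ = ε^{-s} / α_{n,s}`. -/
def qf (n : ℕ) (s τ : ℝ) (u ξ : Rn n → ℝ) : ℝ :=
  (1 / 4) * Bf n s ξ + τ * ∫ x, (3 * u x ^ 2 - 1) * ξ x ^ 2

/-- Quantitative almost stability on a ball. -/
def Stable (n : ℕ) (s τ : ℝ) (u : Rn n → ℝ) (κ : ℝ) (x : Rn n) (r : ℝ) : Prop :=
  ∀ ξ, IsCc1On n (ball x r) ξ → -(κ * r ^ (-s) * ∫ y, ξ y ^ 2) ≤ qf n s τ u ξ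

/-- The constant of the fractional Poincare inequality. -/
def cP (n : ℕ) : ℝ := omega n * (4 ^ (n + 1))⁻¹

lemma cP_pos (n : ℕ) : 0 < cP n := mul_pos (omega_pos n) (by positivity)

lemma cc1_zero {Ω : Set (Rn n)} {ξ : Rn n → ℝ} (h : IsCc1On n Ω ξ) {x : Rn n} (hx : x ∉ Ω) :
    ξ x = 0 := by
  by_contra h0
  exact hx (h.2.2 (subset_tsupport ξ h0))

lemma cc1_bddLip {Ω : Set (Rn n)} {ξ : Rn n → ℝ} (h : IsCc1On n Ω ξ) : ∃ C, BddLip ξ C := by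
  obtain ⟨K, hK⟩ := h.1.lipschitzWith_of_hasCompactSupport h.2.1 one_ne_zero
  obtain ⟨M, hM⟩ := h.2.1.exists_bound_of_continuous h.1.continuous
  refine ⟨max M K, fun x => (hM x).trans (le_max_left _ _), fun x y => ?_⟩
  have := hK.dist_le_mul x y
  rw [Real.dist_eq, dist_eq_norm] at this
  exact this.trans (mul_le_mul_of_nonneg_right (le_max_right _ _) (norm_nonneg _))

lemma sq_integrable {ξ : Rn n → ℝ} (h : Continuous ξ) (hc : HasCompactSupport ξ)
    {f : Rn n → ℝ} (hf : Continuous f) : Integrable fun x => f x * ξ x ^ 2 := by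
  refine (hf.mul (h.pow 2)).integrable_of_hasCompactSupport ?_
  refine HasCompactSupport.mul_left ?_
  rw [show ξ ^ 2 = ξ * ξ by rw [sq]]
  exact hc.mul_left

lemma sq_integrable' {ξ : Rn n → ℝ} (h : Continuous ξ) (hc : HasCompactSupport ξ) :
    Integrable fun x => ξ x ^ 2 := by
  simpa using sq_integrable h hc (f := fun _ => 1) continuous_const

lemma stable_of_small (hn : 1 ≤ n) (hs : s ∈ Ioo (0 : ℝ) 1) {τ κ K r : ℝ} {u : Rn n → ℝ}
    (hτ : 0 ≤ τ) (hκ : 0 ≤ κ) (hu : BddLip u K) (hr : 0 < r) (hsm : τ ≤ cP n / 4 * r ^ (-s))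
    (x : Rn n) : Stable n s τ u κ x r := by
  intro ξ hξ
  obtain ⟨C, hC⟩ := cc1_bddLip hξ
  have h1 := poincare hn hs hC hr (fun y hy => cc1_zero hξ hy)
  have h0 : 0 ≤ ∫ y, ξ y ^ 2 := integral_nonneg fun y => sq_nonneg _
  have i1 := sq_integrable' hξ.1.continuous hξ.2.1
  have i2 := sq_integrable hξ.1.continuous hξ.2.1 (f := fun y => 3 * u y ^ 2 - 1)
    (by have := hu.continuous; fun_prop)
  have h2 : -∫ y, ξ y ^ 2 ≤ ∫ y, (3 * u y ^ 2 - 1) * ξ y ^ 2 := by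
    rw [← integral_neg]
    refine integral_mono i1.neg i2 fun y => ?_
    simp only
    nlinarith [sq_nonneg (u y), sq_nonneg (ξ y), mul_nonneg (sq_nonneg (u y)) (sq_nonneg (ξ y))]
  have h3 : τ * ∫ y, ξ y ^ 2 ≤ cP n / 4 * r ^ (-s) * ∫ y, ξ y ^ 2 :=
    mul_le_mul_of_nonneg_right hsm h0
  have h4 : 0 ≤ κ * r ^ (-s) * ∫ y, ξ y ^ 2 := by positivity
  have h5 := mul_le_mul_of_nonneg_left h2 hτ
  unfold qf
  change cP n * r ^ (-s) * _ ≤ _ at h1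
  linarith

lemma cross_bound (hn : 1 ≤ n) (hs : s ∈ Ioo (0 : ℝ) 1) {ξ ζ : Rn n → ℝ} {C D : ℝ}
    (hξ : BddLip ξ C) (hζ : BddLip ζ D) {z z' : Rn n} {r r' : ℝ} (hr : 0 < r) (hr' : 0 < r')
    (hz : ∀ x, x ∉ ball z r → ξ x = 0) (hz' : ∀ x, x ∉ ball z' r' → ζ x = 0)
    (hd : 2 * (r + r') ≤ ‖z - z'‖)
    (iξ : Integrable fun x => ξ x ^ 2) (iζ : Integrable fun x => ζ x ^ 2) :
    ∫ p : Rn n × Rn n, (ξ p.1 - ξ p.2) * (ζ p.1 - ζ p.2) * J n s (p.1 - p.2) ≤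
      omega n * (r ^ (-s) * (∫ x, ξ x ^ 2) + r' ^ (-s) * ∫ x, ζ x ^ 2) := by
  have hi := (weak_form hn hs hξ hζ.continuous.measurable hζ.bd hz').1
  have hX : 0 ≤ ∫ x, ξ x ^ 2 := integral_nonneg fun x => sq_nonneg _
  have hY : 0 ≤ ∫ x, ζ x ^ 2 := integral_nonneg fun x => sq_nonneg _
  set ρ := r + r' with hρ
  have hρ0 : 0 < ρ := by positivity
  set c := ρ ^ (-((n : ℝ) + s)) with hc
  have hc0 : 0 < c := rpow_pos_of_pos hρ0 _
  let E : Rn n × Rn n → ℝ := fun p => c * (1 / 2) * (ξ p.1 ^ 2 * ib z' r' p.2 +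
    ib z r p.1 * ζ p.2 ^ 2)
  have iE1 : Integrable (fun p : Rn n × Rn n => ξ p.1 ^ 2 * ib z' r' p.2) :=
    iξ.mul_prod (ib_integrable z' r')
  have iE2 : Integrable (fun p : Rn n × Rn n => ib z r p.1 * ζ p.2 ^ 2) :=
    (ib_integrable z r).mul_prod iζ
  have iE : Integrable E := (iE1.add iE2).const_mul _
  have iEs : Integrable (fun p : Rn n × Rn n => E p.swap) := iE.swap
  have vE : ∫ p, E p = c * (1 / 2) * ((∫ x, ξ x ^ 2) * (omega n * r' ^ n) +
      (omega n * r ^ n) * ∫ x, ζ x ^ 2) := by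
    simp only [E]
    rw [integral_const_mul, integral_add iE1 iE2]
    have e1 : ∫ p : Rn n × Rn n, ξ p.1 ^ 2 * ib z' r' p.2 =
        (∫ x, ξ x ^ 2) * ∫ y, ib z' r' y := integral_prod_mul (fun x => ξ x ^ 2) (ib z' r')
    have e2 : ∫ p : Rn n × Rn n, ib z r p.1 * ζ p.2 ^ 2 =
        (∫ x, ib z r x) * ∫ y, ζ y ^ 2 := integral_prod_mul (ib z r) (fun x => ζ x ^ 2)
    rw [e1, e2, ib_integral z hr, ib_integral z' hr']
  have key : ∀ x y, |ξ x * ζ y| * J n s (x - y) ≤ E (x, y) := by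
    intro x y
    simp only [E]
    by_cases hx : x ∈ ball z r
    · by_cases hy : y ∈ ball z' r'
      · rw [ib_of_mem hx, ib_of_mem hy]
        rw [mem_ball, dist_eq_norm] at hx hy
        have hxy : ρ ≤ ‖x - y‖ := by
          have e : z - z' = (x - y) + ((y - z') - (x - z)) := by abel
          have h1 := norm_add_le (x - y) ((y - z') - (x - z))
          have h2 := norm_sub_le (y - z') (x - z)
          rw [← e] at h1
          linarith
        have hJ : J n s (x - y) ≤ c := by
          refine rpow_le_rpow_of_nonpos hρ0 hxy ?_
          have := hs.1
          have : (0 : ℝ) ≤ n := Nat.cast_nonneg _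
          linarith
        have ha : |ξ x * ζ y| ≤ (1 / 2) * (ξ x ^ 2 + ζ y ^ 2) := by
          rw [abs_mul]
          nlinarith [sq_nonneg (|ξ x| - |ζ y|), sq_abs (ξ x), sq_abs (ζ y)]
        calc _ ≤ (1 / 2) * (ξ x ^ 2 + ζ y ^ 2) * c :=
              mul_le_mul ha hJ (J_nonneg _) (by positivity)
          _ = _ := by ring
      · rw [hz' _ hy, ib_of_notMem hy]
        simp
    · rw [hz _ hx, ib_of_notMem hx]
      simp
  have hdis : ∀ x, ξ x * ζ x = 0 := by
    intro x
    by_cases hx : x ∈ ball z r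
    · by_cases hy : x ∈ ball z' r'
      · rw [mem_ball, dist_eq_norm] at hx hy
        exfalso
        have h1 := norm_sub_le (x - z') (x - z)
        rw [show (x - z') - (x - z) = z - z' by abel] at h1
        linarith
      · rw [hz' _ hy, mul_zero]
    · rw [hz _ hx, zero_mul]
  calc _ ≤ ∫ p : Rn n × Rn n, (E p + E p.swap) := by
        refine integral_mono hi (iE.add iEs) fun p => ?_
        have k1 := key p.1 p.2
        have k2 := key p.2 p.1
        rw [J_sub_comm p.2 p.1] at k2
        have hJ := J_nonneg (n := n) (s := s) (p.1 - p.2)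
        have e : (ξ p.1 - ξ p.2) * (ζ p.1 - ζ p.2) = -(ξ p.1 * ζ p.2) - ξ p.2 * ζ p.1 := by
          have := hdis p.1
          have := hdis p.2
          linarith
        change (ξ p.1 - ξ p.2) * (ζ p.1 - ζ p.2) * J n s (p.1 - p.2) ≤
          E (p.1, p.2) + E (p.2, p.1)
        rw [e, sub_mul]
        have a1 := mul_le_mul_of_nonneg_right (neg_le_abs (ξ p.1 * ζ p.2)) hJ
        have a2 := mul_le_mul_of_nonneg_right (neg_le_abs (ξ p.2 * ζ p.1)) hJ
        linarith
    _ = 2 * ∫ p, E p := by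
        rw [integral_add iE iEs, integral_swap_symm, two_mul]
    _ = c * ((∫ x, ξ x ^ 2) * (omega n * r' ^ n) + (omega n * r ^ n) * ∫ x, ζ x ^ 2) := by
        rw [vE]; ring
    _ ≤ _ := by
        have hcn : ∀ a b : ℝ, 0 < a → 0 < b → a ≤ ρ → b ≤ ρ → c * b ^ n ≤ a ^ (-s) := by
          intro a b ha hb haρ hbρ
          calc c * b ^ n ≤ c * ρ ^ n := by gcongr
            _ = ρ ^ (-s) := by
              rw [hc, ← rpow_natCast ρ n, ← rpow_add hρ0]
              congr 1
              ring
            _ ≤ a ^ (-s) := rpow_le_rpow_of_nonpos ha haρ (by linarith [hs.1])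
        have h1 := hcn r r' hr hr' (by linarith) (by linarith)
        have h2 := hcn r' r hr' hr (by linarith) (by linarith)
        have hω := (omega_pos n).le
        have g1 := mul_le_mul_of_nonneg_left h1 (mul_nonneg hω hX)
        have g2 := mul_le_mul_of_nonneg_left h2 (mul_nonneg hω hY)
        linarith

lemma cc1_smul {Ω : Set (Rn n)} {ξ : Rn n → ℝ} (h : IsCc1On n Ω ξ) (a : ℝ) :
    IsCc1On n Ω (fun x => a * ξ x) := by
  refine ⟨contDiff_const.mul h.1, h.2.1.mul_left, (tsupport_mul_subset_right).trans h.2.2⟩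

lemma cc1_mono {Ω Ω' : Set (Rn n)} {ξ : Rn n → ℝ} (h : IsCc1On n Ω ξ) (hs : Ω ⊆ Ω') :
    IsCc1On n Ω' ξ := ⟨h.1, h.2.1, h.2.2.trans hs⟩

lemma Bf_sum_le (hn : 1 ≤ n) (hs : s ∈ Ioo (0 : ℝ) 1) {N : ℕ} {ζ : Fin N → Rn n → ℝ}
    {z : Fin N → Rn n} {r : Fin N → ℝ} (hr : ∀ i, 0 < r i)
    (hζ : ∀ i, IsCc1On n (ball (z i) (r i)) (ζ i))
    (hd : ∀ i j, i ≠ j → 2 * (r i + r j) ≤ ‖z i - z j‖) :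
    Bf n s (fun x => ∑ i, ζ i x) ≤ ∑ i, Bf n s (ζ i) +
      2 * N * omega n * ∑ i, r i ^ (-s) * ∫ x, ζ i x ^ 2 := by
  have hz : ∀ i x, x ∉ ball (z i) (r i) → ζ i x = 0 := fun i x hx => cc1_zero (hζ i) hx
  have hbl : ∀ i, ∃ C, BddLip (ζ i) C := fun i => cc1_bddLip (hζ i)
  choose C hC using hbl
  have hsq : ∀ i, Integrable fun x => ζ i x ^ 2 := fun i =>
    sq_integrable' (hζ i).1.continuous (hζ i).2.1
  let β : Fin N → Fin N → Rn n × Rn n → ℝ := fun i j p =>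
    (ζ i p.1 - ζ i p.2) * (ζ j p.1 - ζ j p.2) * J n s (p.1 - p.2)
  have hβ : ∀ i j, Integrable (β i j) := fun i j =>
    (weak_form hn hs (hC i) (hC j).continuous.measurable (hC j).bd (hz j)).1
  have e : Bf n s (fun x => ∑ i, ζ i x) = ∑ i, ∑ j, ∫ p, β i j p := by
    have : ∀ i, ∑ j, ∫ p, β i j p = ∫ p, ∑ j, β i j p := fun i =>
      (integral_finsetSum _ fun j _ => hβ i j).symm
    simp_rw [this]
    rw [← integral_finsetSum _ fun i _ => integrable_finsetSum _ fun j _ => hβ i j, Bf]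
    congr 1
    funext p
    simp only [β]
    rw [← Finset.sum_sub_distrib, sq, Finset.sum_mul_sum, Finset.sum_mul]
    simp_rw [Finset.sum_mul]
  set X : Fin N → ℝ := fun i => r i ^ (-s) * ∫ x, ζ i x ^ 2 with hX
  have hX0 : ∀ i, 0 ≤ X i := fun i =>
    mul_nonneg (rpow_nonneg (hr i).le _) (integral_nonneg fun x => sq_nonneg _)
  have hω := (omega_pos n).le
  have hb : ∀ i j, ∫ p, β i j p ≤
      (if i = j then Bf n s (ζ i) else 0) + omega n * (X i + X j) := by
    intro i j
    by_cases hij : i = j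
    · subst hij
      rw [if_pos rfl]
      have : ∫ p, β i i p = Bf n s (ζ i) := by
        rw [Bf]
        congr 1
        funext p
        simp only [β]
        ring
      rw [this]
      have := mul_nonneg hω (add_nonneg (hX0 i) (hX0 i))
      linarith
    · rw [if_neg hij, zero_add]
      exact cross_bound hn hs (hC i) (hC j) (hr i) (hr j) (hz i) (hz j) (hd i j hij)
        (hsq i) (hsq j)
  rw [e]
  refine (Finset.sum_le_sum fun i _ => Finset.sum_le_sum fun j _ => hb i j).trans ?_
  simp_rw [Finset.sum_add_distrib, Finset.sum_ite_eq, ← Finset.mul_sum, Finset.sum_add_distrib]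
  simp only [Finset.mem_univ, if_true, Finset.sum_const, Finset.card_univ, Fintype.card_fin,
    nsmul_eq_mul]
  rw [← Finset.mul_sum]
  apply le_of_eq
  ring

/-- The Morse index bound for the normalized form `qf`. -/
def IdxLE (n : ℕ) (s τ : ℝ) (u : Rn n → ℝ) (Ω : Set (Rn n)) (m : ℕ) : Prop :=
  ∀ ξ : Fin (m + 1) → Rn n → ℝ, (∀ i, IsCc1On n Ω (ξ i)) → LinearIndependent ℝ ξ →
    ∃ a : Fin (m + 1) → ℝ, a ≠ 0 ∧ 0 ≤ qf n s τ u (fun x => ∑ i, a i * ξ i x)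

lemma ball_disj {z z' : Rn n} {r r' : ℝ} (h : r + r' ≤ ‖z - z'‖) {x : Rn n}
    (hx : x ∈ ball z r) : x ∉ ball z' r' := by
  intro hx'
  rw [mem_ball, dist_eq_norm] at hx hx'
  have h1 := norm_sub_le (x - z') (x - z)
  rw [show (x - z') - (x - z) = z - z' by abel] at h1
  linarith

lemma qf_smul (τ : ℝ) (u ξ : Rn n → ℝ) (a : ℝ) :
    qf n s τ u (fun x => a * ξ x) = a ^ 2 * qf n s τ u ξ := by
  have e1 : Bf n s (fun x => a * ξ x) = a ^ 2 * Bf n s ξ := by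
    rw [Bf, Bf, ← integral_const_mul]
    congr 1
    funext p
    ring
  have e2 : ∫ x, (3 * u x ^ 2 - 1) * (a * ξ x) ^ 2 =
      a ^ 2 * ∫ x, (3 * u x ^ 2 - 1) * ξ x ^ 2 := by
    rw [← integral_const_mul]
    congr 1
    funext x
    ring
  rw [qf, qf, e1, e2]
  ring

lemma unstable_family_false (hn : 1 ≤ n) (hs : s ∈ Ioo (0 : ℝ) 1) {τ K : ℝ} {u : Rn n → ℝ}
    {Ω : Set (Rn n)} {m : ℕ} (hu : BddLip u K) (hidx : IdxLE n s τ u Ω m)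
    {z : Fin (m + 1) → Rn n} {r : Fin (m + 1) → ℝ} (hr : ∀ i, 0 < r i)
    (hΩ : ∀ i, ball (z i) (r i) ⊆ Ω)
    (hd : ∀ i j, i ≠ j → 2 * (r i + r j) ≤ ‖z i - z j‖)
    (hun : ∀ i, ¬ Stable n s τ u ((m + 1) * omega n) (z i) (r i)) : False := by
  have h1 : ∀ i, ∃ ξ, IsCc1On n (ball (z i) (r i)) ξ ∧
      qf n s τ u ξ < -((m + 1) * omega n * r i ^ (-s) * ∫ y, ξ y ^ 2) := by
    intro i
    have := hun i
    unfold Stable at this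
    push Not at this
    exact this
  choose ξ hξ hlt using h1
  have hω := omega_pos n
  have hdis : ∀ i j, i ≠ j → ∀ x, ξ i x ≠ 0 → ξ j x = 0 := by
    intro i j hij x hx
    have hxi : x ∈ ball (z i) (r i) := by
      by_contra h
      exact hx (cc1_zero (hξ i) h)
    refine cc1_zero (hξ j) (ball_disj ?_ hxi)
    have := hd i j hij
    have := hr i
    have := hr j
    linarith
  have hne : ∀ i, ∃ x, ξ i x ≠ 0 := by
    intro i
    by_contra! h
    have h0 : ξ i = fun _ => 0 := funext h
    have := hlt i
    rw [h0] at this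
    simp [qf, Bf] at this
  choose y hy using hne
  have hlin : LinearIndependent ℝ ξ := by
    rw [Fintype.linearIndependent_iff]
    intro g hg i
    have h2 := congrFun hg (y i)
    simp only [Finset.sum_apply, Pi.smul_apply, smul_eq_mul, Pi.zero_apply] at h2
    rw [Finset.sum_eq_single i (fun j _ hj => by rw [hdis i j hj.symm _ (hy i), mul_zero])
      (fun h => absurd (Finset.mem_univ i) h)] at h2
    exact (mul_eq_zero.mp h2).resolve_right (hy i)
  obtain ⟨a, ha, hq⟩ := hidx ξ (fun i => cc1_mono (hξ i) (hΩ i)) hlin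
  set ζ : Fin (m + 1) → Rn n → ℝ := fun i x => a i * ξ i x with hζ
  have hζc : ∀ i, IsCc1On n (ball (z i) (r i)) (ζ i) := fun i => cc1_smul (hξ i) (a i)
  have hB := Bf_sum_le hn hs hr hζc hd
  have huc := hu.continuous
  have hpot : ∫ x, (3 * u x ^ 2 - 1) * (∑ i, ζ i x) ^ 2 =
      ∑ i, ∫ x, (3 * u x ^ 2 - 1) * ζ i x ^ 2 := by
    rw [← integral_finsetSum _ fun i _ => sq_integrable (hζc i).1.continuous (hζc i).2.1
      (f := fun x => 3 * u x ^ 2 - 1) (by fun_prop)]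
    congr 1
    funext x
    rw [← Finset.mul_sum]
    congr 1
    rw [sq, Finset.sum_mul_sum]
    refine Finset.sum_congr rfl fun i _ => ?_
    rw [Finset.sum_eq_single i _ (fun h => absurd (Finset.mem_univ i) h), sq]
    intro j _ hj
    by_cases h0 : ξ i x = 0
    · simp [hζ, h0]
    · simp [hζ, hdis i j hj.symm x h0]
  have hX0 : ∀ i, 0 ≤ r i ^ (-s) * ∫ x, ζ i x ^ 2 := fun i =>
    mul_nonneg (rpow_nonneg (hr i).le _) (integral_nonneg fun x => sq_nonneg _)
  have hle : qf n s τ u (fun x => ∑ i, ζ i x) ≤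
      ∑ i, (qf n s τ u (ζ i) + (m + 1) * omega n * (r i ^ (-s) * ∫ x, ζ i x ^ 2)) := by
    rw [Finset.sum_add_distrib, ← Finset.mul_sum]
    simp only [qf]
    rw [hpot, Finset.sum_add_distrib, ← Finset.mul_sum, ← Finset.mul_sum]
    have := mul_nonneg (mul_nonneg (by positivity : (0 : ℝ) ≤ m + 1) hω.le)
      (Finset.sum_nonneg fun i (_ : i ∈ Finset.univ) => hX0 i)
    push_cast at hB
    linarith
  have hsq : ∀ i, ∫ x, ζ i x ^ 2 = a i ^ 2 * ∫ x, ξ i x ^ 2 := fun i => by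
    rw [← integral_const_mul]
    congr 1
    funext x
    simp only [hζ]
    ring
  have hterm : ∀ i, qf n s τ u (ζ i) + (m + 1) * omega n * (r i ^ (-s) * ∫ x, ζ i x ^ 2) =
      a i ^ 2 * (qf n s τ u (ξ i) + (m + 1) * omega n * r i ^ (-s) * ∫ x, ξ i x ^ 2) := by
    intro i
    rw [hsq, hζ, qf_smul]
    ring
  have hneg : ∑ i, (qf n s τ u (ζ i) +
      (m + 1) * omega n * (r i ^ (-s) * ∫ x, ζ i x ^ 2)) < 0 := by
    obtain ⟨i, hi⟩ := Function.ne_iff.mp ha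
    refine Finset.sum_neg' (fun j _ => ?_) ⟨i, Finset.mem_univ i, ?_⟩
    · rw [hterm]
      exact mul_nonpos_of_nonneg_of_nonpos (sq_nonneg _) (by have := hlt j; linarith)
    · rw [hterm]
      have h2 : 0 < a i ^ 2 := by
        have : a i ≠ 0 := hi
        positivity
      exact mul_neg_of_pos_of_neg h2 (by have := hlt i; linarith)
  linarith

lemma exists_unstable_cover (hn : 1 ≤ n) (hs : s ∈ Ioo (0 : ℝ) 1) {τ K R rs : ℝ} {u : Rn n → ℝ}
    {p : Rn n} {m : ℕ} (hu : BddLip u K) (hidx : IdxLE n s τ u (ball p R) m)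
    (hrs : 0 < rs) (hsm : ∀ x r, 0 < r → r < rs → Stable n s τ u ((m + 1) * omega n) x r) :
    ∃ S : Finset (Rn n × ℝ), S.card ≤ m ∧ (∀ q ∈ S, rs ≤ q.2 ∧ q.1 ∈ ball p R) ∧
      ∀ x r, 0 < r → ball x r ⊆ ball p R → ¬ Stable n s τ u ((m + 1) * omega n) x r →
        ∃ q ∈ S, q.2 ≤ 2 * r ∧ ‖x - q.1‖ < 2 * (r + q.2) := by
  set T : Set (Rn n × ℝ) := {q | 0 < q.2 ∧ ball q.1 q.2 ⊆ ball p R ∧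
    ¬ Stable n s τ u ((m + 1) * omega n) q.1 q.2} with hT
  have hTr : ∀ q ∈ T, rs ≤ q.2 := by
    intro q hq
    by_contra! h
    exact hq.2.2 (hsm _ _ hq.1 h)
  obtain ⟨U, hUT, hUd, hUc⟩ := Vitali.exists_disjoint_subfamily_covering_enlargement
    (fun q : Rn n × ℝ => ball q.1 (2 * q.2)) T (fun q => q.2⁻¹) 2 one_lt_two
    (fun q hq => inv_nonneg.mpr hq.1.le) rs⁻¹ (fun q hq => inv_anti₀ hrs (hTr q hq))
    (fun q hq => nonempty_ball.mpr (mul_pos two_pos hq.1))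
  have hcard : ∀ F : Finset (Rn n × ℝ), (F : Set (Rn n × ℝ)) ⊆ U → F.card ≤ m := by
    intro F hF
    by_contra! hlt
    obtain ⟨G, hGF, hG⟩ := Finset.exists_subset_card_eq (Nat.succ_le_of_lt hlt)
    let e := G.equivFinOfCardEq hG
    have hGU : ∀ i, ((e.symm i : G) : Rn n × ℝ) ∈ U := fun i => hF (hGF (e.symm i).2)
    refine unstable_family_false hn hs hu hidx (z := fun i => (e.symm i : Rn n × ℝ).1)
      (r := fun i => (e.symm i : Rn n × ℝ).2) (fun i => (hUT (hGU i)).1)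
      (fun i => (hUT (hGU i)).2.1) (fun i j hij => ?_) (fun i => (hUT (hGU i)).2.2)
    have hne : ((e.symm i : G) : Rn n × ℝ) ≠ e.symm j := by
      intro h
      exact hij (e.symm.injective (Subtype.ext h))
    have hdj := hUd (hGU i) (hGU j) hne
    rw [Function.onFun, disjoint_ball_ball_iff (mul_pos two_pos (hUT (hGU i)).1)
      (mul_pos two_pos (hUT (hGU j)).1), dist_eq_norm] at hdj
    linarith
  have hfin : U.Finite := by
    by_contra hinf
    obtain ⟨F, hF, hFc⟩ := Set.Infinite.exists_subset_card_eq hinf (m + 1)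
    have := hcard F hF
    omega
  refine ⟨hfin.toFinset, hcard _ (by simp), fun q hq => ?_, fun x r hr hx hun => ?_⟩
  · have hq' := hUT (hfin.mem_toFinset.mp hq)
    exact ⟨hTr q hq', hq'.2.1 (mem_ball_self hq'.1)⟩
  · obtain ⟨q, hq, ⟨y, hy⟩, hle⟩ := hUc (x, r) ⟨hr, hx, hun⟩
    have hq0 := (hUT hq).1
    refine ⟨q, hfin.mem_toFinset.mpr hq, ?_, ?_⟩
    · have h2 : r⁻¹ ≤ 2 * q.2⁻¹ := hle
      rw [← div_eq_mul_inv, inv_eq_one_div, div_le_div_iff₀ hr hq0] at h2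
      linarith
    · have h1 := hy.1
      have h2 := hy.2
      simp only [mem_ball, dist_eq_norm] at h1 h2
      have h3 := norm_sub_le (y - q.1) (y - x)
      rw [show (y - q.1) - (y - x) = x - q.1 by abel] at h3
      linarith

/-- A `C¹` Lipschitz solution of the normalized equation in `ball p R`. -/
structure Sol (n : ℕ) (s τ K : ℝ) (u : Rn n → ℝ) (p : Rn n) (R : ℝ) : Prop where
  cd : ContDiff ℝ 1 u
  bl : BddLip u K
  le1 : ∀ x, |u x| ≤ 1
  eq : ∀ x ∈ ball p R, Lop n s u x + τ * (u x ^ 3 - u x) = 0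

lemma dq_bddLip {K t : ℝ} {u : Rn n → ℝ} {v : Rn n} (hu : BddLip u K) (ht : 0 < t)
    (hv : ‖v‖ = 1) : BddLip (dq u v t) (max K (2 * K / t)) where
  bd x := by
    refine le_max_of_le_left ?_
    rw [dq, abs_mul, abs_inv, abs_of_pos ht, inv_mul_le_iff₀ ht]
    have := hu.lip (x + t • v) x
    rwa [add_sub_cancel_left, norm_smul, hv, mul_one, Real.norm_eq_abs, abs_of_pos ht,
      mul_comm] at this
  lip x y := by
    have h1 := hu.lip (x + t • v) (y + t • v)
    have h2 := hu.lip x y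
    rw [add_sub_add_right_eq_sub] at h1
    have e : dq u v t x - dq u v t y =
        t⁻¹ * ((u (x + t • v) - u (y + t • v)) - (u x - u y)) := by rw [dq, dq]; ring
    rw [e, abs_mul, abs_inv, abs_of_pos ht]
    have h3 := abs_sub (u (x + t • v) - u (y + t • v)) (u x - u y)
    calc _ ≤ t⁻¹ * (2 * (K * ‖x - y‖)) := by
          refine mul_le_mul_of_nonneg_left ?_ (inv_nonneg.mpr ht.le)
          linarith
      _ = 2 * K / t * ‖x - y‖ := by rw [div_eq_mul_inv]; ring
      _ ≤ _ := mul_le_mul_of_nonneg_right (le_max_right _ _) (norm_nonneg _)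

lemma dq_abs_le {K t : ℝ} {u : Rn n → ℝ} {v : Rn n} (hu : BddLip u K) (ht : 0 < t)
    (hv : ‖v‖ = 1) (x : Rn n) : |dq u v t x| ≤ K := by
  rw [dq, abs_mul, abs_inv, abs_of_pos ht, inv_mul_le_iff₀ ht]
  have := hu.lip (x + t • v) x
  rwa [add_sub_cancel_left, norm_smul, hv, mul_one, Real.norm_eq_abs, abs_of_pos ht,
    mul_comm] at this

lemma dq_contDiff {t : ℝ} {u : Rn n → ℝ} {v : Rn n} (hu : ContDiff ℝ 1 u) :
    ContDiff ℝ 1 (dq u v t) := by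
  unfold dq
  exact contDiff_const.mul ((hu.comp (contDiff_id.add contDiff_const)).sub hu)

/-- The coefficient of the equation satisfied by the difference quotient. -/
def dqc (u : Rn n → ℝ) (v : Rn n) (t : ℝ) (x : Rn n) : ℝ :=
  u (x + t • v) ^ 2 + u (x + t • v) * u x + u x ^ 2 - 1

lemma Lop_dq (hn : 1 ≤ n) (hs : s ∈ Ioo (0 : ℝ) 1) {τ K R t : ℝ} {u : Rn n → ℝ} {p v x : Rn n}
    (hu : Sol n s τ K u p R) (hx : x ∈ ball p R) (hxt : x + t • v ∈ ball p R) :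
    Lop n s (dq u v t) x = -(τ * dqc u v t x * dq u v t x) := by
  have e1 : Lop n s (dq u v t) x = t⁻¹ * (Lop n s u (x + t • v) - Lop n s u x) := by
    have i1 := Lop_integrable hn hs hu.bl x
    have i2 := Lop_integrable hn hs hu.bl (x + t • v)
    have i2' : Integrable (fun y => (u (x + t • v) - u (y + t • v)) * J n s (x - y)) := by
      refine (i2.comp_add_right (t • v)).congr (ae_of_all _ fun y => ?_)
      simp only [add_sub_add_right_eq_sub]
    have h2 : Lop n s u (x + t • v) =
        ∫ y, (u (x + t • v) - u (y + t • v)) * J n s (x - y) := by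
      rw [Lop, ← integral_add_right_eq_self _ (t • v)]
      simp only [add_sub_add_right_eq_sub]
    rw [h2, Lop, Lop, ← integral_sub i2' i1, ← integral_const_mul]
    congr 1
    funext y
    rw [dq, dq]
    ring
  have h1 := hu.eq x hx
  have h2 := hu.eq _ hxt
  rw [e1, dqc, dq, eq_neg_of_add_eq_zero_left h1, eq_neg_of_add_eq_zero_left h2]
  ring

lemma dq_energy (hn : 1 ≤ n) (hs : s ∈ Ioo (0 : ℝ) 1) {τ K R t C r : ℝ} {u φ : Rn n → ℝ}
    {p v z : Rn n} (hu : Sol n s τ K u p R) (ht : 0 < t) (hv : ‖v‖ = 1) (hr : 0 < r)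
    (hφ : IsBump C z r φ) (hb : ball z (2 * r + t) ⊆ ball p R) :
    (1 / 2) * Bf n s (fun x => φ x * dq u v t x) +
      τ * ∫ x, dqc u v t x * (φ x * dq u v t x) ^ 2 = (1 / 2) * Df n s φ (dq u v t) := by
  have h1 := energy_identity hn hs hφ.bddLip (dq_bddLip hu.bl ht hv) (z := z) (r := 2 * r)
    (fun x hx => hφ.zero_two hr hx)
  have h2 : ∫ x, φ x ^ 2 * dq u v t x * Lop n s (dq u v t) x =
      -(τ * ∫ x, dqc u v t x * (φ x * dq u v t x) ^ 2) := by
    rw [← integral_const_mul, ← integral_neg]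
    congr 1
    funext x
    by_cases hx : x ∈ ball z (2 * r)
    · rw [mem_ball, dist_eq_norm] at hx
      have hx1 : x ∈ ball p R := hb (by rw [mem_ball, dist_eq_norm]; linarith)
      have hx2 : x + t • v ∈ ball p R := hb (by
        rw [mem_ball, dist_eq_norm, add_sub_right_comm]
        refine (norm_add_le _ _).trans_lt ?_
        rw [norm_smul, hv, mul_one, Real.norm_eq_abs, abs_of_pos ht]
        linarith)
      rw [Lop_dq hn hs hu hx1 hx2]
      ring
    · rw [hφ.zero_two hr hx]
      ring
  rw [h1, h2]
  ring

lemma bump_cc1 {t C r : ℝ} {u φ : Rn n → ℝ} {v z : Rn n} (hu : ContDiff ℝ 1 u) (hr : 0 < r)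
    (hφ : IsBump C z r φ) : IsCc1On n (ball z (2 * r)) (fun x => φ x * dq u v t x) :=
  ⟨hφ.cd.mul (dq_contDiff hu), hφ.hasCompactSupport.mul_right,
    (tsupport_mul_subset_left).trans (hφ.supp.trans (closedBall_subset_ball (by linarith)))⟩

lemma ball_le_bump {C r : ℝ} {w φ : Rn n → ℝ} {z : Rn n} (hw : Continuous w)
    (hφ : IsBump C z r φ) : ∫ x in ball z r, w x ^ 2 ≤ ∫ x, (φ x * w x) ^ 2 := by
  have i1 := sq_integrable' (hφ.cd.continuous.mul hw) (hφ.hasCompactSupport.mul_right (f' := w))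
  calc ∫ x in ball z r, w x ^ 2 = ∫ x in ball z r, (φ x * w x) ^ 2 := by
        refine setIntegral_congr_fun measurableSet_ball fun x hx => ?_
        simp only [hφ.one x hx, one_mul]
    _ ≤ _ := setIntegral_le_integral i1 (ae_of_all _ fun x => sq_nonneg _)

lemma stable_ball_le (hn : 1 ≤ n) (hs : s ∈ Ioo (0 : ℝ) 1) {τ K R t C r κ N : ℝ}
    {u φ : Rn n → ℝ} {p v z : Rn n} (hu : Sol n s τ K u p R) (hτ : 0 ≤ τ) (ht : 0 < t)
    (hv : ‖v‖ = 1) (hr : 0 < r) (hφ : IsBump C z r φ) (hb : ball z (2 * r + t) ⊆ ball p R)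
    (hN : 1 ≤ N) (hκ : κ * N ^ (-s) ≤ cP n / 16) (hst : Stable n s τ u κ z (N * (2 * r)))
    (hsm : 3 * τ * K * t ≤ cP n / 16 * (2 * r) ^ (-s)) :
    ∫ x in ball z r, dq u v t x ^ 2 ≤ 8 / cP n * r ^ s * |Df n s φ (dq u v t)| := by
  have hE := dq_energy hn hs hu ht hv hr hφ hb
  have hcc := bump_cc1 (t := t) (v := v) hu.cd hr hφ
  have hcc' : IsCc1On n (ball z (N * (2 * r))) (fun x => φ x * dq u v t x) :=
    cc1_mono hcc (ball_subset_ball (by nlinarith))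
  have hS := hst _ hcc'
  obtain ⟨D, hD⟩ := cc1_bddLip hcc
  have hP := poincare hn hs hD (mul_pos two_pos hr) (fun x hx => cc1_zero hcc hx)
  change cP n * _ * _ ≤ _ at hP
  have hle := ball_le_bump (dq_bddLip hu.bl ht hv).continuous hφ
  have huc := hu.bl.continuous
  have i0 := sq_integrable' hcc.1.continuous hcc.2.1
  have i1 := sq_integrable hcc.1.continuous hcc.2.1 (f := fun x => 3 * u x ^ 2 - 1) (by fun_prop)
  have i2 := sq_integrable hcc.1.continuous hcc.2.1 (f := dqc u v t)
    (by unfold dqc; fun_prop)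
  have hX0 : 0 ≤ ∫ x, (φ x * dq u v t x) ^ 2 := integral_nonneg fun x => sq_nonneg _
  have herr : (∫ x, (3 * u x ^ 2 - 1) * (φ x * dq u v t x) ^ 2) -
      ∫ x, dqc u v t x * (φ x * dq u v t x) ^ 2 ≤ 3 * K * t * ∫ x, (φ x * dq u v t x) ^ 2 := by
    rw [← integral_sub i1 i2, ← integral_const_mul]
    refine integral_mono (i1.sub i2) (i0.const_mul _) fun x => ?_
    simp only
    rw [← sub_mul]
    refine mul_le_mul_of_nonneg_right ?_ (sq_nonneg _)
    have e : 3 * u x ^ 2 - 1 - dqc u v t x = (u x - u (x + t • v)) * (2 * u x + u (x + t • v)) := by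
      rw [dqc]; ring
    rw [e]
    refine (le_abs_self _).trans ?_
    rw [abs_mul]
    have h1 := hu.bl.lip x (x + t • v)
    rw [sub_add_cancel_left, norm_neg, norm_smul, hv, mul_one, Real.norm_eq_abs,
      abs_of_pos ht] at h1
    have h2 : |2 * u x + u (x + t • v)| ≤ 3 := by
      have a1 := abs_le.mp (hu.le1 x)
      have a2 := abs_le.mp (hu.le1 (x + t • v))
      rw [abs_le]
      constructor <;> linarith [a1.1, a1.2, a2.1, a2.2]
    calc _ ≤ K * t * 3 := mul_le_mul h1 h2 (abs_nonneg _) ((abs_nonneg _).trans h1)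
      _ = _ := by ring
  set X := ∫ x, (φ x * dq u v t x) ^ 2
  have hpos : 0 < (2 * r) ^ (-s) := rpow_pos_of_pos (by positivity) _
  rw [mul_rpow (by linarith : (0 : ℝ) ≤ N) (by positivity)] at hS
  have hκ' : κ * (N ^ (-s) * (2 * r) ^ (-s)) * X ≤ cP n / 16 * (2 * r) ^ (-s) * X := by
    rw [← mul_assoc]
    gcongr
  have hsm' := mul_le_mul_of_nonneg_right hsm hX0
  have herr' := mul_le_mul_of_nonneg_left herr hτ
  have hab := le_abs_self (Df n s φ (dq u v t))
  have hfin : cP n / 8 * (2 * r) ^ (-s) * X ≤ 1 / 2 * |Df n s φ (dq u v t)| := by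
    unfold qf at hS
    nlinarith
  have hc := cP_pos n
  have h2s : (2 * r) ^ s ≤ 2 * r ^ s := by
    rw [mul_rpow zero_le_two hr.le]
    gcongr
    calc (2 : ℝ) ^ s ≤ 2 ^ (1 : ℝ) := rpow_le_rpow_of_exponent_le one_le_two hs.2.le
      _ = 2 := rpow_one _
  refine hle.trans ?_
  have hinv : (2 * r) ^ s * (2 * r) ^ (-s) = 1 := by
    rw [← rpow_add (by positivity), add_neg_cancel, rpow_zero]
  have hr2 : 0 ≤ (2 * r) ^ s := rpow_nonneg (by positivity) _
  calc X = 8 / cP n * ((2 * r) ^ s * (cP n / 8 * (2 * r) ^ (-s) * X)) := by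
        rw [show (2 * r) ^ s * (cP n / 8 * (2 * r) ^ (-s) * X) =
          (2 * r) ^ s * (2 * r) ^ (-s) * (cP n / 8 * X) by ring, hinv]
        field_simp
    _ ≤ 8 / cP n * ((2 * r) ^ s * (1 / 2 * |Df n s φ (dq u v t)|)) := by gcongr
    _ ≤ 8 / cP n * ((2 * r ^ s) * (1 / 2 * |Df n s φ (dq u v t)|)) := by gcongr
    _ = _ := by ring

lemma basic_inequality (hn : 1 ≤ n) {s₀ C : ℝ} (hs₀ : s₀ ∈ Ioo (0 : ℝ) 1) (hC : 0 ≤ C) :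
    ∃ C₃ : ℝ, 0 < C₃ ∧ ∀ s ∈ Ioo s₀ 1, ∀ (τ K R t r κ N δ : ℝ) (u φ : Rn n → ℝ) (p v z : Rn n),
      Sol n s τ K u p R → 0 ≤ τ → 0 < t → ‖v‖ = 1 → 0 < r → IsBump C z r φ →
      ball z (2 * r + t) ⊆ ball p R → 1 ≤ N → κ * N ^ (-s) ≤ cP n / 16 →
      Stable n s τ u κ z (N * (2 * r)) → 3 * τ * K * t ≤ cP n / 16 * (2 * r) ^ (-s) →
      0 < δ → δ ≤ 1 / 2 →
      ∫ x in ball z r, dq u v t x ^ 2 ≤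
        C₃ * (δ * (∫ x in ball z (2 * r), dq u v t x ^ 2) + δ⁻¹ ^ 5 * (r ^ n / r ^ 2)) := by
  obtain ⟨C₁, hC₁, H⟩ := Df_estimate hn hs₀ hC
  have hc := cP_pos n
  have hω := omega_pos n
  refine ⟨8 / cP n * C₁ * (2 + omega n * 2 ^ n), by positivity, ?_⟩
  intro s hs τ K R t r κ N δ u φ p v z hu hτ ht hv hr hφ hb hN hκ hst hsm hδ hδ2
  have hs' : s ∈ Ioo (0 : ℝ) 1 := ⟨hs₀.1.trans hs.1, hs.2⟩
  have h1 := stable_ball_le hn hs' hu hτ ht hv hr hφ hb hN hκ hst hsm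
  have hw := dq_bddLip hu.bl ht hv
  have h2 := H s hs δ r t K v z u φ hδ hδ2 hr ht hv hu.bl hu.le1 ⟨_, hw⟩ hφ
  have hwc := hw.continuous
  have hfin : ∀ f : Rn n → ℝ, Continuous f → IntegrableOn f (ball z (2 * r)) := fun f hf =>
    (hf.continuousOn.integrableOn_compact (isCompact_closedBall z (2 * r))).mono_set
      ball_subset_closedBall
  have i1 := hfin (fun x => dq u v t x ^ 2) (by fun_prop)
  have i2 := hfin (fun x => |dq u v t x|) (by fun_prop)
  have hAG : δ⁻¹ ^ 2 * r⁻¹ * (∫ x in ball z (2 * r), |dq u v t x|) ≤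
      δ * (∫ x in ball z (2 * r), dq u v t x ^ 2) +
        δ⁻¹ ^ 5 * r⁻¹ ^ 2 * (omega n * (2 * r) ^ n) := by
    have : δ⁻¹ ^ 5 * r⁻¹ ^ 2 * (omega n * (2 * r) ^ n) =
        ∫ x in ball z (2 * r), δ⁻¹ ^ 5 * r⁻¹ ^ 2 := by
      rw [setIntegral_const, volume_ball z (by positivity), smul_eq_mul]
      ring
    have ic := hfin (fun _ => δ⁻¹ ^ 5 * r⁻¹ ^ 2) continuous_const
    rw [this, ← integral_const_mul, ← integral_const_mul, ← integral_add (i1.const_mul _) ic]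
    refine integral_mono (i2.const_mul _) ((i1.const_mul _).add ic) fun x => ?_
    simp only
    have h3 : δ * (|dq u v t x| - δ⁻¹ ^ 3 * r⁻¹) ^ 2 = δ * dq u v t x ^ 2 -
        2 * (δ⁻¹ ^ 2 * r⁻¹ * |dq u v t x|) + δ⁻¹ ^ 5 * r⁻¹ ^ 2 := by
      rw [sub_sq, sq_abs]
      field_simp
    have h4 : 0 ≤ δ * (|dq u v t x| - δ⁻¹ ^ 3 * r⁻¹) ^ 2 := by positivity
    have h5 : 0 ≤ δ⁻¹ ^ 2 * r⁻¹ * |dq u v t x| := by positivity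
    linarith
  set X := ∫ x in ball z (2 * r), dq u v t x ^ 2 with hX
  have hX0 : 0 ≤ X := integral_nonneg fun x => sq_nonneg _
  set Y := ∫ x in ball z (2 * r), |dq u v t x|
  have hrs : r ^ s * r ^ (-s) = 1 := by rw [← rpow_add hr, add_neg_cancel, rpow_zero]
  have hrs1 : r ^ s * r ^ (-1 - s) = r⁻¹ := by
    rw [← rpow_add hr, ← rpow_neg_one]
    congr 1
    ring
  calc _ ≤ 8 / cP n * r ^ s * |Df n s φ (dq u v t)| := h1
    _ ≤ 8 / cP n * r ^ s * (C₁ * (δ * r ^ (-s) * X + δ⁻¹ ^ 2 * r ^ (-1 - s) * Y)) := by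
        gcongr
    _ = 8 / cP n * C₁ * (δ * X * (r ^ s * r ^ (-s)) + δ⁻¹ ^ 2 * (r ^ s * r ^ (-1 - s)) * Y) := by
        ring
    _ = 8 / cP n * C₁ * (δ * X + δ⁻¹ ^ 2 * r⁻¹ * Y) := by rw [hrs, hrs1, mul_one]
    _ ≤ 8 / cP n * C₁ * (δ * X + (δ * X + δ⁻¹ ^ 5 * r⁻¹ ^ 2 * (omega n * (2 * r) ^ n))) := by
        gcongr
    _ = 8 / cP n * C₁ * (2 * (δ * X) + omega n * 2 ^ n * (δ⁻¹ ^ 5 * (r ^ n / r ^ 2))) := by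
        rw [mul_pow]
        field_simp
        ring
    _ ≤ 8 / cP n * C₁ * ((2 + omega n * 2 ^ n) * (δ * X) +
          (2 + omega n * 2 ^ n) * (δ⁻¹ ^ 5 * (r ^ n / r ^ 2))) := by
        have : 0 < omega n * 2 ^ n := by positivity
        gcongr
        · linarith
        · linarith
    _ = _ := by ring

open ENNReal in
lemma averaging {f ρ h : Rn n → ℝ} {E E' : Set (Rn n)} (hf : Continuous f) (hf0 : ∀ x, 0 ≤ f x)
    (hρ : ∀ x y, |ρ x - ρ y| ≤ 1 / 4 * ‖x - y‖) (hE : MeasurableSet E) (hE' : MeasurableSet E')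
    (hEb : Bornology.IsBounded E)
    (hpos : ∀ x ∈ E', 0 < ρ x) (hEE' : ∀ y ∈ E, 0 < ρ y ∧ ball y (ρ y / 2) ⊆ E')
    (hh : ∀ x ∈ E', ∫ y in ball x (ρ x), f y ≤ ρ x ^ n * h x) (hint : IntegrableOn h E') :
    omega n * (4 / 9) ^ n * ∫ x in E, f x ≤ ∫ x in E', h x := by
  have hρc : Continuous ρ := by
    have : LipschitzWith (1 / 4) ρ := LipschitzWith.of_dist_le_mul fun x y => by
      rw [Real.dist_eq, dist_eq_norm]
      simpa using hρ x y
    exact this.continuous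
  have hω := omega_pos n
  have hfi : ∀ x r, IntegrableOn f (ball x r) := fun x r =>
    (hf.continuousOn.integrableOn_compact (isCompact_closedBall x r)).mono_set
      ball_subset_closedBall
  have hfE : IntegrableOn f E := by
    obtain ⟨r, hr⟩ := hEb.subset_ball (0 : Rn n)
    exact (hfi 0 r).mono_set hr
  have hh0 : ∀ x ∈ E', 0 ≤ h x := fun x hx => by
    have h1 : 0 ≤ ∫ y in ball x (ρ x), f y := integral_nonneg fun y => hf0 y
    have h2 := h1.trans (hh x hx)
    exact nonneg_of_mul_nonneg_right h2 (pow_pos (hpos x hx) n)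
  let A : Set (Rn n × Rn n) := {q | dist q.1 q.2 < ρ q.1}
  have hA : MeasurableSet A := by
    have : IsOpen A := isOpen_lt (by fun_prop) (by fun_prop)
    exact this.measurableSet
  let g : Rn n → Rn n → ℝ≥0∞ := fun x y =>
    ENNReal.ofReal ((ρ x ^ n)⁻¹) * A.indicator 1 (x, y)
  have hg : Measurable (Function.uncurry g) := by
    refine Measurable.mul ?_ ?_
    · exact (ENNReal.measurable_ofReal.comp
        ((hρc.pow n).measurable.inv)).comp measurable_fst
    · exact (measurable_one.indicator hA)
  have hfm : Measurable fun y => ENNReal.ofReal (f y) :=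
    ENNReal.measurable_ofReal.comp hf.measurable
  have hlow : ∀ y ∈ E, ENNReal.ofReal (omega n * (4 / 9) ^ n) ≤ ∫⁻ x in E', g x y := by
    intro y hy
    obtain ⟨hy0, hsub⟩ := hEE' y hy
    calc ENNReal.ofReal (omega n * (4 / 9) ^ n)
        = ∫⁻ x in ball y (ρ y / 2), ENNReal.ofReal (((9 / 8 * ρ y) ^ n)⁻¹) := by
          rw [setLIntegral_const, ← ENNReal.ofReal_toReal (measure_ball_lt_top (μ := volume)
            (x := y) (r := ρ y / 2)).ne]
          change _ = _ * ENNReal.ofReal (volume.real _)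
          rw [volume_ball y (by positivity), ← ENNReal.ofReal_mul (by positivity)]
          congr 1
          have : (0 : ℝ) < ρ y ^ n := by positivity
          rw [mul_pow, div_pow, div_pow, div_pow, mul_inv, inv_div]
          have e : (4 : ℝ) ^ n * 2 ^ n = 8 ^ n := by rw [← mul_pow]; norm_num
          field_simp
          rw [← e]
      _ ≤ ∫⁻ x in ball y (ρ y / 2), g x y := by
          refine setLIntegral_mono' measurableSet_ball fun x hx => ?_
          have hx' := hx
          rw [mem_ball, dist_eq_norm] at hx'
          have h1 := abs_le.mp (hρ x y)
          have hmem : (x, y) ∈ A := by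
            change dist x y < ρ x
            rw [dist_eq_norm]
            linarith [h1.1]
          have hx0 := hpos x (hsub hx)
          simp only [g, indicator_of_mem hmem, Pi.one_apply, mul_one]
          refine ENNReal.ofReal_le_ofReal ?_
          refine inv_anti₀ (by positivity) (pow_le_pow_left₀ hx0.le ?_ n)
          linarith [h1.2]
      _ ≤ _ := lintegral_mono_set hsub
  have hL : ENNReal.ofReal (omega n * (4 / 9) ^ n) * ∫⁻ y in E, ENNReal.ofReal (f y) ≤
      ∫⁻ x in E', ENNReal.ofReal (h x) := by
    calc _ = ∫⁻ y in E, ENNReal.ofReal (omega n * (4 / 9) ^ n) * ENNReal.ofReal (f y) :=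
          (lintegral_const_mul _ hfm).symm
      _ ≤ ∫⁻ y in E, (∫⁻ x in E', g x y) * ENNReal.ofReal (f y) :=
          setLIntegral_mono' hE fun y hy => mul_le_mul_left (hlow y hy) _
      _ = ∫⁻ y in E, ∫⁻ x in E', g x y * ENNReal.ofReal (f y) := by
          refine lintegral_congr fun y => ?_
          rw [lintegral_mul_const]
          exact hg.comp (measurable_id.prodMk measurable_const)
      _ = ∫⁻ x in E', ∫⁻ y in E, g x y * ENNReal.ofReal (f y) := by
          rw [lintegral_lintegral_swap]
          refine Measurable.aemeasurable ?_
          exact (hg.comp measurable_swap).mul (hfm.comp measurable_fst)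
      _ ≤ ∫⁻ x in E', ENNReal.ofReal (h x) := by
          refine setLIntegral_mono' hE' fun x hx => ?_
          have hx0 := hpos x hx
          calc ∫⁻ y in E, g x y * ENNReal.ofReal (f y)
              ≤ ∫⁻ y, g x y * ENNReal.ofReal (f y) := setLIntegral_le_lintegral _ _
            _ = ∫⁻ y, ENNReal.ofReal ((ρ x ^ n)⁻¹) *
                (ball x (ρ x)).indicator (fun y => ENNReal.ofReal (f y)) y := by
                refine lintegral_congr fun y => ?_
                simp only [g]
                rw [mul_assoc]
                congr 1
                by_cases hy : y ∈ ball x (ρ x)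
                · have hm : (x, y) ∈ A := by
                    change dist x y < ρ x
                    rw [dist_comm]
                    exact hy
                  rw [indicator_of_mem hy, indicator_of_mem hm, Pi.one_apply, one_mul]
                · have hm : (x, y) ∉ A := by
                    change ¬ dist x y < ρ x
                    rw [dist_comm]
                    exact hy
                  rw [indicator_of_notMem hy, indicator_of_notMem hm, zero_mul]
            _ = ENNReal.ofReal ((ρ x ^ n)⁻¹) * ∫⁻ y in ball x (ρ x), ENNReal.ofReal (f y) := by
                rw [lintegral_const_mul _ (hfm.indicator measurableSet_ball),
                  lintegral_indicator measurableSet_ball]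
            _ = ENNReal.ofReal ((ρ x ^ n)⁻¹ * ∫ y in ball x (ρ x), f y) := by
                rw [ENNReal.ofReal_mul (by positivity),
                  ofReal_integral_eq_lintegral_ofReal (hfi _ _) (ae_of_all _ hf0)]
            _ ≤ _ := by
                refine ENNReal.ofReal_le_ofReal ?_
                rw [inv_mul_le_iff₀ (by positivity)]
                exact hh x hx
  rw [← ofReal_integral_eq_lintegral_ofReal hfE (ae_of_all _ hf0),
    ← ofReal_integral_eq_lintegral_ofReal hint
      ((ae_restrict_iff' hE').mpr (ae_of_all _ hh0)), ← ENNReal.ofReal_mul (by positivity)] at hL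
  exact (ENNReal.ofReal_le_ofReal_iff (setIntegral_nonneg hE' hh0)).mp hL

/-- The regularity scale determined by the centers and radii in `S`. -/
def ell (S : Finset (Rn n × ℝ)) (p : Rn n) (R : ℝ) (x : Rn n) : ℝ :=
  S.fold min (7 * R / 8 - ‖x - p‖) fun q => max ‖x - q.1‖ q.2 / 6

lemma le_ell {S : Finset (Rn n × ℝ)} {p x : Rn n} {R a : ℝ} : a ≤ ell S p R x ↔
    a ≤ 7 * R / 8 - ‖x - p‖ ∧ ∀ q ∈ S, a ≤ max ‖x - q.1‖ q.2 / 6 := Finset.le_fold_min a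

lemma lt_ell {S : Finset (Rn n × ℝ)} {p x : Rn n} {R a : ℝ} : a < ell S p R x ↔
    a < 7 * R / 8 - ‖x - p‖ ∧ ∀ q ∈ S, a < max ‖x - q.1‖ q.2 / 6 := Finset.lt_fold_min a

lemma ell_lip (S : Finset (Rn n × ℝ)) (p : Rn n) (R : ℝ) (x y : Rn n) :
    |ell S p R x - ell S p R y| ≤ ‖x - y‖ := by
  have key : ∀ x y : Rn n, ell S p R x - ‖x - y‖ ≤ ell S p R y := by
    intro x y
    have hx := le_ell.mp (le_refl (ell S p R x))
    refine le_ell.mpr ⟨?_, fun q hq => ?_⟩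
    · have h1 := norm_sub_le_norm_sub_add_norm_sub y x p
      rw [norm_sub_rev y x] at h1
      linarith [hx.1]
    · have h1 := hx.2 q hq
      have h2 := norm_sub_le_norm_sub_add_norm_sub x y q.1
      have h3 : max ‖x - q.1‖ q.2 ≤ max ‖y - q.1‖ q.2 + ‖x - y‖ := by
        refine max_le ?_ ?_
        · linarith [le_max_left ‖y - q.1‖ q.2]
        · linarith [le_max_right ‖y - q.1‖ q.2, norm_nonneg (x - y)]
      linarith [norm_nonneg (x - y)]
  have h1 := key x y
  have h2 := key y x
  rw [norm_sub_rev y x] at h2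
  rw [abs_le]
  constructor <;> linarith

lemma ell_cases (S : Finset (Rn n × ℝ)) (p : Rn n) (R : ℝ) (x : Rn n) :
    ell S p R x = 7 * R / 8 - ‖x - p‖ ∨ ∃ q ∈ S, ell S p R x = max ‖x - q.1‖ q.2 / 6 := by
  by_contra! h
  have h0 := le_ell.mp (le_refl (ell S p R x))
  exact lt_irrefl _ (lt_ell.mpr ⟨lt_of_le_of_ne h0.1 h.1, fun q hq =>
    lt_of_le_of_ne (h0.2 q hq) (h.2 q hq)⟩)

lemma ell_sum_le (S : Finset (Rn n × ℝ)) (p : Rn n) (R : ℝ) (x : Rn n) {F : ℝ → ℝ}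
    (h0 : 0 ≤ F (7 * R / 8 - ‖x - p‖)) (hS : ∀ q ∈ S, 0 ≤ F (max ‖x - q.1‖ q.2 / 6)) :
    F (ell S p R x) ≤ F (7 * R / 8 - ‖x - p‖) + ∑ q ∈ S, F (max ‖x - q.1‖ q.2 / 6) := by
  rcases ell_cases S p R x with h | ⟨q, hq, h⟩
  · rw [h]
    linarith [Finset.sum_nonneg hS]
  · rw [h]
    have := Finset.single_le_sum hS hq
    linarith

/-- `ℓ` is a scale below which `u` is almost stable, at distance at least `R / 8` from the
boundary of `ball p R`. -/
structure Scale (n : ℕ) (s τ : ℝ) (u : Rn n → ℝ) (p : Rn n) (R κ : ℝ) (ℓ : Rn n → ℝ) : Prop where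
  lip : ∀ x y, |ℓ x - ℓ y| ≤ ‖x - y‖
  le : ∀ x, ℓ x ≤ 7 * R / 8 - ‖x - p‖
  st : ∀ x r, 0 < r → r < ℓ x → Stable n s τ u κ x r

lemma doubling {f : Rn n → ℝ} (hf : Continuous f) (hf0 : ∀ x, 0 ≤ f x) {x : Rn n} {r M : ℝ}
    (hr : 0 < r)
    (h : ∀ y ∈ ball x (3 * r), ∫ z in ball y (r / 2), f z ≤ M * ((r / 2) ^ n / (r / 2) ^ 2)) :
    ∫ z in ball x (2 * r), f z ≤ 4 * (27 / 4) ^ n * M * (r ^ n / r ^ 2) := by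
  have hω := omega_pos n
  have h1 := averaging hf hf0 (ρ := fun _ => r / 2) (h := fun _ => M / (r / 2) ^ 2)
    (E := ball x (2 * r)) (E' := ball x (3 * r)) (fun y z => by simp)
    measurableSet_ball measurableSet_ball isBounded_ball (fun _ _ => by positivity)
    (fun y hy => ⟨by positivity, fun z hz => by
      rw [mem_ball] at hy hz ⊢
      linarith [dist_triangle z y x]⟩)
    (fun y hy => (h y hy).trans (le_of_eq (by ring)))
    (integrableOn_const (measure_ball_lt_top.ne))
  rw [setIntegral_const, volume_ball x (by positivity), smul_eq_mul, mul_pow] at h1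
  have e : (27 / 4 : ℝ) ^ n = 3 ^ n * ((4 / 9) ^ n)⁻¹ := by
    rw [← inv_pow, ← mul_pow]
    norm_num
  have h2 : (0 : ℝ) < omega n * (4 / 9) ^ n := by positivity
  rw [← le_div_iff₀' h2] at h1
  refine h1.trans (le_of_eq ?_)
  rw [e]
  field_simp
  try ring

lemma dq_sq_setIntegral_le {u : Rn n → ℝ} {v x : Rn n} {t K r : ℝ} (hu : BddLip u K) (ht : 0 < t)
    (hv : ‖v‖ = 1) (hr : 0 < r) : ∫ y in ball x r, dq u v t y ^ 2 ≤ K ^ 2 * (omega n * r ^ n) := by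
  have h : ∀ y ∈ ball x r, ‖dq u v t y ^ 2‖ ≤ K ^ 2 := fun y _ => by
    rw [Real.norm_eq_abs, abs_pow]
    exact pow_le_pow_left₀ (abs_nonneg _) (dq_abs_le hu ht hv y) 2
  have := norm_setIntegral_le_of_norm_le_const (μ := volume) measure_ball_lt_top h
  rw [volume_ball x hr] at this
  exact (le_abs_self _).trans this

lemma absorption (hn : 1 ≤ n) {s₀ : ℝ} (hs₀ : s₀ ∈ Ioo (0 : ℝ) 1) :
    ∃ C₄ : ℝ, 0 < C₄ ∧ ∀ s ∈ Ioo s₀ 1, ∀ (τ K R t κ N : ℝ) (u ℓ : Rn n → ℝ) (p v : Rn n),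
      Sol n s τ K u p R → 0 ≤ τ → Scale n s τ u p R κ ℓ → 0 < t → t ≤ R / 8 →
      3 * τ * K * t ≤ cP n / 16 * R ^ (-s) → ‖v‖ = 1 → 2 ≤ N → κ * N ^ (-s) ≤ cP n / 16 →
      ∀ x r, 0 < r → 4 * N * r ≤ ℓ x →
        ∫ y in ball x r, dq u v t y ^ 2 ≤ C₄ * (r ^ n / r ^ 2) := by
  obtain ⟨C, hC, Hφ⟩ := exists_bump n
  obtain ⟨C₃, hC₃, H⟩ := basic_inequality hn hs₀ (zero_le_one.trans hC)
  set A : ℝ := 4 * (27 / 4) ^ n with hA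
  have hA0 : 0 < A := by positivity
  set δ : ℝ := (2 * C₃ * A + 2)⁻¹ with hδ
  have hδ0 : 0 < δ := by positivity
  have hδ2 : δ ≤ 1 / 2 := by
    rw [hδ, one_div]
    exact inv_anti₀ two_pos (by nlinarith [mul_pos hC₃ hA0])
  have hδA : C₃ * δ * A ≤ 1 / 2 := by
    rw [hδ, mul_right_comm, ← div_eq_mul_inv, div_le_iff₀ (by positivity)]
    linarith
  set B : ℝ := C₃ * δ⁻¹ ^ 5 with hB
  have hB0 : 0 < B := by positivity
  refine ⟨2 * B, by positivity, ?_⟩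
  intro s hs τ K R t κ N u ℓ p v hu hτ hℓ ht htR htK hv hN hκ
  have hs' : s ∈ Ioo (0 : ℝ) 1 := ⟨hs₀.1.trans hs.1, hs.2⟩
  have hω := omega_pos n
  have hrR : ∀ x r, 4 * N * r ≤ ℓ x → 8 * r ≤ R ∨ r ≤ 0 := by
    intro x r h
    by_contra! h0
    have h1 := hℓ.le x
    nlinarith [norm_nonneg (x - p)]
  let P : ℝ → Prop := fun M => ∀ x r, 0 < r → 4 * N * r ≤ ℓ x →
    ∫ y in ball x r, dq u v t y ^ 2 ≤ M * (r ^ n / r ^ 2)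
  have hcont : Continuous (dq u v t) := (dq_contDiff hu.cd).continuous
  have step : ∀ M, P M → P (M / 2 + B) := by
    intro M hM x r hr hx
    have hrx : 8 * r ≤ R := (hrR x r hx).resolve_right hr.not_ge
    obtain ⟨φ, hφ⟩ := Hφ x r hr
    have h1 := H s hs τ K R t r κ N δ u φ p v x hu hτ ht hv hr hφ
      (fun y hy => by
        rw [mem_ball, dist_eq_norm] at hy ⊢
        have h1 := hℓ.le x
        have h2 := norm_sub_le_norm_sub_add_norm_sub y x p
        nlinarith) (by linarith) hκ
      (hℓ.st _ _ (by positivity) (by nlinarith))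
      (htK.trans (mul_le_mul_of_nonneg_left
        (rpow_le_rpow_of_nonpos (by positivity) (by linarith) (by linarith [hs'.1]))
        (by linarith [cP_pos n]))) hδ0 hδ2
    have h2 := doubling (hcont.pow 2) (fun y => sq_nonneg _) hr (M := M) (x := x) (fun y hy => by
      refine hM y (r / 2) (by positivity) ?_
      rw [mem_ball, dist_eq_norm] at hy
      have := (abs_le.mp (hℓ.lip y x)).1
      nlinarith)
    have hD : 0 < r ^ n / r ^ 2 := by positivity
    have hM0 : 0 ≤ M * (r ^ n / r ^ 2) :=
      le_trans (integral_nonneg fun y => sq_nonneg _) (hM x r hr hx)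
    calc _ ≤ C₃ * (δ * (A * M * (r ^ n / r ^ 2)) + δ⁻¹ ^ 5 * (r ^ n / r ^ 2)) :=
          h1.trans (by gcongr; exact h2)
      _ = C₃ * δ * A * (M * (r ^ n / r ^ 2)) + B * (r ^ n / r ^ 2) := by rw [hB]; ring
      _ ≤ 1 / 2 * (M * (r ^ n / r ^ 2)) + B * (r ^ n / r ^ 2) := by gcongr
      _ = _ := by ring
  set M₀ : ℝ := K ^ 2 * omega n * R ^ 2 with hM₀
  have h0 : P M₀ := by
    intro x r hr hx
    have hrx : 8 * r ≤ R := (hrR x r hx).resolve_right hr.not_ge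
    refine (dq_sq_setIntegral_le hu.bl ht hv hr).trans ?_
    have h1 : (1 : ℝ) ≤ R ^ 2 / r ^ 2 := by
      rw [one_le_div (by positivity)]
      exact pow_le_pow_left₀ hr.le (by linarith) 2
    calc K ^ 2 * (omega n * r ^ n) = K ^ 2 * (omega n * r ^ n) * 1 := by ring
      _ ≤ K ^ 2 * (omega n * r ^ n) * (R ^ 2 / r ^ 2) := by gcongr
      _ = _ := by rw [hM₀]; ring
  have hk : ∀ k : ℕ, P (2 * B + M₀ * (1 / 2) ^ k) := by
    intro k
    induction k with
    | zero =>
      intro x r hr hx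
      refine (h0 x r hr hx).trans (mul_le_mul_of_nonneg_right ?_ (by positivity))
      simp only [pow_zero, mul_one]
      linarith
    | succ k ih =>
      have := step _ ih
      convert this using 1
      ring
  intro x r hr hx
  have ht' : Tendsto (fun k : ℕ => (2 * B + M₀ * (1 / 2) ^ k) * (r ^ n / r ^ 2)) atTop
      (𝓝 ((2 * B + M₀ * 0) * (r ^ n / r ^ 2))) :=
    ((tendsto_pow_atTop_nhds_zero_of_lt_one (by norm_num) (by norm_num)).const_mul M₀
      |>.const_add _).mul_const _
  rw [mul_zero, add_zero] at ht'
  exact ge_of_tendsto' ht' fun k => hk k x r hr hx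

lemma dq_tendsto {u : Rn n → ℝ} (hu : ContDiff ℝ 1 u) (v x : Rn n) :
    Tendsto (fun t => dq u v t x) (𝓝[>] 0) (𝓝 (fderiv ℝ u x v)) :=
  (((hu.differentiable one_ne_zero).differentiableAt).hasFDerivAt.hasLineDerivAt
    v).tendsto_slope_zero_right

lemma dq_sq_integral_tendsto {u : Rn n → ℝ} {K : ℝ} (hu : ContDiff ℝ 1 u) (hb : BddLip u K)
    {v : Rn n} (hv : ‖v‖ = 1) (x : Rn n) (r : ℝ) :
    Tendsto (fun t => ∫ y in ball x r, dq u v t y ^ 2) (𝓝[>] 0)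
      (𝓝 (∫ y in ball x r, fderiv ℝ u y v ^ 2)) := by
  refine tendsto_integral_filter_of_dominated_convergence (fun _ => K ^ 2) ?_ ?_
    (integrableOn_const measure_ball_lt_top.ne) ?_
  · exact Eventually.of_forall fun t => ((dq_contDiff hu).continuous.pow 2).aestronglyMeasurable
  · filter_upwards [self_mem_nhdsWithin] with t ht
    refine ae_of_all _ fun y => ?_
    rw [Real.norm_eq_abs, abs_pow]
    exact pow_le_pow_left₀ (abs_nonneg _) (dq_abs_le hb ht hv y) 2
  · exact ae_of_all _ fun y => (dq_tendsto hu v y).pow 2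

lemma sq_le_of_small {u : Rn n → ℝ} {K : ℝ} (hu : ContDiff ℝ 1 u) (hb : BddLip u K)
    {v : Rn n} (hv : ‖v‖ = 1) (x : Rn n) (r : ℝ) {M t₀ : ℝ} (ht₀ : 0 < t₀)
    (h : ∀ t, 0 < t → t < t₀ → ∫ y in ball x r, dq u v t y ^ 2 ≤ M) :
    ∫ y in ball x r, fderiv ℝ u y v ^ 2 ≤ M := by
  refine le_of_tendsto (dq_sq_integral_tendsto hu hb hv x r) ?_
  filter_upwards [Ioo_mem_nhdsGT ht₀] with t ht using h t ht.1 ht.2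

lemma exists_small {τ K R c : ℝ} (hR : 0 < R) (hc : 0 < c) (hτ : 0 ≤ τ) (hK : 0 ≤ K) :
    ∃ t₀ > 0, ∀ t, 0 < t → t < t₀ → t ≤ R ∧ 3 * τ * K * t ≤ c := by
  refine ⟨min R (c / (3 * τ * K + 1)), lt_min hR (by positivity), fun t ht h => ?_⟩
  rw [lt_min_iff, lt_div_iff₀ (by positivity)] at h
  exact ⟨h.1.le, by nlinarith⟩

lemma energy_decay (hn : 1 ≤ n) {s₀ : ℝ} (hs₀ : s₀ ∈ Ioo (0 : ℝ) 1) :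
    ∃ C₄ : ℝ, 0 < C₄ ∧ ∀ s ∈ Ioo s₀ 1, ∀ (τ K R κ N : ℝ) (u ℓ : Rn n → ℝ) (p v : Rn n),
      Sol n s τ K u p R → 0 ≤ τ → Scale n s τ u p R κ ℓ → ‖v‖ = 1 → 2 ≤ N →
      κ * N ^ (-s) ≤ cP n / 16 → ∀ x r, 0 < r → 4 * N * r ≤ ℓ x →
        ∫ y in ball x r, fderiv ℝ u y v ^ 2 ≤ C₄ * (r ^ n / r ^ 2) := by
  obtain ⟨C₄, hC₄, H⟩ := absorption hn hs₀
  refine ⟨C₄, hC₄, ?_⟩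
  intro s hs τ K R κ N u ℓ p v hu hτ hℓ hv hN hκ x r hr hx
  have hR : 0 < R := by
    by_contra! h0
    have h1 := hℓ.le x
    nlinarith [norm_nonneg (x - p)]
  obtain ⟨t₀, ht₀, h⟩ := exists_small (τ := τ) (K := K) (R := R / 8)
    (c := cP n / 16 * R ^ (-s)) (by positivity)
    (mul_pos (by linarith [cP_pos n]) (rpow_pos_of_pos hR _)) hτ hu.bl.nonneg
  exact sq_le_of_small hu.cd hu.bl hv x r ht₀ fun t ht htt =>
    H s hs τ K R t κ N u ℓ p v hu hτ hℓ ht (h t ht htt).1 (h t ht htt).2 hv hN hκ x r hr hx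

lemma setIntegral_abs_le {f : Rn n → ℝ} (hf : Continuous f) (x : Rn n) {r : ℝ} (hr : 0 < r)
    {a : ℝ} (ha : 0 < a) :
    ∫ y in ball x r, |f y| ≤ a * (∫ y in ball x r, f y ^ 2) + a⁻¹ * (omega n * r ^ n) := by
  have hi : ∀ g : Rn n → ℝ, Continuous g → IntegrableOn g (ball x r) := fun g hg =>
    (hg.continuousOn.integrableOn_compact (isCompact_closedBall x r)).mono_set
      ball_subset_closedBall
  have h1 : ∀ y, |f y| ≤ a * f y ^ 2 + a⁻¹ := fun y => by
    have h2 := two_mul_le_add_sq (a * |f y|) 1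
    rw [mul_pow, sq_abs] at h2
    have h3 : a * |f y| ≤ a * (a * f y ^ 2 + a⁻¹) := by
      rw [mul_add, mul_inv_cancel₀ ha.ne']
      nlinarith [mul_nonneg ha.le (abs_nonneg (f y))]
    exact le_of_mul_le_mul_left h3 ha
  calc ∫ y in ball x r, |f y| ≤ ∫ y in ball x r, (a * f y ^ 2 + a⁻¹) :=
        integral_mono (hi _ hf.abs) (hi _ (by fun_prop)) h1
    _ = _ := by
        rw [integral_add (hi _ (by fun_prop)) (hi _ (by fun_prop)), integral_const_mul,
          setIntegral_const, volume_ball x hr, smul_eq_mul]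
        ring

lemma exists_scale (hn : 1 ≤ n) (hs : s ∈ Ioo (0 : ℝ) 1) {τ K R : ℝ} {u : Rn n → ℝ} {p : Rn n}
    {m : ℕ} (hu : BddLip u K) (hτ : 0 < τ) (hidx : IdxLE n s τ u (ball p R) m) :
    ∃ (rs : ℝ) (S : Finset (Rn n × ℝ)), 0 < rs ∧ rs ^ (-s) = 4 * τ / cP n ∧ S.card ≤ m ∧
      (∀ q ∈ S, rs ≤ q.2 ∧ q.1 ∈ ball p R) ∧
      Scale n s τ u p R ((m + 1) * omega n) (ell S p R) := by
  have hc := cP_pos n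
  have hω := omega_pos n
  have hrs : ((4 * τ / cP n) ^ (-s⁻¹)) ^ (-s) = 4 * τ / cP n := by
    rw [← rpow_mul (by positivity), neg_mul_neg, inv_mul_cancel₀ hs.1.ne', rpow_one]
  obtain ⟨S, hS, hq, hSt⟩ := exists_unstable_cover hn hs (m := m) hu hidx
    (rs := (4 * τ / cP n) ^ (-s⁻¹)) (by positivity) (fun x r hr hr' => by
      refine stable_of_small hn hs hτ.le (by positivity) hu hr ?_ x
      have h1 := rpow_le_rpow_of_nonpos hr hr'.le (neg_nonpos.mpr hs.1.le)
      rw [hrs, div_le_iff₀ hc] at h1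
      linarith)
  refine ⟨_, S, by positivity, hrs, hS, hq, ell_lip S p R, fun x => (le_ell.mp le_rfl).1, ?_⟩
  intro x r hr hrx
  have hl := lt_ell.mp hrx
  by_contra hst
  obtain ⟨q, hqS, h1, h2⟩ := hSt x r hr (fun y hy => by
    rw [mem_ball, dist_eq_norm] at hy ⊢
    have h3 := norm_sub_le_norm_sub_add_norm_sub y x p
    linarith [hl.1, norm_nonneg (x - p)]) hst
  have h3 := hl.2 q hqS
  have h4 : max ‖x - q.1‖ q.2 ≤ 6 * r := max_le (by linarith) (by linarith)
  linarith

lemma exists_ratio {κ c s₀ : ℝ} (hs₀ : 0 < s₀) (hκ : 0 ≤ κ) (hc : 0 < c) :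
    ∃ N : ℝ, 2 ≤ N ∧ ∀ s, s₀ < s → κ * N ^ (-s) ≤ c := by
  have h := (tendsto_rpow_neg_atTop hs₀).const_mul κ
  rw [mul_zero] at h
  obtain ⟨N, hN, hN2⟩ := ((h.eventually (gt_mem_nhds hc)).and (eventually_ge_atTop 2)).exists
  refine ⟨N, hN2, fun s hs => le_trans ?_ hN.le⟩
  exact mul_le_mul_of_nonneg_left
    (rpow_le_rpow_of_exponent_le (by linarith) (by linarith)) hκ

lemma averaged_bound {f : Rn n → ℝ} (hf : Continuous f) (hf0 : ∀ x, 0 ≤ f x)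
    {S : Finset (Rn n × ℝ)} {p : Rn n} {R rs a c₁ c₂ β D : ℝ} {m : ℕ} (hR : 0 < R) (hrs : 0 < rs)
    (hSm : S.card ≤ m) (hS : ∀ q ∈ S, rs ≤ q.2) (ha : 4 ≤ a) (hc₁ : 0 ≤ c₁) (hc₂ : 0 ≤ c₂)
    (hβ : 0 < β) (hD0 : 0 ≤ D)
    (h₁ : ∀ x, 0 < ell S p R x → ∫ y in ball x (ell S p R x / a), f y ≤
      (ell S p R x / a) ^ n * (c₁ * (ell S p R x)⁻¹))
    (h₂ : ∀ x, 0 < ell S p R x → ∫ y in ball x (ell S p R x / a), f y ≤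
      (ell S p R x / a) ^ n * (c₂ * (ell S p R x) ^ (-β)))
    (hD : ∀ q ∈ S, ∫ x in ball p (3 * R / 4), max ‖x - q.1‖ q.2 ^ (-β) ≤ D) :
    omega n * (4 / 9) ^ n * ∫ x in ball p (R / 2), f x ≤
      8 * c₁ * omega n * (R ^ n / R) + m * (c₂ * 6 ^ β * D) := by
  have ha0 : 0 < a := by linarith
  have hω := omega_pos n
  set ℓ := ell S p R with hℓ
  have hle : ∀ x, ℓ x ≤ 7 * R / 8 - ‖x - p‖ := fun x => (le_ell.mp le_rfl).1
  have hℓc : Continuous ℓ := by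
    have : LipschitzWith 1 ℓ := LipschitzWith.of_dist_le_mul fun x y => by
      rw [Real.dist_eq, dist_eq_norm]
      simpa using ell_lip S p R x y
    exact this.continuous
  have hmx : ∀ q ∈ S, ∀ x : Rn n, rs ≤ max ‖x - q.1‖ q.2 := fun q hq x =>
    (hS q hq).trans (le_max_right _ _)
  have hlow : ∀ x ∈ ball p (3 * R / 4), min (R / 8) (rs / 6) ≤ ℓ x := fun x hx => by
    rw [mem_ball, dist_eq_norm] at hx
    refine le_ell.mpr ⟨(min_le_left _ _).trans (by linarith), fun q hq =>
      (min_le_right _ _).trans ?_⟩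
    have := hmx q hq x
    gcongr
  have hlow0 : 0 < min (R / 8) (rs / 6) := by positivity
  have hpos : ∀ x ∈ ball p (3 * R / 4), 0 < ℓ x := fun x hx => hlow0.trans_le (hlow x hx)
  let F : ℝ → ℝ := fun r => min (c₁ * r⁻¹) (c₂ * r ^ (-β))
  have hF0 : ∀ r, 0 < r → 0 ≤ F r := fun r hr => le_min (by positivity) (by positivity)
  have hFm : Measurable F := by
    refine Measurable.min (measurable_inv.const_mul _) ?_
    exact (measurable_id.pow_const _).const_mul _
  have hfin : volume (ball p (3 * R / 4)) < ⊤ := measure_ball_lt_top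
  have hFi : IntegrableOn (fun x => F (ℓ x)) (ball p (3 * R / 4)) := by
    refine Measure.integrableOn_of_bounded (M := c₁ * (min (R / 8) (rs / 6))⁻¹) hfin.ne
      (hFm.comp hℓc.measurable).aestronglyMeasurable ?_
    refine (ae_restrict_mem measurableSet_ball).mono fun x hx => ?_
    rw [Real.norm_eq_abs, abs_of_nonneg (hF0 _ (hpos x hx))]
    exact (min_le_left _ _).trans (mul_le_mul_of_nonneg_left (inv_anti₀ hlow0 (hlow x hx)) hc₁)
  have hav := averaging hf hf0 (ρ := fun x => ℓ x / a) (h := fun x => F (ℓ x))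
    (E := ball p (R / 2)) (E' := ball p (3 * R / 4))
    (fun x y => by
      rw [← sub_div, abs_div, abs_of_pos ha0, div_le_iff₀ ha0]
      have := ell_lip S p R x y
      nlinarith [norm_nonneg (x - y)])
    measurableSet_ball measurableSet_ball isBounded_ball
    (fun x hx => div_pos (hpos x hx) ha0)
    (fun y hy => by
      have hy' : y ∈ ball p (3 * R / 4) := ball_subset_ball (by linarith) hy
      refine ⟨div_pos (hpos y hy') ha0, fun z hz => ?_⟩
      rw [mem_ball] at hy hz ⊢
      have h1 : ℓ y / a ≤ ℓ y / 4 := div_le_div_of_nonneg_left (hpos y hy').le (by norm_num) ha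
      have h2 := hle y
      have h3 := norm_nonneg (y - p)
      linarith [dist_triangle z y p])
    (fun x hx => by
      have h0 : (0 : ℝ) < (ℓ x / a) ^ n := pow_pos (div_pos (hpos x hx) ha0) n
      have e1 := h₁ x (hpos x hx)
      have e2 := h₂ x (hpos x hx)
      rw [← div_le_iff₀' h0] at e1 e2 ⊢
      exact le_min e1 e2) hFi
  have hGi : ∀ q ∈ S, IntegrableOn (fun x => c₂ * 6 ^ β * max ‖x - q.1‖ q.2 ^ (-β))
      (ball p (3 * R / 4)) := fun q hq => by
    refine Measure.integrableOn_of_bounded (M := c₂ * 6 ^ β * rs ^ (-β)) hfin.ne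
      ?_ (ae_of_all _ fun x => ?_)
    · refine Measurable.aestronglyMeasurable ?_
      refine Measurable.const_mul (Measurable.pow_const ?_ _) _
      fun_prop
    · have h1 := rpow_le_rpow_of_nonpos hrs (hmx q hq x) (neg_nonpos.mpr hβ.le)
      have h2 : 0 < max ‖x - q.1‖ q.2 := hrs.trans_le (hmx q hq x)
      rw [Real.norm_eq_abs, abs_of_nonneg (by positivity)]
      gcongr
  have hci : IntegrableOn (fun _ : Rn n => c₁ * (8 / R)) (ball p (3 * R / 4)) :=
    integrableOn_const hfin.ne
  refine hav.trans ?_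
  calc ∫ x in ball p (3 * R / 4), F (ℓ x)
      ≤ ∫ x in ball p (3 * R / 4), (c₁ * (8 / R) +
          ∑ q ∈ S, c₂ * 6 ^ β * max ‖x - q.1‖ q.2 ^ (-β)) := by
        refine setIntegral_mono_on hFi (hci.add (integrable_finsetSum _ hGi)) measurableSet_ball ?_
        intro x hx
        have hx' := hx
        rw [mem_ball, dist_eq_norm] at hx
        have h3 : ∀ q ∈ S, 0 < max ‖x - q.1‖ q.2 := fun q hq => hrs.trans_le (hmx q hq x)
        refine (ell_sum_le S p R x (F := F) (hF0 _ (by linarith)) fun q hq =>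
          hF0 _ (div_pos (h3 q hq) (by norm_num))).trans (add_le_add ?_ (Finset.sum_le_sum fun q hq => ?_))
        · refine (min_le_left _ _).trans (mul_le_mul_of_nonneg_left ?_ hc₁)
          rw [← inv_div R 8]
          exact inv_anti₀ (by positivity) (by linarith)
        · refine (min_le_right _ _).trans (le_of_eq ?_)
          rw [div_rpow (h3 q hq).le (by norm_num), rpow_neg (by norm_num : (0 : ℝ) ≤ 6)]
          field_simp
    _ = c₁ * (8 / R) * (omega n * (3 * R / 4) ^ n) +
          ∑ q ∈ S, c₂ * 6 ^ β * ∫ x in ball p (3 * R / 4), max ‖x - q.1‖ q.2 ^ (-β) := by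
        rw [integral_add hci (integrable_finsetSum _ hGi), integral_finsetSum _ hGi,
          setIntegral_const, volume_ball p (by positivity), smul_eq_mul]
        simp_rw [integral_const_mul]
        ring
    _ ≤ c₁ * (8 / R) * (omega n * R ^ n) + ∑ q ∈ S, c₂ * 6 ^ β * D := by
        gcongr with q hq
        · linarith
        · exact hD q hq
    _ ≤ _ := by
        rw [Finset.sum_const, nsmul_eq_mul]
        have : (S.card : ℝ) ≤ m := by exact_mod_cast hSm
        have h2 : (S.card : ℝ) * (c₂ * 6 ^ β * D) ≤ m * (c₂ * 6 ^ β * D) := by gcongr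
        refine add_le_add (le_of_eq ?_) h2
        ring

lemma inv_integral_le (hn : 2 ≤ n) {p x : Rn n} {R rs : ℝ} (hR : 0 < R) (hx : x ∈ ball p R) :
    ∫ y in ball p (3 * R / 4), max ‖y - x‖ rs ^ (-1 : ℝ) ≤
      n * omega n * ((2 * R) ^ ((n : ℝ) - 1) / ((n : ℝ) - 1)) := by
  have hn1 : (0 : ℝ) < (n : ℝ) - 1 := by
    have : (2 : ℝ) ≤ n := by exact_mod_cast hn
    linarith
  have h := radial_lt (n := n) (by omega) hn1 (mul_pos two_pos hR)
  rw [← h.2, ← integral_sub_right_eq_self (μ := (volume : Measure (Rn n))) _ x,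
    ← integral_indicator measurableSet_ball]
  refine integral_mono_of_nonneg (ae_of_all _ fun y => indicator_nonneg (fun z _ => ?_) y)
    (h.1.comp_sub_right x) ?_
  · exact rpow_nonneg (le_max_of_le_left (norm_nonneg _)) _
  have hne : ∀ᵐ y : Rn n, y ≠ x := by
    have : Nonempty (Fin n) := ⟨⟨0, by omega⟩⟩
    rw [ae_iff]
    simp
  filter_upwards [hne] with y hy
  by_cases hyE : y ∈ ball p (3 * R / 4)
  · rw [indicator_of_mem hyE]
    rw [mem_ball, dist_eq_norm] at hyE hx
    rw [norm_sub_rev] at hx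
    have h1 := norm_sub_le_norm_sub_add_norm_sub y p x
    rw [if_pos (by linarith), sub_sub_cancel_left]
    exact rpow_le_rpow_of_nonpos (norm_pos_iff.mpr (sub_ne_zero.mpr hy)) (le_max_left _ _)
      (by norm_num)
  · rw [indicator_of_notMem hyE]
    split_ifs
    · positivity
    · exact le_rfl

lemma abs_decay (hn : 1 ≤ n) {s₀ : ℝ} (hs₀ : s₀ ∈ Ioo (0 : ℝ) 1) :
    ∃ C₅ : ℝ, 0 < C₅ ∧ ∀ s ∈ Ioo s₀ 1, ∀ (τ K R κ N : ℝ) (u ℓ : Rn n → ℝ) (p v : Rn n),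
      Sol n s τ K u p R → 0 ≤ τ → Scale n s τ u p R κ ℓ → ‖v‖ = 1 → 2 ≤ N →
      κ * N ^ (-s) ≤ cP n / 16 → ∀ x r, 0 < r → 4 * N * r ≤ ℓ x →
        ∫ y in ball x r, |fderiv ℝ u y v| ≤ C₅ * (r ^ n / r) := by
  obtain ⟨C₄, hC₄, H⟩ := energy_decay hn hs₀
  have hω := omega_pos n
  refine ⟨C₄ + omega n, by positivity, ?_⟩
  intro s hs τ K R κ N u ℓ p v hu hτ hℓ hv hN hκ x r hr hx
  have hc : Continuous fun y => fderiv ℝ u y v :=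
    (hu.cd.continuous_fderiv one_ne_zero).clm_apply continuous_const
  refine (setIntegral_abs_le hc x hr hr).trans ?_
  calc _ ≤ r * (C₄ * (r ^ n / r ^ 2)) + r⁻¹ * (omega n * r ^ n) := by
        gcongr
        exact H s hs τ K R κ N u ℓ p v hu hτ hℓ hv hN hκ x r hr hx
    _ = _ := by field_simp

lemma directional_bound_high (hn : 2 ≤ n) {s₀ : ℝ} (hs₀ : s₀ ∈ Ioo (0 : ℝ) 1) (m : ℕ) :
    ∃ C : ℝ, 0 < C ∧ ∀ s ∈ Ioo s₀ 1, ∀ (τ K R : ℝ) (u : Rn n → ℝ) (p v : Rn n),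
      Sol n s τ K u p R → 0 < τ → 0 < R → IdxLE n s τ u (ball p R) m → ‖v‖ = 1 →
      ∫ x in ball p (R / 2), |fderiv ℝ u x v| ≤ C / (1 - s) * R ^ (n - 1) := by
  have hn' : 1 ≤ n := by omega
  obtain ⟨C₅, hC₅, H⟩ := abs_decay hn' hs₀
  have hω := omega_pos n
  obtain ⟨N, hN, hNs⟩ := exists_ratio hs₀.1 (κ := (m + 1) * omega n) (c := cP n / 16)
    (by positivity) (by linarith [cP_pos n])
  have hn1 : (0 : ℝ) < (n : ℝ) - 1 := by
    have : (2 : ℝ) ≤ n := by exact_mod_cast hn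
    linarith
  have hω2 : 0 < omega n * (4 / 9) ^ n := by positivity
  set c : ℝ := C₅ * (4 * N) with hc
  have hc0 : 0 < c := by positivity
  set C : ℝ := (omega n * (4 / 9) ^ n)⁻¹ * (8 * c * omega n +
    m * (c * 6 ^ (1 : ℝ) * (n * omega n * (2 ^ ((n : ℝ) - 1) / ((n : ℝ) - 1))))) with hC
  have hC0 : 0 < C := by positivity
  refine ⟨C, hC0, ?_⟩
  intro s hs τ K R u p v hu hτ hR hidx hv
  have hs' : s ∈ Ioo (0 : ℝ) 1 := ⟨hs₀.1.trans hs.1, hs.2⟩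
  obtain ⟨rs, S, hrs, -, hSm, hS, hsc⟩ := exists_scale hn' hs' hu.bl hτ hidx
  have hcont : Continuous fun y => |fderiv ℝ u y v| :=
    ((hu.cd.continuous_fderiv one_ne_zero).clm_apply continuous_const).abs
  have h1 : ∀ x, 0 < ell S p R x → ∫ y in ball x (ell S p R x / (4 * N)), |fderiv ℝ u y v| ≤
      (ell S p R x / (4 * N)) ^ n * (c * (ell S p R x)⁻¹) := fun x hx => by
    refine (H s hs τ K R _ N u _ p v hu hτ.le hsc hv hN (hNs s hs.1) x _ (by positivity)
      (by rw [mul_div_cancel₀ _ (by positivity)])).trans (le_of_eq ?_)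
    rw [hc]
    field_simp
  have h := averaged_bound hcont (fun _ => abs_nonneg _) (β := 1)
    (D := n * omega n * ((2 * R) ^ ((n : ℝ) - 1) / ((n : ℝ) - 1))) hR hrs hSm
    (fun q hq => (hS q hq).1) (a := 4 * N) (by linarith) hc0.le hc0.le one_pos (by positivity) h1
    (fun x hx => by rw [rpow_neg_one]; exact h1 x hx)
    (fun q hq => inv_integral_le hn hR (hS q hq).2)
  have e1 : R ^ n / R = R ^ (n - 1) := by
    rw [div_eq_iff hR.ne', ← pow_succ, Nat.sub_add_cancel hn']
  have e2 : (2 * R) ^ ((n : ℝ) - 1) = 2 ^ ((n : ℝ) - 1) * R ^ (n - 1) := by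
    rw [mul_rpow (by norm_num) hR.le, ← rpow_natCast R (n - 1), Nat.cast_sub hn', Nat.cast_one]
  rw [e1, e2, ← le_div_iff₀' hω2] at h
  refine h.trans ?_
  have h3 : C ≤ C / (1 - s) := by
    rw [le_div_iff₀ (by linarith [hs.2])]
    nlinarith [hs'.1]
  calc _ = C * R ^ (n - 1) := by rw [hC, div_eq_inv_mul]; ring
    _ ≤ _ := by gcongr

lemma bump_form_le (hn : 1 ≤ n) {s₀ : ℝ} (hs₀ : s₀ ∈ Ioo (0 : ℝ) 1) (hs : s ∈ Ioo s₀ 1)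
    {C r : ℝ} {x : Rn n} {φ w : Rn n → ℝ} (hC : 1 ≤ C) (hr : 0 < r) (hφ : IsBump C x r φ)
    (hw : ∀ y z, |w y - w z| ≤ 2) :
    |∫ q : Rn n × Rn n, (w q.1 - w q.2) * (φ q.1 - φ q.2) * J n s (q.1 - q.2)| ≤
      4 * C * omega n ^ 2 * n * 2 ^ n / s₀ * (1 - s)⁻¹ * (r ^ n * r ^ (-s)) := by
  have hs' : s ∈ Ioo (0 : ℝ) 1 := ⟨hs₀.1.trans hs.1, hs.2⟩
  have hω := omega_pos n
  have h1s : 0 < 1 - s := by linarith [hs.2]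
  have hm := mlin_integral hn hs' hr
  have h := integral_le_dom (F := fun q : Rn n × Rn n =>
    (w q.1 - w q.2) * (φ q.1 - φ q.2) * J n s (q.1 - q.2)) (c := 2 * C) (z := x)
    (mul_pos two_pos hr) hm.1 (fun z => mlin_neg _ z) (fun q => by
      have hmn : 0 ≤ mlin n s r (q.1 - q.2) := mlin_nonneg hr _
      by_cases hq : q.1 ∈ ball x (2 * r) ∨ q.2 ∈ ball x (2 * r)
      · have h1 : 1 ≤ ib x (2 * r) q.1 + ib x (2 * r) q.2 := by
          rcases hq with hq | hq
          · rw [ib_of_mem hq]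
            linarith [ib_nonneg x (2 * r) q.2]
          · rw [ib_of_mem hq]
            linarith [ib_nonneg x (2 * r) q.1]
        have h2 : |φ q.1 - φ q.2| ≤ C * min (‖q.1 - q.2‖ / r) 1 := by
          rcases le_total (‖q.1 - q.2‖ / r) 1 with h | h
          · rw [min_eq_left h]
            exact (hφ.lip _ _).trans (le_of_eq (by ring))
          · rw [min_eq_right h, abs_le]
            constructor <;> linarith [hφ.nonneg q.1, hφ.nonneg q.2, hφ.le_one q.1, hφ.le_one q.2]
        rw [abs_mul, abs_mul, abs_of_nonneg (J_nonneg _)]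
        calc _ ≤ 2 * (C * min (‖q.1 - q.2‖ / r) 1) * J n s (q.1 - q.2) := by
              refine mul_le_mul_of_nonneg_right ?_ (J_nonneg _)
              exact mul_le_mul (hw _ _) h2 (abs_nonneg _) zero_le_two
          _ = 2 * C * (1 * mlin n s r (q.1 - q.2)) := by rw [mlin]; ring
          _ ≤ _ := by gcongr
      · push Not at hq
        rw [hφ.zero_two hr hq.1, hφ.zero_two hr hq.2, sub_self, mul_zero, zero_mul, abs_zero]
        have := ib_nonneg x (2 * r) q.1
        have := ib_nonneg x (2 * r) q.2
        positivity)
  rw [hm.2] at h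
  have e : 1 / (1 - s) + 1 / s ≤ (1 - s)⁻¹ * s₀⁻¹ := by
    have e1 : 1 / (1 - s) + 1 / s = (1 - s)⁻¹ * s⁻¹ := by
      have := hs'.1.ne'
      field_simp
      ring
    rw [e1]
    have := inv_anti₀ hs₀.1 hs.1.le
    gcongr
  have hr' : 0 < r ^ (-s) := rpow_pos_of_pos hr _
  calc _ ≤ 2 * C * (2 * (omega n * (2 * r) ^ n) *
          (n * omega n * ((1 - s)⁻¹ * s₀⁻¹) * r ^ (-s))) := h.trans (by gcongr)
    _ = _ := by rw [mul_pow]; ring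

lemma bump_sq_le {C r : ℝ} {x : Rn n} {φ : Rn n → ℝ} (hr : 0 < r) (hφ : IsBump C x r φ) :
    omega n * r ^ n ≤ ∫ y, φ y ^ 2 ∧ ∫ y, φ y ^ 2 ≤ omega n * (2 * r) ^ n ∧
      omega n * r ^ n ≤ ∫ y, φ y := by
  have i1 := sq_integrable' hφ.cd.continuous hφ.hasCompactSupport
  have i2 := hφ.cd.continuous.integrable_of_hasCompactSupport (μ := volume) hφ.hasCompactSupport
  have key : ∀ g : Rn n → ℝ, (∀ y, 0 ≤ g y) → (∀ y ∈ ball x r, g y = 1) → Integrable g →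
      omega n * r ^ n ≤ ∫ y, g y := fun g h0 h1 hi => by
    calc omega n * r ^ n = ∫ y in ball x r, g y := by
          rw [setIntegral_congr_fun measurableSet_ball h1, setIntegral_const, volume_ball x hr]
          simp
      _ ≤ _ := setIntegral_le_integral hi (ae_of_all _ h0)
  refine ⟨key _ (fun y => sq_nonneg _) (fun y hy => by simp [hφ.one y hy]) i1, ?_,
    key _ hφ.nonneg hφ.one i2⟩
  rw [← ib_integral x (mul_pos two_pos hr)]
  refine integral_mono i1 (ib_integrable _ _) fun y => ?_
  by_cases hy : y ∈ ball x (2 * r)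
  · simp only [ib_of_mem hy]
    nlinarith [hφ.nonneg y, hφ.le_one y]
  · simp only [hφ.zero_two hr hy, ib_of_notMem hy]
    norm_num

lemma gain_stable (hn : 1 ≤ n) {s₀ : ℝ} (hs₀ : s₀ ∈ Ioo (0 : ℝ) 1) (hs : s ∈ Ioo s₀ 1)
    {C r τ K κ : ℝ} {x : Rn n} {φ u : Rn n → ℝ} (hC : 1 ≤ C) (hr : 0 < r) (hφ : IsBump C x r φ)
    (hu : BddLip u K) (hτ : 0 ≤ τ) (hκ : 0 ≤ κ) (hst : Stable n s τ u κ x (2 * r))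
    (hosc : ∀ y ∈ ball x (2 * r), |u y - u x| ≤ 1 / 100) (hux : u x ^ 2 ≤ 3 / 10) :
    (1 - s) * (τ * r ^ s) ≤
      100 * (C * omega n * n * 2 ^ n / s₀ + κ * 2 ^ n) := by
  have hs' : s ∈ Ioo (0 : ℝ) 1 := ⟨hs₀.1.trans hs.1, hs.2⟩
  have hω := omega_pos n
  have h1s : 0 < 1 - s := by linarith [hs.2]
  have h0 := hst φ ⟨hφ.cd, hφ.hasCompactSupport,
    hφ.supp.trans (closedBall_subset_ball (by linarith))⟩
  obtain ⟨b1, b2, -⟩ := bump_sq_le hr hφ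
  have h1 := (le_abs_self _).trans (bump_form_le hn hs₀ hs hC hr hφ (w := φ) fun y z => by
    rw [abs_le]
    constructor <;> linarith [hφ.nonneg y, hφ.nonneg z, hφ.le_one y, hφ.le_one z])
  have hB : Bf n s φ = ∫ q : Rn n × Rn n, (φ q.1 - φ q.2) * (φ q.1 - φ q.2) * J n s (q.1 - q.2) := by
    rw [Bf]
    simp_rw [pow_two]
  rw [← hB] at h1
  have huc := hu.continuous
  have i0 := sq_integrable' hφ.cd.continuous hφ.hasCompactSupport
  have i1 := sq_integrable hφ.cd.continuous hφ.hasCompactSupport (f := fun x => 3 * u x ^ 2 - 1)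
    (by fun_prop)
  have h2 : ∫ y, (3 * u y ^ 2 - 1) * φ y ^ 2 ≤ ∫ y, -(3 / 100) * φ y ^ 2 := by
    refine integral_mono i1 (i0.const_mul _) fun y => ?_
    by_cases hy : y ∈ ball x (2 * r)
    · refine mul_le_mul_of_nonneg_right ?_ (sq_nonneg _)
      have h3 := abs_le.mp (hosc y hy)
      have h4 : |u x| ≤ 3 / 5 := abs_le_of_sq_le_sq (by norm_num; linarith) (by norm_num)
      have h5 := abs_le.mp h4
      nlinarith
    · simp [hφ.zero_two hr hy]
  rw [integral_const_mul] at h2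
  rw [qf] at h0
  have hr' : 0 < r ^ (-s) := rpow_pos_of_pos hr _
  have hrs : r ^ (-s) * r ^ s = 1 := by rw [← rpow_add hr]; simp
  have h3 : (2 * r) ^ (-s) ≤ r ^ (-s) :=
    rpow_le_rpow_of_nonpos hr (by linarith) (by linarith [hs'.1])
  have h4 : κ * (2 * r) ^ (-s) * ∫ y, φ y ^ 2 ≤ κ * r ^ (-s) * (omega n * (2 * r) ^ n) := by
    gcongr
  have h5 : τ * (3 / 100) * (omega n * r ^ n) ≤ τ * (3 / 100) * ∫ y, φ y ^ 2 := by gcongr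
  have h6 : τ * ∫ y, (3 * u y ^ 2 - 1) * φ y ^ 2 ≤ τ * (-(3 / 100) * ∫ y, φ y ^ 2) := by gcongr
  have h7 : τ * (3 / 100) * (omega n * r ^ n) ≤
      1 / 4 * (4 * C * omega n ^ 2 * n * 2 ^ n / s₀ * (1 - s)⁻¹ * (r ^ n * r ^ (-s))) +
        κ * r ^ (-s) * (omega n * (2 * r) ^ n) := by linarith
  have h8 := mul_le_mul_of_nonneg_left h7
    (show 0 ≤ (1 - s) * r ^ s * (omega n * r ^ n)⁻¹ by positivity)
  have hrn : 0 < r ^ n := by positivity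
  have e1 : (1 - s) * r ^ s * (omega n * r ^ n)⁻¹ * (τ * (3 / 100) * (omega n * r ^ n)) =
      3 / 100 * ((1 - s) * (τ * r ^ s)) := by
    field_simp
  have e2 : (1 - s) * r ^ s * (omega n * r ^ n)⁻¹ *
      (1 / 4 * (4 * C * omega n ^ 2 * n * 2 ^ n / s₀ * (1 - s)⁻¹ * (r ^ n * r ^ (-s))) +
        κ * r ^ (-s) * (omega n * (2 * r) ^ n)) =
      (r ^ (-s) * r ^ s) * (C * omega n * n * 2 ^ n / s₀ + (1 - s) * (κ * 2 ^ n)) := by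
    have := hs₀.1.ne'
    rw [mul_pow]
    field_simp
  rw [e1, e2, hrs, one_mul] at h8
  have h9 : (1 - s) * (κ * 2 ^ n) ≤ κ * 2 ^ n :=
    mul_le_of_le_one_left (by positivity) (by linarith [hs'.1])
  have h10 : 0 ≤ C * omega n * n * 2 ^ n / s₀ := by
    have := hs₀.1
    positivity
  have h11 : 0 ≤ κ * 2 ^ n := by positivity
  linarith

lemma gain_transition (hn : 1 ≤ n) {s₀ : ℝ} (hs₀ : s₀ ∈ Ioo (0 : ℝ) 1) (hs : s ∈ Ioo s₀ 1)
    {C r τ K R : ℝ} {x p : Rn n} {φ u : Rn n → ℝ} (hC : 1 ≤ C) (hr : 0 < r)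
    (hφ : IsBump C x r φ) (hu : Sol n s τ K u p R) (hτ : 0 ≤ τ) (hb : ball x (2 * r) ⊆ ball p R)
    (hosc : ∀ y ∈ ball x (2 * r), |u y - u x| ≤ 1 / 100) (hux : 3 / 10 ≤ u x ^ 2)
    (hux' : u x ^ 2 ≤ 7 / 10) :
    (1 - s) * (τ * r ^ s) ≤ 100 * (C * omega n * n * 2 ^ n / s₀) := by
  have hs' : s ∈ Ioo (0 : ℝ) 1 := ⟨hs₀.1.trans hs.1, hs.2⟩
  have hω := omega_pos n
  have h1s : 0 < 1 - s := by linarith [hs.2]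
  obtain ⟨-, -, b3⟩ := bump_sq_le hr hφ
  have h1 := bump_form_le hn hs₀ hs hC hr hφ (w := u) fun y z => by
    have h1 := abs_le.mp (hu.le1 y)
    have h2 := abs_le.mp (hu.le1 z)
    rw [abs_le]
    constructor <;> linarith
  rw [(weak_form hn hs' hu.bl hφ.cd.continuous.measurable (M := 1)
    (fun y => by rw [abs_of_nonneg (hφ.nonneg y)]; exact hφ.le_one y)
    (fun y hy => hφ.zero_two hr hy)).2] at h1
  have h2 : ∫ y, φ y * Lop n s u y = τ * ∫ y, φ y * (u y - u y ^ 3) := by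
    rw [← integral_const_mul]
    congr 1
    funext y
    by_cases hy : y ∈ ball x (2 * r)
    · rw [eq_neg_of_add_eq_zero_left (hu.eq y (hb hy))]
      ring
    · rw [hφ.zero_two hr hy]
      ring
  have huc := hu.bl.continuous
  have i0 := hφ.cd.continuous.integrable_of_hasCompactSupport (μ := volume) hφ.hasCompactSupport
  have i1 : Integrable fun y => φ y * (u y - u y ^ 3) :=
    (hφ.cd.continuous.mul (by fun_prop)).integrable_of_hasCompactSupport
      hφ.hasCompactSupport.mul_right
  have hx5 := abs_le.mp (hu.le1 x)
  have h3 : ∫ y, 7 / 100 * φ y ≤ ∫ y, u x * (φ y * (u y - u y ^ 3)) := by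
    refine integral_mono (i0.const_mul _) (i1.const_mul _) fun y => ?_
    by_cases hy : y ∈ ball x (2 * r)
    · have h4 := abs_le.mp (hosc y hy)
      have h6 : 29 / 100 ≤ u x * u y := by nlinarith
      have h7 : u y ^ 2 ≤ 73 / 100 := by nlinarith
      have h8 : 7 / 100 ≤ u x * (u y - u y ^ 3) := by
        calc (7 / 100 : ℝ) ≤ 29 / 100 * (27 / 100) := by norm_num
          _ ≤ u x * u y * (1 - u y ^ 2) :=
              mul_le_mul h6 (by linarith) (by norm_num) (by linarith)
          _ = _ := by ring
      nlinarith [hφ.nonneg y]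
    · simp [hφ.zero_two hr hy]
  rw [integral_const_mul, integral_const_mul] at h3
  have h4 : τ * (7 / 100 * (omega n * r ^ n)) ≤ |∫ y, φ y * Lop n s u y| := by
    rw [h2, abs_mul, abs_of_nonneg hτ]
    refine mul_le_mul_of_nonneg_left ?_ hτ
    calc _ ≤ 7 / 100 * ∫ y, φ y := by gcongr
      _ ≤ |u x * ∫ y, φ y * (u y - u y ^ 3)| := h3.trans (le_abs_self _)
      _ ≤ _ := by
          rw [abs_mul]
          exact mul_le_of_le_one_left (abs_nonneg _) (hu.le1 x)
  rw [abs_mul, abs_of_pos (two_pos : (0 : ℝ) < 2)] at h1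
  have h7 : τ * (7 / 100 * (omega n * r ^ n)) ≤
      1 / 2 * (4 * C * omega n ^ 2 * n * 2 ^ n / s₀ * (1 - s)⁻¹ * (r ^ n * r ^ (-s))) := by
    linarith
  have hrs : r ^ (-s) * r ^ s = 1 := by rw [← rpow_add hr]; simp
  have h8 := mul_le_mul_of_nonneg_left h7
    (show 0 ≤ (1 - s) * r ^ s * (omega n * r ^ n)⁻¹ by positivity)
  have hrn : 0 < r ^ n := by positivity
  have e1 : (1 - s) * r ^ s * (omega n * r ^ n)⁻¹ * (τ * (7 / 100 * (omega n * r ^ n))) =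
      7 / 100 * ((1 - s) * (τ * r ^ s)) := by
    field_simp
  have e2 : (1 - s) * r ^ s * (omega n * r ^ n)⁻¹ *
      (1 / 2 * (4 * C * omega n ^ 2 * n * 2 ^ n / s₀ * (1 - s)⁻¹ * (r ^ n * r ^ (-s)))) =
      (r ^ (-s) * r ^ s) * (2 * (C * omega n * n * 2 ^ n / s₀)) := by
    have := hs₀.1.ne'
    field_simp
    try ring
  rw [e1, e2, hrs, one_mul] at h8
  have h10 : 0 ≤ C * omega n * n * 2 ^ n / s₀ := by
    have := hs₀.1
    positivity
  linarith

lemma gain_phase (hn : 1 ≤ n) {s₀ C : ℝ} (hs₀ : s₀ ∈ Ioo (0 : ℝ) 1) (hC : 0 ≤ C) :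
    ∃ C₆ : ℝ, 0 < C₆ ∧ ∀ s ∈ Ioo s₀ 1, ∀ (τ K R t r A : ℝ) (u φ : Rn n → ℝ) (p v x : Rn n),
      Sol n s τ K u p R → 0 ≤ τ → 0 < t → ‖v‖ = 1 → 0 < r → IsBump C x r φ →
      ball x (2 * r + t) ⊆ ball p R → K * t ≤ 1 / 100 →
      (∀ y ∈ ball x (2 * r), |u y - u x| ≤ 1 / 100) → 7 / 10 ≤ u x ^ 2 →
      ∫ y in ball x (2 * r), dq u v t y ^ 2 ≤ A * (r ^ n / r ^ 2) →
      τ * r ^ s * ∫ y in ball x r, dq u v t y ^ 2 ≤ C₆ * (A + 1) * (r ^ n / r ^ 2) := by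
  obtain ⟨C₁, hC₁, H⟩ := Df_estimate hn hs₀ hC
  have hω := omega_pos n
  refine ⟨C₁ * (5 + 4 * (omega n * 2 ^ n)), by positivity, ?_⟩
  intro s hs τ K R t r A u φ p v x hu hτ ht hv hr hφ hb hKt hosc hux hA
  have hs' : s ∈ Ioo (0 : ℝ) 1 := ⟨hs₀.1.trans hs.1, hs.2⟩
  have hbl := dq_bddLip hu.bl ht hv
  have hE := dq_energy hn hs' hu ht hv hr hφ hb
  have hD := H s hs (1 / 2) r t K v x u φ (by norm_num) le_rfl hr ht hv hu.bl hu.le1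
    ⟨_, hbl⟩ hφ
  have hcc := bump_cc1 (t := t) (v := v) hu.cd hr hφ
  have huc := hu.bl.continuous
  have i0 := sq_integrable' hcc.1.continuous hcc.2.1
  have i1 := sq_integrable hcc.1.continuous hcc.2.1 (f := dqc u v t) (by unfold dqc; fun_prop)
  have h1 : ∫ y, 1 / 2 * (φ y * dq u v t y) ^ 2 ≤ ∫ y, dqc u v t y * (φ y * dq u v t y) ^ 2 := by
    refine integral_mono (i0.const_mul _) i1 fun y => ?_
    by_cases hy : y ∈ ball x (2 * r)
    · refine mul_le_mul_of_nonneg_right ?_ (sq_nonneg _)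
      have h3 := abs_le.mp (hosc y hy)
      have h4 := hu.bl.lip (y + t • v) y
      rw [add_sub_cancel_left, norm_smul, hv, mul_one, Real.norm_eq_abs, abs_of_pos ht] at h4
      have h5 := abs_le.mp (h4.trans hKt)
      have h6 := abs_le.mp (hu.le1 y)
      have h7 := abs_le.mp (hu.le1 x)
      have h8 : 68 / 100 ≤ u y ^ 2 := by nlinarith
      have h9 : 66 / 100 ≤ u (y + t • v) ^ 2 := by
        have := abs_le.mp (hu.le1 (y + t • v))
        nlinarith
      have h10 : 66 / 100 ≤ u (y + t • v) * u y := by nlinarith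
      rw [dqc]
      linarith
    · simp [hφ.zero_two hr hy]
  rw [integral_const_mul] at h1
  have hBf : 0 ≤ Bf n s (fun y => φ y * dq u v t y) :=
    integral_nonneg fun q => mul_nonneg (sq_nonneg _) (J_nonneg _)
  have h2 := ball_le_bump hbl.continuous hφ
  have h3 : τ * ∫ y in ball x r, dq u v t y ^ 2 ≤ |Df n s φ (dq u v t)| := by
    have e1 : τ * ∫ y in ball x r, dq u v t y ^ 2 ≤ τ * ∫ y, (φ y * dq u v t y) ^ 2 := by gcongr
    have e2 := mul_le_mul_of_nonneg_left h1 hτ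
    have e3 := le_abs_self (Df n s φ (dq u v t))
    linarith
  have h4 := setIntegral_abs_le hbl.continuous x (mul_pos two_pos hr) hr
  set I := ∫ y in ball x (2 * r), dq u v t y ^ 2 with hI
  have hrs : r ^ s * r ^ (-s) = 1 := by rw [← rpow_add hr]; simp
  have hrs1 : r ^ (-1 - s) = r ^ (-s) * r⁻¹ := by
    rw [sub_eq_neg_add, rpow_add hr, rpow_neg_one]
  have hpos : 0 < r ^ (-s) := rpow_pos_of_pos hr _
  have hpos' : 0 < r ^ s := rpow_pos_of_pos hr _
  have hT : 0 ≤ r ^ n / r ^ 2 := by positivity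
  have hI0 : 0 ≤ I := integral_nonneg fun y => sq_nonneg _
  rw [hrs1] at hD
  calc τ * r ^ s * ∫ y in ball x r, dq u v t y ^ 2
      = r ^ s * (τ * ∫ y in ball x r, dq u v t y ^ 2) := by ring
    _ ≤ r ^ s * (C₁ * (1 / 2 * r ^ (-s) * I + (1 / 2 : ℝ)⁻¹ ^ 2 * (r ^ (-s) * r⁻¹) *
          (r * I + r⁻¹ * (omega n * (2 * r) ^ n)))) := by
        refine mul_le_mul_of_nonneg_left (h3.trans (hD.trans ?_)) hpos'.le
        gcongr
    _ = (r ^ s * r ^ (-s)) * (C₁ * (9 / 2 * I + 4 * (omega n * 2 ^ n) * (r ^ n / r ^ 2))) := by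
        rw [mul_pow]
        field_simp
        ring
    _ ≤ C₁ * (5 * (A * (r ^ n / r ^ 2)) + 4 * (omega n * 2 ^ n) * (r ^ n / r ^ 2)) := by
        rw [hrs, one_mul]
        gcongr
        norm_num
    _ ≤ _ := by
        have hA0 := hI0.trans hA
        have : 0 ≤ C₁ * (5 * (r ^ n / r ^ 2) + 4 * (omega n * 2 ^ n) * (A * (r ^ n / r ^ 2))) := by
          positivity
        linarith

end

end FracAC

namespace FracAC

noncomputable section

variable {s : ℝ}

lemma norm_map_one (L : ℝ ≃ₗᵢ[ℝ] Rn 1) : ‖L 1‖ = 1 := by simp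

lemma osc_le_setIntegral (L : ℝ ≃ₗᵢ[ℝ] Rn 1) {u : Rn 1 → ℝ} (hu : ContDiff ℝ 1 u) {x y : Rn 1}
    {ρ : ℝ} (hy : y ∈ ball x ρ) :
    |u y - u x| ≤ ∫ z in ball x ρ, |fderiv ℝ u z (L 1)| := by
  have hL : ∀ t, L t = t • L 1 := fun t => by rw [← map_smul, smul_eq_mul, mul_one]
  have hc : Continuous fun z => fderiv ℝ u z (L 1) :=
    (hu.continuous_fderiv one_ne_zero).clm_apply continuous_const
  have hmp : MeasurePreserving (fun t : ℝ => x + L t) volume volume :=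
    (measurePreserving_add_left volume x).comp L.measurePreserving
  have hemb : MeasurableEmbedding fun t : ℝ => x + L t :=
    (MeasurableEquiv.addLeft x).measurableEmbedding.comp
      L.toHomeomorph.measurableEmbedding
  have hpre : (fun t : ℝ => x + L t) ⁻¹' ball x ρ = ball 0 ρ := by
    ext t
    simp [mem_ball, dist_eq_norm]
  rw [← hmp.setIntegral_preimage_emb hemb, hpre]
  have hcL : Continuous fun t : ℝ => x + L t := continuous_const.add L.continuous
  set c : ℝ := L.symm (y - x) with hcdef
  have hyc : y = x + L c := by simp [hcdef]
  have hcρ : |c| < ρ := by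
    rw [← Real.norm_eq_abs, hcdef, L.symm.norm_map, ← dist_eq_norm]
    exact hy
  have hderiv : ∀ t : ℝ, HasDerivAt (fun t => u (x + L t)) (fderiv ℝ u (x + L t) (L 1)) t := by
    intro t
    have h1 : HasDerivAt (fun t : ℝ => x + L t) (L 1) t := by
      have h2 : HasDerivAt (fun t : ℝ => x + t • L 1) ((1 : ℝ) • L 1) t :=
        ((hasDerivAt_id t).smul_const (L 1)).const_add x
      rw [one_smul] at h2
      exact h2.congr_of_eventuallyEq (Eventually.of_forall fun t => by simp only [hL t])
    exact ((hu.differentiable one_ne_zero) _).hasFDerivAt.comp_hasDerivAt t h1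
  have hg : Continuous fun t : ℝ => fderiv ℝ u (x + L t) (L 1) := hc.comp hcL
  have hint := intervalIntegral.integral_eq_sub_of_hasDerivAt (a := 0) (b := c)
    (fun t _ => hderiv t) (hg.intervalIntegrable _ _)
  have e : u y - u x = ∫ t in (0 : ℝ)..c, fderiv ℝ u (x + L t) (L 1) := by
    rw [hint, hyc, map_zero, add_zero]
  rw [e, ← Real.norm_eq_abs]
  refine intervalIntegral.norm_integral_le_integral_norm_uIoc.trans ?_
  refine setIntegral_mono_set ?_ (ae_of_all _ fun t => abs_nonneg _) (Eventually.of_forall ?_)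
  · exact (hg.abs.continuousOn.integrableOn_compact (isCompact_closedBall 0 ρ)).mono_set
      ball_subset_closedBall
  · intro t ht
    have ht' : t ∈ uIoc 0 c := ht
    change t ∈ ball (0 : ℝ) ρ
    rw [mem_ball, dist_zero_right, Real.norm_eq_abs]
    rw [mem_uIoc] at ht'
    rw [abs_lt] at hcρ ⊢
    rcases ht' with h | h <;> constructor <;> linarith [h.1, h.2]

lemma kq_integral_le {p : Rn 1} {q : Rn 1 × ℝ} {R rs β : ℝ} (hβ : 0 < β) (hrs : 0 < rs)
    (hq : rs ≤ q.2) :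
    ∫ y in ball p (3 * R / 4), max ‖y - q.1‖ q.2 ^ (-(1 + β)) ≤
      omega 1 * (1 + 1 / β) * rs ^ (-β) := by
  have hq0 := hrs.trans_le hq
  have hω := omega_pos 1
  obtain ⟨h1, h2⟩ := kq_integral (n := 1) le_rfl hβ hq0
  calc ∫ y in ball p (3 * R / 4), max ‖y - q.1‖ q.2 ^ (-(1 + β))
      ≤ ∫ y, kq 1 β q.2 (y - q.1) := by
        have e : (fun y : Rn 1 => max ‖y - q.1‖ q.2 ^ (-(1 + β))) =
            fun y => kq 1 β q.2 (y - q.1) := by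
          funext y
          rw [kq, Nat.cast_one]
        rw [e]
        exact setIntegral_le_integral (h1.comp_sub_right q.1) (ae_of_all _ fun y => kq_nonneg _)
    _ = omega 1 * (1 + 1 / β) * q.2 ^ (-β) := by
        rw [integral_sub_right_eq_self (μ := volume) (kq 1 β q.2), h2, Nat.cast_one]
    _ ≤ _ := by
        have := rpow_le_rpow_of_nonpos hrs hq (neg_nonpos.mpr hβ.le)
        gcongr

end

end FracAC

namespace FracAC

noncomputable section

variable {s : ℝ}

lemma energy_gain {s₀ : ℝ} (hs₀ : s₀ ∈ Ioo (0 : ℝ) 1) {κ : ℝ} (hκ0 : 0 ≤ κ) :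
    ∃ η C₈ : ℝ, 0 < η ∧ η ≤ 1 ∧ 0 < C₈ ∧ ∀ s ∈ Ioo s₀ 1, ∀ (τ K R N : ℝ) (u ℓ : Rn 1 → ℝ)
      (p : Rn 1) (L : ℝ ≃ₗᵢ[ℝ] Rn 1),
      Sol 1 s τ K u p R → 0 < τ → Scale 1 s τ u p R κ ℓ → 2 ≤ N →
      κ * N ^ (-s) ≤ cP 1 / 16 → ∀ x r₀, 0 < r₀ → 4 * N * r₀ ≤ ℓ x →
        (1 - s) * (τ * (η * r₀) ^ s) * ∫ y in ball x (η * r₀), fderiv ℝ u y (L 1) ^ 2 ≤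
          C₈ * (η * r₀)⁻¹ := by
  obtain ⟨C, hC, Hφ⟩ := exists_bump 1
  obtain ⟨C₄', hC₄', HA⟩ := absorption le_rfl hs₀ (n := 1)
  obtain ⟨C₄, hC₄, HE⟩ := energy_decay le_rfl hs₀ (n := 1)
  obtain ⟨C₆, hC₆, HP⟩ := gain_phase le_rfl hs₀ (zero_le_one.trans hC) (n := 1)
  have hω := omega_pos 1
  have hs00 := hs₀.1
  set η : ℝ := (80000 * C₄ * omega 1 + 2)⁻¹ with hη
  have hη0 : 0 < η := by positivity
  have hη2 : 2 * η ≤ 1 := by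
    rw [hη, ← div_eq_mul_inv, div_le_one (by positivity)]
    have : 0 ≤ 80000 * C₄ * omega 1 := by positivity
    linarith
  have hηC : 80000 * C₄ * omega 1 * η ≤ 1 := by
    rw [hη, ← div_eq_mul_inv, div_le_one (by positivity)]
    linarith
  set C₇ : ℝ := 100 * (C * omega 1 * (1 : ℕ) * 2 ^ 1 / s₀ + κ * 2 ^ 1) with hC₇
  have hC₇0 : 0 < C₇ := by
    rw [hC₇, Nat.cast_one]
    positivity
  refine ⟨η, C₇ * C₄ + C₆ * (C₄' / 2 + 1), hη0, by linarith, by positivity, ?_⟩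
  intro s hs τ K R N u ℓ p L hu hτ hℓ hN hκ x r₀ hr₀ hx
  have hv := norm_map_one L
  have hs' : s ∈ Ioo (0 : ℝ) 1 := ⟨hs₀.1.trans hs.1, hs.2⟩
  set r : ℝ := η * r₀ with hr
  have hr0 : 0 < r := by positivity
  have hrr : 2 * r ≤ r₀ := by
    rw [hr, ← mul_assoc]
    exact mul_le_of_le_one_left hr₀.le hη2
  have hℓx := hℓ.le x
  have h8 : 8 * r₀ ≤ ℓ x := le_trans (by gcongr; linarith) hx
  have hxp := norm_nonneg (x - p)
  have hR : 0 < R := by linarith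
  have hsub : ∀ t, t ≤ R / 8 → ball x (2 * r + t) ⊆ ball p R := fun t ht y hy => by
    rw [mem_ball, dist_eq_norm] at hy ⊢
    have h2 := norm_sub_le_norm_sub_add_norm_sub y x p
    linarith
  have hcd : Continuous fun y => fderiv ℝ u y (L 1) :=
    (hu.cd.continuous_fderiv one_ne_zero).clm_apply continuous_const
  have hosc : ∀ y ∈ ball x (2 * r), |u y - u x| ≤ 1 / 100 := by
    intro y hy
    refine (osc_le_setIntegral L hu.cd hy).trans ?_
    have e1 := setIntegral_abs_le hcd x (mul_pos two_pos hr0)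
      (a := r₀ / (200 * C₄)) (by positivity)
    have e2 := HE s hs τ K R κ N u ℓ p (L 1) hu hτ.le hℓ hv hN hκ x r₀ hr₀ hx
    have e3 : ∫ y in ball x (2 * r), fderiv ℝ u y (L 1) ^ 2 ≤
        ∫ y in ball x r₀, fderiv ℝ u y (L 1) ^ 2 := by
      refine setIntegral_mono_set ?_ (ae_of_all _ fun t => sq_nonneg _)
        (ball_subset_ball hrr).eventuallyLE
      exact ((hcd.pow 2).continuousOn.integrableOn_compact (isCompact_closedBall x r₀)).mono_set
        ball_subset_closedBall
    refine e1.trans ?_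
    calc _ ≤ r₀ / (200 * C₄) * (C₄ * (r₀ ^ 1 / r₀ ^ 2)) +
          (r₀ / (200 * C₄))⁻¹ * (omega 1 * (2 * r) ^ 1) := by
          gcongr
          exact e3.trans e2
      _ = 1 / 200 + 80000 * C₄ * omega 1 * η / 200 := by
          rw [hr]
          field_simp
          ring
      _ ≤ _ := by linarith
  have hD : r ^ 1 / r ^ 2 = r⁻¹ := by field_simp
  have hrs : 0 < r ^ s := rpow_pos_of_pos hr0 _
  have h1s : 0 < 1 - s := by linarith [hs.2]
  have hE : ∫ y in ball x r, fderiv ℝ u y (L 1) ^ 2 ≤ C₄ * r⁻¹ := by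
    rw [← hD]
    exact HE s hs τ K R κ N u ℓ p (L 1) hu hτ.le hℓ hv hN hκ x r hr0
      (le_trans (by gcongr; linarith) hx)
  have hE0 : 0 ≤ ∫ y in ball x r, fderiv ℝ u y (L 1) ^ 2 := integral_nonneg fun y => sq_nonneg _
  obtain ⟨φ, hφ⟩ := Hφ x r hr0
  have hrest : 0 ≤ C₆ * (C₄' / 2 + 1) * r⁻¹ := by positivity
  have hrest' : 0 ≤ C₇ * C₄ * r⁻¹ := by positivity
  have hlow : (1 - s) * (τ * r ^ s) ≤ C₇ → (1 - s) * (τ * r ^ s) *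
      ∫ y in ball x r, fderiv ℝ u y (L 1) ^ 2 ≤ (C₇ * C₄ + C₆ * (C₄' / 2 + 1)) * r⁻¹ := by
    intro h
    calc _ ≤ C₇ * (C₄ * r⁻¹) := by gcongr
      _ ≤ _ := by linarith
  rcases le_total (u x ^ 2) (3 / 10) with hux | hux
  · exact hlow (gain_stable le_rfl hs₀ hs hC hr0 hφ hu.bl hτ.le hκ0
      (hℓ.st x (2 * r) (by positivity) (by linarith)) hosc hux)
  rcases le_total (u x ^ 2) (7 / 10) with hux' | hux'
  · refine hlow ((gain_transition le_rfl hs₀ hs hC hr0 hφ hu hτ.le ?_ hosc hux hux').trans ?_)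
    · have := hsub 0 (by positivity)
      rwa [add_zero] at this
    · rw [hC₇]
      have : 0 ≤ κ * 2 ^ 1 := by positivity
      gcongr
      linarith
  obtain ⟨t₀, ht₀, h₀⟩ := exists_small (τ := τ) (K := K) (R := R / 8)
    (c := cP 1 / 16 * R ^ (-s)) (by positivity)
    (mul_pos (by linarith [cP_pos 1]) (rpow_pos_of_pos hR _)) hτ.le hu.bl.nonneg
  obtain ⟨t₁, ht₁, h₁⟩ := exists_small (τ := 1 / 3) (K := K) (R := R) (c := 1 / 100) hR
    (by norm_num) (by norm_num) hu.bl.nonneg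
  have hfin := sq_le_of_small hu.cd hu.bl hv x r (M := C₆ * (C₄' / 2 + 1) * r⁻¹ / (τ * r ^ s))
    (lt_min ht₀ ht₁) (fun t ht htt => by
      obtain ⟨g1, g2⟩ := h₀ t ht (htt.trans_le (min_le_left _ _))
      obtain ⟨-, g3⟩ := h₁ t ht (htt.trans_le (min_le_right _ _))
      have g4 := HA s hs τ K R t κ N u ℓ p (L 1) hu hτ.le hℓ ht g1 g2 hv hN hκ x (2 * r)
        (by positivity) (le_trans (by gcongr) hx)
      have g5 := HP s hs τ K R t r (C₄' / 2) u φ p (L 1) x hu hτ.le ht hv hr0 hφ (hsub t g1)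
        (by linarith) hosc hux' (g4.trans (le_of_eq (by field_simp)))
      rw [le_div_iff₀ (by positivity), mul_comm]
      rwa [hD] at g5)
  rw [le_div_iff₀ (by positivity)] at hfin
  calc _ = (1 - s) * ((∫ y in ball x r, fderiv ℝ u y (L 1) ^ 2) * (τ * r ^ s)) := by ring
    _ ≤ 1 * (C₆ * (C₄' / 2 + 1) * r⁻¹) := by
        gcongr
        linarith [hs'.1]
    _ ≤ _ := by linarith

lemma abs_gain {s₀ : ℝ} (hs₀ : s₀ ∈ Ioo (0 : ℝ) 1) {κ : ℝ} (hκ0 : 0 ≤ κ) :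
    ∃ η C₉ : ℝ, 0 < η ∧ η ≤ 1 ∧ 0 < C₉ ∧ ∀ s ∈ Ioo s₀ 1, ∀ (τ K R N : ℝ) (u ℓ : Rn 1 → ℝ)
      (p : Rn 1) (L : ℝ ≃ₗᵢ[ℝ] Rn 1),
      Sol 1 s τ K u p R → 0 < τ → Scale 1 s τ u p R κ ℓ → 2 ≤ N →
      κ * N ^ (-s) ≤ cP 1 / 16 → ∀ x r₀, 0 < r₀ → 4 * N * r₀ ≤ ℓ x →
        ∫ y in ball x (η * r₀), |fderiv ℝ u y (L 1)| ≤
          C₉ * ((√((1 - s) * τ))⁻¹ * (η * r₀) ^ (-(s / 2))) := by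
  obtain ⟨η, C₈, hη, hη1, hC₈, H⟩ := energy_gain hs₀ hκ0
  have hω := omega_pos 1
  refine ⟨η, C₈ + omega 1, hη, hη1, by positivity, ?_⟩
  intro s hs τ K R N u ℓ p L hu hτ hℓ hN hκ x r₀ hr₀ hx
  have h := H s hs τ K R N u ℓ p L hu hτ hℓ hN hκ x r₀ hr₀ hx
  set r : ℝ := η * r₀ with hr
  have hr0 : 0 < r := by positivity
  have h1s : 0 < 1 - s := by linarith [hs.2]
  have hcd : Continuous fun y => fderiv ℝ u y (L 1) :=
    (hu.cd.continuous_fderiv one_ne_zero).clm_apply continuous_const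
  set b : ℝ := √((1 - s) * τ) with hb
  have hb0 : 0 < b := Real.sqrt_pos.mpr (by positivity)
  have hb2 : b ^ 2 = (1 - s) * τ := Real.sq_sqrt (by positivity)
  set d : ℝ := r ^ (s / 2) with hd
  have hd0 : 0 < d := rpow_pos_of_pos hr0 _
  have hd2 : d ^ 2 = r ^ s := by
    rw [hd, ← rpow_natCast, ← rpow_mul hr0.le]
    norm_num
  have hdi : r ^ (-(s / 2)) = d⁻¹ := rpow_neg hr0.le _
  rw [hdi]
  rw [← mul_assoc, ← hb2, ← hd2] at h
  refine (setIntegral_abs_le hcd x hr0 (a := r * (b * d)) (by positivity)).trans ?_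
  have h2 : ∫ y in ball x r, fderiv ℝ u y (L 1) ^ 2 ≤ C₈ * r⁻¹ / (b ^ 2 * d ^ 2) := by
    rw [le_div_iff₀ (by positivity), mul_comm]
    exact h
  calc _ ≤ r * (b * d) * (C₈ * r⁻¹ / (b ^ 2 * d ^ 2)) + (r * (b * d))⁻¹ * (omega 1 * r ^ 1) := by
        gcongr
    _ = _ := by field_simp

lemma bound_one {s₀ : ℝ} (hs₀ : s₀ ∈ Ioo (0 : ℝ) 1) (m : ℕ) :
    ∃ C : ℝ, 0 < C ∧ ∀ s ∈ Ioo s₀ 1, ∀ (τ K R : ℝ) (u : Rn 1 → ℝ) (p : Rn 1)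
      (L : ℝ ≃ₗᵢ[ℝ] Rn 1),
      Sol 1 s τ K u p R → 0 < τ → 0 < R → IdxLE 1 s τ u (ball p R) m →
      ∫ x in ball p (R / 2), |fderiv ℝ u x (L 1)| ≤ C / (1 - s) := by
  have hω := omega_pos 1
  have hcp := cP_pos 1
  obtain ⟨C₅, hC₅, H₅⟩ := abs_decay le_rfl hs₀ (n := 1)
  obtain ⟨η, C₉, hη, hη1, hC₉, H₉⟩ := abs_gain hs₀ (κ := (m + 1) * omega 1) (by positivity)
  obtain ⟨N, hN, hNs⟩ := exists_ratio hs₀.1 (κ := (m + 1) * omega 1) (c := cP 1 / 16)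
    (by positivity) (by linarith)
  have hs00 := hs₀.1
  set a : ℝ := 4 * N / η with ha
  have ha0 : 0 < a := by positivity
  have ha4 : 4 ≤ a := by
    rw [ha, le_div_iff₀ hη]
    nlinarith
  set E : ℝ := C₉ * a ^ 2 * 6 ^ 2 * (omega 1 * (1 + 2 / s₀)) * √(4 / cP 1) with hE
  have hE0 : 0 ≤ E := by positivity
  set C : ℝ := (omega 1 * (4 / 9) ^ 1)⁻¹ * (8 * (C₅ * a) * omega 1 + m * E) with hC
  have hC0 : 0 < C := by positivity
  refine ⟨C, hC0, ?_⟩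
  intro s hs τ K R u p L hu hτ hR hidx
  have hv := norm_map_one L
  have hs' : s ∈ Ioo (0 : ℝ) 1 := ⟨hs₀.1.trans hs.1, hs.2⟩
  have hs0 := hs'.1
  have h1s : 0 < 1 - s := by linarith [hs.2]
  obtain ⟨rs, S, hrs, hrsτ, hSm, hS, hsc⟩ := exists_scale le_rfl hs' hu.bl hτ hidx
  have hcont : Continuous fun y => |fderiv ℝ u y (L 1)| :=
    ((hu.cd.continuous_fderiv one_ne_zero).clm_apply continuous_const).abs
  set b : ℝ := √((1 - s) * τ) with hb
  have hb0 : 0 < b := Real.sqrt_pos.mpr (by positivity)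
  have e0 : ∀ x, ell S p R x / a = η * (ell S p R x / (4 * N)) := fun x => by
    rw [ha]
    field_simp
  have h := averaged_bound (n := 1) hcont (fun _ => abs_nonneg _) (β := 1 + s / 2)
    (D := omega 1 * (1 + 1 / (s / 2)) * rs ^ (-(s / 2))) (c₁ := C₅ * a) (c₂ := C₉ * a ^ 2 * b⁻¹)
    hR hrs hSm (fun q hq => (hS q hq).1) ha4 (by positivity) (by positivity) (by positivity)
    (by positivity)
    (fun x hx => by
      refine (H₅ s hs τ K R _ N u _ p (L 1) hu hτ.le hsc hv hN (hNs s hs.1) x _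
        (div_pos hx ha0) ?_).trans (le_of_eq ?_)
      · rw [e0]
        have e1 : 4 * N * (η * (ell S p R x / (4 * N))) = η * ell S p R x := by field_simp
        rw [e1]
        exact mul_le_of_le_one_left hx.le hη1
      · field_simp)
    (fun x hx => by
      have h9 := H₉ s hs τ K R N u _ p L hu hτ hsc hN (hNs s hs.1) x (ell S p R x / (4 * N))
        (by positivity) (by rw [mul_div_cancel₀ _ (by positivity)])
      rw [← e0] at h9
      refine h9.trans ?_
      set l := ell S p R x with hl
      have e1 : (l / a) ^ (-(s / 2)) = l ^ (-(s / 2)) * a ^ (s / 2) := by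
        rw [div_rpow hx.le ha0.le, rpow_neg ha0.le, div_inv_eq_mul]
      have e2 : l ^ (-(1 + s / 2)) = l⁻¹ * l ^ (-(s / 2)) := by
        rw [neg_add, rpow_add hx, rpow_neg_one]
      have e3 : a ^ (s / 2) ≤ a := by
        calc a ^ (s / 2) ≤ a ^ (1 : ℝ) :=
              rpow_le_rpow_of_exponent_le (by linarith) (by linarith [hs'.2])
          _ = a := rpow_one a
      have hlp : 0 < l ^ (-(s / 2)) := rpow_pos_of_pos hx _
      rw [e1, e2]
      calc _ ≤ C₉ * (b⁻¹ * (l ^ (-(s / 2)) * a)) := by gcongr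
        _ = _ := by
            have := hx.ne'
            field_simp)
    (fun q hq => kq_integral_le (by positivity) hrs (hS q hq).1)
  have hω2 : 0 < omega 1 * (4 / 9) ^ 1 := by positivity
  rw [← le_div_iff₀' hω2] at h
  refine h.trans ?_
  have f1 : rs ^ (-(s / 2)) = √(4 / cP 1) * √τ := by
    rw [← Real.sqrt_mul (by positivity), div_mul_eq_mul_div, ← hrsτ, Real.sqrt_eq_rpow,
      ← rpow_mul hrs.le]
    congr 1
    ring
  have f2 : b = √(1 - s) * √τ := by rw [hb, Real.sqrt_mul h1s.le]
  have f3 : (6 : ℝ) ^ (1 + s / 2) ≤ 6 ^ 2 := by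
    rw [← rpow_natCast]
    exact rpow_le_rpow_of_exponent_le (by norm_num) (by push_cast; linarith [hs'.2])
  have f4 : 1 + 1 / (s / 2) ≤ 1 + 2 / s₀ := by
    rw [one_div_div]
    have := hs.1.le
    gcongr
  have hq1 : 0 < √(1 - s) := Real.sqrt_pos.mpr h1s
  have hqτ : 0 < √τ := Real.sqrt_pos.mpr hτ
  have f5 : (√(1 - s))⁻¹ ≤ (1 - s)⁻¹ := by
    refine inv_anti₀ h1s ?_
    refine Real.le_sqrt_of_sq_le ?_
    nlinarith
  have f6 : C₉ * a ^ 2 * b⁻¹ * 6 ^ (1 + s / 2) *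
      (omega 1 * (1 + 1 / (s / 2)) * rs ^ (-(s / 2))) ≤ E * (1 - s)⁻¹ := by
    have hc4 : 0 ≤ √(4 / cP 1) := Real.sqrt_nonneg _
    calc _ ≤ C₉ * a ^ 2 * b⁻¹ * 6 ^ 2 * (omega 1 * (1 + 2 / s₀) * rs ^ (-(s / 2))) := by gcongr
      _ = E * (√(1 - s))⁻¹ := by
          rw [f1, f2, hE]
          field_simp
      _ ≤ _ := by gcongr
  have f7 : (1 : ℝ) ≤ (1 - s)⁻¹ := by
    rw [one_le_inv₀ h1s]
    linarith
  calc _ ≤ (8 * (C₅ * a) * omega 1 * (1 - s)⁻¹ + m * (E * (1 - s)⁻¹)) /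
        (omega 1 * (4 / 9) ^ 1) := by
        rw [pow_one R, div_self hR.ne']
        gcongr
    _ = _ := by
        rw [hC]
        ring

end

end FracAC

namespace FracAC

noncomputable section

variable {n : ℕ} {s : ℝ}

lemma alphaC_pos (hs : s ∈ Ioo (0 : ℝ) 1) : 0 < alphaC n s := by
  obtain ⟨h0, h1⟩ := hs
  have e1 : 0 < Real.Gamma (((n : ℝ) + s) / 2) := Real.Gamma_pos_of_pos (by positivity)
  have e2 : 0 < Real.Gamma (1 - s / 2) := Real.Gamma_pos_of_pos (by linarith)
  unfold alphaC
  positivity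

lemma Qform_eq {ε τ : ℝ} (hα : 0 < alphaC n s) (hτ : τ = ε ^ (-s) / alphaC n s)
    {u ζ : Rn n → ℝ} {Ω : Set (Rn n)} (hζ : ∀ x ∉ Ω, ζ x = 0) :
    Qform n s ε u Ω ζ = alphaC n s * qf n s τ u ζ := by
  have hετ : ε ^ (-s) = alphaC n s * τ := by rw [hτ]; field_simp
  have e1 : ∫ p in ((Ωᶜ ×ˢ Ωᶜ)ᶜ : Set (Rn n × Rn n)), (ζ p.1 - ζ p.2) ^ 2 * fracKer n s p.1 p.2
      = alphaC n s * Bf n s ζ := by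
    rw [setIntegral_eq_integral_of_forall_compl_eq_zero, Bf, ← integral_const_mul]
    · refine integral_congr_ae (Eventually.of_forall fun p => ?_)
      simp only [fracKer, J]
      ring
    · intro p hp
      rw [Set.notMem_compl_iff] at hp
      simp [hζ p.1 hp.1, hζ p.2 hp.2]
  have e2 : ∫ x in Ω, (3 * u x ^ 2 - 1) * ζ x ^ 2 = ∫ x, (3 * u x ^ 2 - 1) * ζ x ^ 2 :=
    setIntegral_eq_integral_of_forall_compl_eq_zero fun x hx => by simp [hζ x hx]
  rw [Qform, e1, e2, qf, hετ]
  ring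

lemma idxLE_of_ACMorseIndexLE {ε τ : ℝ} (hα : 0 < alphaC n s)
    (hτ : τ = ε ^ (-s) / alphaC n s) {u : Rn n → ℝ} {Ω : Set (Rn n)} {m : ℕ}
    (h : ACMorseIndexLE n s ε u Ω m) : IdxLE n s τ u Ω m := by
  intro ξ hξ hli
  obtain ⟨a, ha, hQ⟩ := h ξ hξ hli
  refine ⟨a, ha, ?_⟩
  rw [Qform_eq hα hτ fun x hx => Finset.sum_eq_zero fun i _ => by rw [cc1_zero (hξ i) hx, mul_zero]]
    at hQ
  exact nonneg_of_mul_nonneg_right hQ hα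

lemma sol_of_isACSol {ε τ K R : ℝ} (hα : 0 < alphaC n s)
    (hτ : τ = ε ^ (-s) / alphaC n s) {u : Rn n → ℝ} {p : Rn n}
    (hu1 : ∀ x, u x ∈ Ioo (-1 : ℝ) 1) (hu : ContDiff ℝ 1 u) (hK : ∀ x, ‖fderiv ℝ u x‖ ≤ K)
    (h : IsACSol n s ε u (ball p R)) : Sol n s τ (max 1 K) u p R := by
  have hle : ∀ x, |u x| ≤ 1 := fun x => abs_le.2 ⟨(hu1 x).1.le, (hu1 x).2.le⟩
  refine ⟨hu, ⟨fun x => (hle x).trans (le_max_left _ _), fun x y => ?_⟩, hle, fun x hx => ?_⟩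
  · exact convex_univ.norm_image_sub_le_of_norm_fderiv_le (𝕜 := ℝ)
      (fun z _ => hu.differentiable one_ne_zero z)
      (fun z _ => (hK z).trans (le_max_right _ _)) (mem_univ y) (mem_univ x)
  · have e := h x hx
    have e1 : ∫ y, (u x - u y) * fracKer n s x y = alphaC n s * Lop n s u x := by
      rw [Lop, ← integral_const_mul]
      refine integral_congr_ae (Eventually.of_forall fun y => ?_)
      simp only [fracKer, J]
      ring
    have hετ : ε ^ (-s) = alphaC n s * τ := by rw [hτ]; field_simp
    rw [e1, hετ, mul_assoc, ← mul_add] at e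
    exact (mul_eq_zero.1 e).resolve_left hα.ne'

lemma norm_le_sum_coord (f : Rn n →L[ℝ] ℝ) :
    ‖f‖ ≤ ∑ i, |f (EuclideanSpace.single i 1)| := by
  refine f.opNorm_le_bound (Finset.sum_nonneg fun i _ => abs_nonneg _) fun x => ?_
  have hx : x = ∑ i, x i • EuclideanSpace.single i (1 : ℝ) := by
    ext j
    simp [Pi.single_apply]
  calc ‖f x‖ = ‖∑ i, x i * f (EuclideanSpace.single i 1)‖ := by
        conv_lhs => rw [hx, map_sum]
        simp
    _ ≤ ∑ i, ‖x i * f (EuclideanSpace.single i 1)‖ := norm_sum_le _ _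
    _ ≤ ∑ i, |f (EuclideanSpace.single i 1)| * ‖x‖ := by
        refine Finset.sum_le_sum fun i _ => ?_
        rw [norm_mul, mul_comm, Real.norm_eq_abs (f _)]
        gcongr
        exact PiLp.norm_apply_le x i
    _ = _ := by rw [Finset.sum_mul]

lemma norm_le_coord_one (L : ℝ ≃ₗᵢ[ℝ] Rn 1) (f : Rn 1 →L[ℝ] ℝ) : ‖f‖ ≤ |f (L 1)| := by
  refine f.opNorm_le_bound (abs_nonneg _) fun x => ?_
  obtain ⟨c, rfl⟩ := L.surjective x
  have hc : L c = c • L 1 := by rw [← map_smul, smul_eq_mul, mul_one]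
  rw [L.norm_map, hc, map_smul, smul_eq_mul, norm_mul, mul_comm, Real.norm_eq_abs (f _)]

lemma integrableOn_ball {f : Rn n → ℝ} (hf : Continuous f) (p : Rn n) (R : ℝ) :
    IntegrableOn f (ball p R) :=
  (hf.continuousOn.integrableOn_compact (isCompact_closedBall p R)).mono_set ball_subset_closedBall

lemma norm_fderiv_bound (hn : 1 ≤ n) {s₀ : ℝ} (hs₀ : s₀ ∈ Ioo (0 : ℝ) 1) (m : ℕ) :
    ∃ C : ℝ, 0 < C ∧ ∀ s ∈ Ioo s₀ 1, ∀ (τ K R : ℝ) (u : Rn n → ℝ) (p : Rn n),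
      Sol n s τ K u p R → 0 < τ → 0 < R → IdxLE n s τ u (ball p R) m →
      ∫ x in ball p (R / 2), ‖fderiv ℝ u x‖ ≤ C / (1 - s) * R ^ (n - 1) := by
  obtain rfl | hn2 := hn.eq_or_lt
  · obtain ⟨C, hC, H⟩ := bound_one hs₀ m
    refine ⟨C, hC, fun s hs τ K R u p hu hτ hR hidx => ?_⟩
    let L : ℝ ≃ₗᵢ[ℝ] Rn 1 := (OrthonormalBasis.singleton (Fin 1) ℝ).repr
    have hc := hu.cd.continuous_fderiv one_ne_zero
    calc ∫ x in ball p (R / 2), ‖fderiv ℝ u x‖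
        ≤ ∫ x in ball p (R / 2), |fderiv ℝ u x (L 1)| :=
          setIntegral_mono (integrableOn_ball hc.norm _ _)
            (integrableOn_ball (hc.clm_apply continuous_const).abs _ _)
            fun x => norm_le_coord_one L _
      _ ≤ _ := by simpa using H s hs τ K R u p L hu hτ hR hidx
  · obtain ⟨C, hC, H⟩ := directional_bound_high hn2 hs₀ m
    refine ⟨n * C, by positivity, fun s hs τ K R u p hu hτ hR hidx => ?_⟩
    have hc := hu.cd.continuous_fderiv one_ne_zero
    have hi : ∀ i : Fin n, IntegrableOn
        (fun x => |fderiv ℝ u x (EuclideanSpace.single i 1)|) (ball p (R / 2)) := fun i =>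
      integrableOn_ball (hc.clm_apply continuous_const).abs _ _
    calc ∫ x in ball p (R / 2), ‖fderiv ℝ u x‖
        ≤ ∫ x in ball p (R / 2), ∑ i, |fderiv ℝ u x (EuclideanSpace.single i 1)| :=
          setIntegral_mono (integrableOn_ball hc.norm _ _)
            (integrable_finsetSum _ fun i _ => hi i) fun x => norm_le_sum_coord _
      _ = ∑ i, ∫ x in ball p (R / 2), |fderiv ℝ u x (EuclideanSpace.single i 1)| :=
          integral_finsetSum _ fun i _ => hi i
      _ ≤ ∑ _i : Fin n, C / (1 - s) * R ^ (n - 1) :=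
          Finset.sum_le_sum fun i _ => H s hs τ K R u p _ hu hτ hR hidx (by simp)
      _ = _ := by
          rw [Finset.sum_const, Finset.card_univ, Fintype.card_fin, nsmul_eq_mul]
          ring

end
end FracAC

noncomputable section

/-- **BV estimate for finite Morse index solutions of fractional Allen–Cahn**
(Theorem 1.9 of the paper, Euclidean version): there exists `C = C(n,s₀,m)` such that any
solution in `B_R(p)` with Morse index at most `m` satisfies
`∫_{B_{R/2}(p)} |∇u| ≤ (C/(1-s)) R^{n-1}`, uniformly in `ε`. -/
theorem bv_estimate_finite_index
    (n : ℕ) (hn : 1 ≤ n) (s₀ : ℝ) (hs₀ : s₀ ∈ Set.Ioo (0 : ℝ) 1) (m : ℕ) :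
    ∃ C : ℝ, 0 < C ∧
    ∀ s : ℝ, s ∈ Set.Ioo s₀ 1 → ∀ ε : ℝ, 0 < ε → ∀ R : ℝ, 0 < R → ∀ p : Rn n,
    ∀ u : Rn n → ℝ, (∀ x, u x ∈ Set.Ioo (-1 : ℝ) 1) → ContDiff ℝ 1 u →
      (∃ K : ℝ, ∀ x, ‖fderiv ℝ u x‖ ≤ K) →
      IsACSol n s ε u (Metric.ball p R) →
      ACMorseIndexLE n s ε u (Metric.ball p R) m →
      (∫ x in Metric.ball p (R / 2), ‖fderiv ℝ u x‖) ≤ C / (1 - s) * R ^ (n - 1) := by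
  obtain ⟨C, hC, H⟩ := FracAC.norm_fderiv_bound hn hs₀ m
  refine ⟨C, hC, fun s hs ε hε R hR p u hu1 hu ⟨K, hK⟩ hsol hidx => ?_⟩
  have hα : 0 < alphaC n s := FracAC.alphaC_pos ⟨hs₀.1.trans hs.1, hs.2⟩
  exact H s hs (ε ^ (-s) / alphaC n s) (max 1 K) R u p
    (FracAC.sol_of_isACSol hα rfl hu1 hu hK hsol) (by positivity) hR
    (FracAC.idxLE_of_ACMorseIndexLE hα rfl hidx)

end
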